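/- arXiv:2403.01302 — 3 statements merged into one kernel-verified Lean document; each statement's English description precedes it below -/
import Mathlib

section
/- Assume the structural assumptions and condition (3.1) hold with γ≥1, that ρ>0 and ρ₁,…,ρ_M≥0 are constants, and that 𝒦≡0. Then there exist constants C₀>0 and C₀*>0, depending only on the structural data (independent of u₀, u, t), such that, setting β̄=(ν, ν−ν₁, …, ν−ν_M), ℰ(t) = t^{ν−1}·E_{β̄,ν}( −(C₀*/ρ)t^{ν}, −(ρ₁/ρ)t^{ν−ν₁}, …, −(ρ_M/ρ)t^{ν−ν_M} ), and 𝔤(t) = | 1 − (C₀*/ρ)∫₀ᵗ ℰ(s) ds | + Σ_{i=1}^M (ρ_i/ρ)·∫₀ᵗ ω_{1−ν_i}(t−s)ℰ(s) ds + ∫₀ᵗ ω_{1−ν}(t−s)ℰ(s) ds, every classical solution u of the homogeneous Dirichlet problem with initial datum u₀ satisfies sup_{x∈Ω̄}|u(x,t)| ≤ C₀·( 1 + ‖u₀‖_{W^{1,2}}·𝔤(t) ) for all t>0. -/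
open MeasureTheory Set

/-- Kernel whose derivative is the Caputo fractional derivative of order `θ ∈ (0,1)`:
`(1/Γ(1-θ)) ∫₀^τ (τ-s)^(-θ) (v(s) - v(0)) ds`. -/
noncomputable def caputoKernel (θ : ℝ) (v : ℝ → ℝ) (τ : ℝ) : ℝ :=
  (Real.Gamma (1 - θ))⁻¹ * ∫ s in (0:ℝ)..τ, (τ - s) ^ (-θ) * (v s - v 0)

/-- Caputo fractional derivative `D^θ v`. -/
noncomputable def caputo (θ : ℝ) (v : ℝ → ℝ) (t : ℝ) : ℝ := deriv (caputoKernel θ v) t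

/-- `ω_θ(t) = t^(θ-1)/Γ(θ)`. -/
noncomputable def omegaK (θ t : ℝ) : ℝ := t ^ (θ - 1) / Real.Gamma θ

/-- The multinomial Mittag-Leffler function `E_{(β₁,…,β_m),β₀}(z₁,…,z_m)`. -/
noncomputable def mML {m : ℕ} (β : Fin m → ℝ) (β₀ : ℝ) (z : Fin m → ℝ) : ℝ :=
  ∑' k : ℕ, ∑ κ ∈ Finset.Nat.antidiagonalTuple m k,
    ((k.factorial : ℝ) / ∏ j, ((κ j).factorial : ℝ)) *
      (∏ j, z j ^ κ j) / Real.Gamma (β₀ + ∑ j, β j * (κ j : ℝ))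

/-- `ℰ_{β̄,β₀}(t; d̄) = t^(β₀-1) E_{β̄,β₀}(-d₁ t^{β₁}, …, -d_m t^{β_m})`. -/
noncomputable def calE {m : ℕ} (β : Fin m → ℝ) (β₀ : ℝ) (d : Fin m → ℝ) (t : ℝ) : ℝ :=
  t ^ (β₀ - 1) * mML β β₀ (fun j => -(d j) * t ^ (β j))

/-- The function `𝔤` of Corollary 1, built from the multinomial Mittag-Leffler
function with `β̄ = (ν, ν-ν₁, …, ν-ν_M)` and `d̄ = (C₀*/ρ, ρ₁/ρ, …, ρ_M/ρ)`. -/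
noncomputable def gFun (M : ℕ) (ν : ℝ) (νs : Fin M → ℝ) (ρ : ℝ) (ρs : Fin M → ℝ)
    (C₀star : ℝ) (t : ℝ) : ℝ :=
  |1 - C₀star / ρ *
      ∫ s in (0:ℝ)..t,
        calE (Fin.cons ν fun i => ν - νs i) ν (Fin.cons (C₀star / ρ) fun i => ρs i / ρ) s|
    + (∑ i, ρs i / ρ *
        ∫ s in (0:ℝ)..t, omegaK (1 - νs i) (t - s) *
          calE (Fin.cons ν fun i => ν - νs i) ν (Fin.cons (C₀star / ρ) fun i => ρs i / ρ) s)
    + ∫ s in (0:ℝ)..t, omegaK (1 - ν) (t - s) *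
        calE (Fin.cons ν fun i => ν - νs i) ν (Fin.cons (C₀star / ρ) fun i => ρs i / ρ) s

/-! ### Part 1: multinomial Mittag-Leffler series -/

/-- Terms of the Mittag-Leffler series, defined recursively. -/
noncomputable def mlTerm {m : ℕ} (β d : Fin m → ℝ) : ℕ → ℝ → ℝ → ℝ
  | 0, α, t => omegaK α t
  | k + 1, α, t => ∑ j, -(d j) * mlTerm β d k (α + β j) t

noncomputable def mlEv (α t : ℝ) (X : AddMonoidAlgebra ℝ ℝ) : ℝ :=
  X.coeff.sum fun g c => c * omegaK (α + g) t

lemma mlEv_single (α t g c : ℝ) :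
    mlEv α t (AddMonoidAlgebra.single g c) = c * omegaK (α + g) t := by
  simp [mlEv]

lemma mlEv_add (α t : ℝ) (X Y : AddMonoidAlgebra ℝ ℝ) :
    mlEv α t (X + Y) = mlEv α t X + mlEv α t Y := by
  unfold mlEv
  rw [AddMonoidAlgebra.coeff_add, Finsupp.sum_add_index']
  · simp
  · intros; ring

lemma mlEv_zero (α t : ℝ) : mlEv α t 0 = 0 := by
  simp [mlEv]

lemma mlEv_sum {ι : Type*} (α t : ℝ) (s : Finset ι) (X : ι → AddMonoidAlgebra ℝ ℝ) :
    mlEv α t (∑ i ∈ s, X i) = ∑ i ∈ s, mlEv α t (X i) := by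
  classical
  induction s using Finset.induction_on with
  | empty => simp [mlEv_zero]
  | insert a s ha ih => rw [Finset.sum_insert ha, Finset.sum_insert ha, mlEv_add, ih]

lemma mlEv_single_mul (α t g c : ℝ) (X : AddMonoidAlgebra ℝ ℝ) :
    mlEv α t (AddMonoidAlgebra.single g c * X) = c * mlEv (α + g) t X := by
  induction X using AddMonoidAlgebra.induction_linear with
  | zero => simp [mlEv_zero]
  | add X Y hX hY => rw [mul_add, mlEv_add, mlEv_add, hX, hY, mul_add]
  | single h e => rw [AddMonoidAlgebra.single_mul_single, mlEv_single, mlEv_single, add_assoc,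
      mul_assoc]

lemma mlTerm_eq_ev {m : ℕ} (β d : Fin m → ℝ) (k : ℕ) (α t : ℝ) :
    mlTerm β d k α t = mlEv α t ((∑ j, AddMonoidAlgebra.single (β j) (-(d j))) ^ k) := by
  induction k generalizing α with
  | zero => simp [mlTerm, AddMonoidAlgebra.one_def, mlEv_single]
  | succ k ih =>
    rw [pow_succ', Finset.sum_mul, mlEv_sum, mlTerm]
    refine Finset.sum_congr rfl fun j _ => ?_
    rw [mlEv_single_mul, ih]

lemma mlTerm_eq {m : ℕ} (β d : Fin m → ℝ) (k : ℕ) (α t : ℝ) (ht : 0 < t) :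
    t ^ (α - 1) * (∑ κ ∈ Finset.Nat.antidiagonalTuple m k,
    ((k.factorial : ℝ) / ∏ j, ((κ j).factorial : ℝ)) *
      (∏ j, (-(d j) * t ^ (β j)) ^ κ j) / Real.Gamma (α + ∑ j, β j * (κ j : ℝ)))
    = mlTerm β d k α t := by
  rw [mlTerm_eq_ev, Finset.sum_pow_eq_sum_piAntidiag,
    Finset.piAntidiag_univ_fin_eq_antidiagonalTuple, mlEv_sum, Finset.mul_sum]
  refine Finset.sum_congr rfl fun κ hκ => ?_
  have hk : ∑ j, κ j = k := Finset.Nat.mem_antidiagonalTuple.1 hκ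
  simp only [AddMonoidAlgebra.single_pow, AddMonoidAlgebra.prod_single]
  have hm : ((Nat.multinomial Finset.univ κ : ℕ) : AddMonoidAlgebra ℝ ℝ)
      = AddMonoidAlgebra.single 0 ((Nat.multinomial Finset.univ κ : ℕ) : ℝ) := by
    rw [AddMonoidAlgebra.natCast_def]
  have hmul : ((Nat.multinomial Finset.univ κ : ℕ) : ℝ)
      = (k.factorial : ℝ) / ∏ j, ((κ j).factorial : ℝ) := by
    rw [eq_div_iff (by
      refine Finset.prod_ne_zero_iff.2 fun j _ => ?_
      exact_mod_cast (Nat.factorial_pos _).ne')]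
    have := Nat.multinomial_spec Finset.univ κ
    rw [hk] at this
    rw [← this]; push_cast; ring
  rw [hm, AddMonoidAlgebra.single_mul_single, mlEv_single, hmul, omegaK]
  have h1 : ∏ j, (-(d j) * t ^ (β j)) ^ κ j
      = (∏ j, (-(d j)) ^ κ j) * t ^ (∑ j, β j * (κ j : ℝ)) := by
    rw [Real.rpow_sum_of_pos ht, ← Finset.prod_mul_distrib]
    refine Finset.prod_congr rfl fun j _ => ?_
    rw [mul_pow, Real.rpow_mul_natCast ht.le]
  have h2 : (0 + ∑ j, κ j • β j) = ∑ j, β j * (κ j : ℝ) := by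
    rw [zero_add]
    refine Finset.sum_congr rfl fun j _ => ?_
    rw [nsmul_eq_mul, mul_comm]
  rw [h1, h2, show α + ∑ j, β j * (κ j : ℝ) - 1 = (α - 1) + ∑ j, β j * (κ j : ℝ) by ring,
    Real.rpow_add ht]
  ring

lemma calE_eq {m : ℕ} (β d : Fin m → ℝ) (α t : ℝ) (ht : 0 < t) :
    calE β α d t = ∑' k, mlTerm β d k α t := by
  unfold calE mML
  rw [← tsum_mul_left]
  exact tsum_congr fun k => mlTerm_eq β d k α t ht

lemma gamma_lower {x R : ℝ} (hx : 0 < x) (hR : 1 ≤ R) :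
    R ^ (x - 1) * Real.exp (-R) ≤ Real.Gamma x := by
  have hR0 : 0 < R := by linarith
  have key : ∀ y : ℝ, 1 ≤ y → R ^ (y - 1) * Real.exp (-R) ≤ Real.Gamma y := by
    intro y hy
    rw [Real.Gamma_eq_integral (by linarith)]
    have hIntg := Real.GammaIntegral_convergent (s := y) (by linarith)
    calc R ^ (y - 1) * Real.exp (-R) = ∫ x in Ioi R, R ^ (y - 1) * Real.exp (-x) := by
          rw [integral_const_mul, integral_exp_neg_Ioi]
      _ ≤ ∫ x in Ioi R, Real.exp (-x) * x ^ (y - 1) := by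
          refine setIntegral_mono_on ?_ (hIntg.mono_set (Ioi_subset_Ioi hR0.le)) measurableSet_Ioi ?_
          · exact (integrableOn_exp_neg_Ioi R).const_mul _
          · intro x hx
            rw [mul_comm]
            exact mul_le_mul_of_nonneg_left
              (Real.rpow_le_rpow hR0.le (le_of_lt hx) (by linarith)) (Real.exp_pos _).le
      _ ≤ ∫ x in Ioi 0, Real.exp (-x) * x ^ (y - 1) := by
          refine setIntegral_mono_set hIntg ?_ (Ioi_subset_Ioi hR0.le).eventuallyLE
          filter_upwards [ae_restrict_mem measurableSet_Ioi] with x hx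
          exact mul_nonneg (Real.exp_pos _).le (Real.rpow_nonneg (le_of_lt hx) _)
  rcases le_or_gt 1 x with h | h
  · exact key x h
  · have h1 := key (x + 1) (by linarith)
    rw [Real.Gamma_add_one hx.ne'] at h1
    have h2 : R ^ (x - 1) ≤ R ^ (x + 1 - 1) := Real.rpow_le_rpow_of_exponent_le hR (by linarith)
    have h3 := Real.Gamma_pos_of_pos hx
    have h4 := mul_le_mul_of_nonneg_right h2 (Real.exp_pos (-R)).le
    nlinarith

lemma omegaK_nonneg {α t : ℝ} (hα : 0 < α) (ht : 0 ≤ t) : 0 ≤ omegaK α t :=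
  div_nonneg (Real.rpow_nonneg ht _) (Real.Gamma_pos_of_pos hα).le

lemma omegaK_bound {α t R : ℝ} (hα : 0 < α) (ht : 0 < t) (hR : 1 ≤ R) :
    omegaK α t ≤ Real.exp R * (t / R) ^ (α - 1) := by
  have hR0 : 0 < R := by linarith
  have h := gamma_lower hα hR
  have hp : 0 < R ^ (α - 1) := Real.rpow_pos_of_pos hR0 _
  unfold omegaK
  rw [Real.div_rpow ht.le hR0.le, div_le_iff₀ (Real.Gamma_pos_of_pos hα)]
  calc t ^ (α - 1) = Real.exp R * (t ^ (α - 1) / R ^ (α - 1)) * (R ^ (α - 1) * Real.exp (-R)) := by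
        rw [Real.exp_neg]; field_simp
    _ ≤ _ := by
        refine mul_le_mul_of_nonneg_left h ?_
        have := Real.rpow_nonneg ht.le (α - 1)
        positivity

lemma mlTerm_bound {m : ℕ} (β d : Fin m → ℝ) (hβ : ∀ j, 0 < β j) (hd : ∀ j, 0 ≤ d j)
    {t R : ℝ} (ht : 0 < t) (hR : 1 ≤ R) (k : ℕ) : ∀ {α : ℝ}, 0 < α →
    |mlTerm β d k α t| ≤ Real.exp R * (t / R) ^ (α - 1) * (∑ j, d j * (t / R) ^ β j) ^ k := by
  have hR0 : 0 < R := by linarith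
  induction k with
  | zero =>
    intro α hα
    simp only [mlTerm, pow_zero, mul_one]
    rw [abs_of_nonneg (omegaK_nonneg hα ht.le)]
    exact omegaK_bound hα ht hR
  | succ k ih =>
    intro α hα
    rw [mlTerm, pow_succ', Finset.sum_mul, Finset.mul_sum]
    refine (Finset.abs_sum_le_sum_abs _ _).trans (Finset.sum_le_sum fun j _ => ?_)
    rw [abs_mul, abs_neg, abs_of_nonneg (hd j)]
    refine (mul_le_mul_of_nonneg_left (ih (add_pos hα (hβ j))) (hd j)).trans (le_of_eq ?_)
    rw [show α + β j - 1 = (α - 1) + β j by ring, Real.rpow_add (by positivity)]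
    ring

lemma exists_R {m : ℕ} (β d : Fin m → ℝ) (hβ : ∀ j, 0 < β j) (hd : ∀ j, 0 ≤ d j)
    {T : ℝ} (hT : 0 < T) : ∃ R : ℝ, 1 ≤ R ∧ ∀ t, 0 < t → t ≤ T →
      (∑ j, d j * (t / R) ^ β j) ≤ 1 / 2 := by
  have h : Filter.Tendsto (fun R : ℝ => ∑ j, d j * (T / R) ^ β j) Filter.atTop
      (nhds (∑ j, d j * (0:ℝ) ^ β j)) := by
    refine tendsto_finsetSum _ fun j _ => Filter.Tendsto.const_mul _ ?_
    exact (Filter.Tendsto.div_atTop tendsto_const_nhds Filter.tendsto_id).rpow_const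
      (Or.inr (hβ j).le)
  have h0 : (∑ j, d j * (0:ℝ) ^ β j) = 0 :=
    Finset.sum_eq_zero fun j _ => by rw [Real.zero_rpow (hβ j).ne', mul_zero]
  rw [h0] at h
  have h1 := (h.eventually (gt_mem_nhds (show (0:ℝ) < 1 / 2 by norm_num))).and
    (Filter.eventually_ge_atTop 1)
  obtain ⟨R, hR, hR1⟩ := h1.exists
  refine ⟨R, hR1, fun t ht htT => le_trans (Finset.sum_le_sum fun j _ => ?_) hR.le⟩
  have : 0 < R := by linarith
  refine mul_le_mul_of_nonneg_left (Real.rpow_le_rpow (by positivity) ?_ (hβ j).le) (hd j)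
  gcongr

lemma mlTerm_bound' {m : ℕ} (β d : Fin m → ℝ) (hβ : ∀ j, 0 < β j) (hd : ∀ j, 0 ≤ d j)
    {T : ℝ} (hT : 0 < T) : ∃ R : ℝ, 1 ≤ R ∧ ∀ t, 0 < t → t ≤ T → ∀ (k : ℕ) (α : ℝ), 0 < α →
    |mlTerm β d k α t| ≤ Real.exp R * (t / R) ^ (α - 1) * (1 / 2) ^ k := by
  obtain ⟨R, hR, h⟩ := exists_R β d hβ hd hT
  refine ⟨R, hR, fun t ht htT k α hα => (mlTerm_bound β d hβ hd ht hR k hα).trans ?_⟩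
  have hR0 : 0 < R := by linarith
  refine mul_le_mul_of_nonneg_left (pow_le_pow_left₀ ?_ (h t ht htT) k) (by positivity)
  exact Finset.sum_nonneg fun j _ => mul_nonneg (hd j) (by positivity)

lemma mlTerm_summable {m : ℕ} (β d : Fin m → ℝ) (hβ : ∀ j, 0 < β j) (hd : ∀ j, 0 ≤ d j)
    {α t : ℝ} (hα : 0 < α) (ht : 0 < t) : Summable fun k => mlTerm β d k α t := by
  obtain ⟨R, hR, h⟩ := mlTerm_bound' β d hβ hd ht
  exact Summable.of_norm_bounded (summable_geometric_two.mul_left _)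
    fun k => h t ht le_rfl k α hα

lemma calE_rec {m : ℕ} (β d : Fin m → ℝ) (hβ : ∀ j, 0 < β j) (hd : ∀ j, 0 ≤ d j)
    {α t : ℝ} (hα : 0 < α) (ht : 0 < t) :
    calE β α d t = omegaK α t - ∑ j, d j * calE β (α + β j) d t := by
  rw [calE_eq β d α t ht, (mlTerm_summable β d hβ hd hα ht).tsum_eq_zero_add]
  simp only [mlTerm]
  rw [Summable.tsum_finsetSum fun j _ =>
    (mlTerm_summable β d hβ hd (add_pos hα (hβ j)) ht).mul_left _, sub_eq_add_neg,
    ← Finset.sum_neg_distrib]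
  congr 1
  refine Finset.sum_congr rfl fun j _ => ?_
  rw [tsum_mul_left, calE_eq β d _ t ht]; ring

lemma beta_real {a c α : ℝ} (ha : 0 < a) (hc : 0 < c) (hα : 0 < α) :
    ∫ s in (0:ℝ)..a, s ^ (α - 1) * (a - s) ^ (c - 1)
      = a ^ (α + c - 1) * (Real.Gamma α * Real.Gamma c / Real.Gamma (α + c)) := by
  have h1 := Complex.betaIntegral_scaled (α : ℂ) (c : ℂ) ha
  have h2 := Complex.Gamma_mul_Gamma_eq_betaIntegral (s := (α : ℂ)) (t := (c : ℂ))
    (by simpa using hα) (by simpa using hc)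
  have h3 : (Complex.Gamma ((α : ℂ) + c)) ≠ 0 := by
    rw [← Complex.ofReal_add, Complex.Gamma_ofReal]
    exact_mod_cast (Real.Gamma_pos_of_pos (add_pos hα hc)).ne'
  have h4 : Complex.betaIntegral α c = ((Real.Gamma α * Real.Gamma c / Real.Gamma (α + c) : ℝ) : ℂ) := by
    push_cast
    rw [← Complex.Gamma_ofReal, ← Complex.Gamma_ofReal, ← Complex.Gamma_ofReal, Complex.ofReal_add,
      h2]
    field_simp
  rw [h4] at h1
  have h5 : ∫ x in (0:ℝ)..a, (x : ℂ) ^ ((α : ℂ) - 1) * ((a : ℂ) - x) ^ ((c : ℂ) - 1)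
      = ∫ x in (0:ℝ)..a, ((x ^ (α - 1) * (a - x) ^ (c - 1) : ℝ) : ℂ) := by
    refine intervalIntegral.integral_congr fun x hx => ?_
    rw [uIcc_of_le ha.le] at hx
    rw [Complex.ofReal_mul, Complex.ofReal_cpow hx.1, Complex.ofReal_cpow (by linarith [hx.2])]
    push_cast; rfl
  rw [h5, intervalIntegral.integral_ofReal] at h1
  have h6 : ((a : ℂ) ^ ((α : ℂ) + c - 1)) = ((a ^ (α + c - 1) : ℝ) : ℂ) := by
    rw [Complex.ofReal_cpow ha.le]; push_cast; rfl
  rw [h6] at h1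
  exact_mod_cast h1

lemma omegaK_conv {a c α : ℝ} (ha : 0 < a) (hc : 0 < c) (hα : 0 < α) :
    ∫ s in (0:ℝ)..a, omegaK c (a - s) * omegaK α s = omegaK (α + c) a := by
  have h1 := beta_real ha hc hα
  have g1 := (Real.Gamma_pos_of_pos hα).ne'
  have g2 := (Real.Gamma_pos_of_pos hc).ne'
  have : ∀ s, omegaK c (a - s) * omegaK α s
    = (Real.Gamma c * Real.Gamma α)⁻¹ * (s ^ (α - 1) * (a - s) ^ (c - 1)) := by
    intro s; unfold omegaK; field_simp
  simp_rw [this]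
  rw [intervalIntegral.integral_const_mul, h1, omegaK]
  field_simp

lemma pow_conv_integrable {a c α : ℝ} (ha : 0 < a) (hc : 0 < c) (hα : 0 < α) :
    IntervalIntegrable (fun s => s ^ (α - 1) * (a - s) ^ (c - 1)) volume 0 a := by
  refine intervalIntegral.intervalIntegrable_of_integral_ne_zero ?_
  rw [beta_real ha hc hα]
  have g1 := Real.Gamma_pos_of_pos hα
  have g2 := Real.Gamma_pos_of_pos hc
  have g3 := Real.Gamma_pos_of_pos (add_pos hα hc)
  have := Real.rpow_pos_of_pos ha (α + c - 1)
  positivity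

lemma omegaK_conv_integrable {a c α : ℝ} (ha : 0 < a) (hc : 0 < c) (hα : 0 < α) :
    IntervalIntegrable (fun s => omegaK c (a - s) * omegaK α s) volume 0 a := by
  refine ((pow_conv_integrable ha hc hα).const_mul (Real.Gamma c * Real.Gamma α)⁻¹).congr ?_
  intro s _
  simp only [omegaK, mul_inv, div_eq_mul_inv]; ring

lemma omegaK_continuousOn (α : ℝ) : ContinuousOn (omegaK α) (Ioi 0) := by
  unfold omegaK
  refine ContinuousOn.div_const ?_ _
  exact fun s hs => (Real.continuousAt_rpow_const _ _ (Or.inl (ne_of_gt hs))).continuousWithinAt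

lemma mlTerm_continuousOn {m : ℕ} (β d : Fin m → ℝ) (k : ℕ) : ∀ (α : ℝ),
    ContinuousOn (mlTerm β d k α) (Ioi 0) := by
  induction k with
  | zero => intro α; exact omegaK_continuousOn α
  | succ k ih =>
    intro α
    have : mlTerm β d (k + 1) α = fun t => ∑ j, -(d j) * mlTerm β d k (α + β j) t := by
      funext t; rw [mlTerm]
    rw [this]
    exact continuousOn_finsetSum _ fun j _ => (ih _).const_mul _

lemma mlTerm_conv {m : ℕ} (β d : Fin m → ℝ) (hβ : ∀ j, 0 < β j) {a c : ℝ} (ha : 0 < a)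
    (hc : 0 < c) (k : ℕ) : ∀ {α : ℝ}, 0 < α →
    IntervalIntegrable (fun s => omegaK c (a - s) * mlTerm β d k α s) volume 0 a ∧
    ∫ s in (0:ℝ)..a, omegaK c (a - s) * mlTerm β d k α s = mlTerm β d k (α + c) a := by
  induction k with
  | zero =>
    intro α hα
    exact ⟨omegaK_conv_integrable ha hc hα, omegaK_conv ha hc hα⟩
  | succ k ih =>
    intro α hα
    have e : (fun s => omegaK c (a - s) * mlTerm β d (k + 1) α s)
      = fun s => ∑ j, -(d j) * (omegaK c (a - s) * mlTerm β d k (α + β j) s) := by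
      funext s
      rw [mlTerm, Finset.mul_sum]
      exact Finset.sum_congr rfl fun j _ => by ring
    have hi : ∀ j ∈ (Finset.univ : Finset (Fin m)), IntervalIntegrable
        (fun s => -(d j) * (omegaK c (a - s) * mlTerm β d k (α + β j) s)) volume 0 a :=
      fun j _ => ((ih (add_pos hα (hβ j))).1.const_mul _)
    rw [e]
    refine ⟨?_, ?_⟩
    · have := IntervalIntegrable.sum Finset.univ hi
      have e2 : (∑ j, fun s => -d j * (omegaK c (a - s) * mlTerm β d k (α + β j) s))
        = fun s => ∑ j, -(d j) * (omegaK c (a - s) * mlTerm β d k (α + β j) s) := by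
        funext s; simp
      rwa [e2] at this
    · rw [intervalIntegral.integral_finsetSum hi, mlTerm]
      refine Finset.sum_congr rfl fun j _ => ?_
      rw [intervalIntegral.integral_const_mul, (ih (add_pos hα (hβ j))).2]
      congr 2; ring

lemma calE_conv_hasSum {m : ℕ} (β d : Fin m → ℝ) (hβ : ∀ j, 0 < β j) (hd : ∀ j, 0 ≤ d j)
    {a c α : ℝ} (ha : 0 < a) (hc : 0 < c) (hα : 0 < α) :
    ∫ s in (0:ℝ)..a, omegaK c (a - s) * calE β α d s = calE β (α + c) d a := by
  obtain ⟨R, hR, hb⟩ := mlTerm_bound' β d hβ hd ha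
  have hR0 : 0 < R := by linarith
  have key := intervalIntegral.hasSum_integral_of_dominated_convergence
    (μ := volume) (a := 0) (b := a) (F := fun k s => omegaK c (a - s) * mlTerm β d k α s)
    (f := fun s => omegaK c (a - s) * calE β α d s)
    (fun k s => omegaK c (a - s) * (Real.exp R * (s / R) ^ (α - 1)) * (1 / 2) ^ k) ?_ ?_ ?_ ?_ ?_
  · rw [← key.tsum_eq, calE_eq _ _ _ _ ha]
    exact tsum_congr fun k => (mlTerm_conv β d hβ ha hc k hα).2
  · intro k
    have := (mlTerm_conv β d hβ ha hc k hα).1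
    rw [intervalIntegrable_iff] at this
    exact this.aestronglyMeasurable
  · intro k
    refine Filter.Eventually.of_forall fun s hs => ?_
    rw [uIoc_of_le ha.le] at hs
    have h1 := omegaK_nonneg hc (show 0 ≤ a - s by linarith [hs.2])
    rw [Real.norm_eq_abs, abs_mul, abs_of_nonneg h1, mul_assoc]
    exact mul_le_mul_of_nonneg_left (hb s hs.1 hs.2 k α hα) h1
  · exact Filter.Eventually.of_forall fun s hs => summable_geometric_two.mul_left _
  · have : (fun s => ∑' k : ℕ, omegaK c (a - s) * (Real.exp R * (s / R) ^ (α - 1)) * (1 / 2 : ℝ) ^ k)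
      = fun s => omegaK c (a - s) * (Real.exp R * (s / R) ^ (α - 1)) * 2 := by
      funext s; rw [tsum_mul_left, tsum_geometric_two]
    rw [this]
    refine ((omegaK_conv_integrable ha hc hα).const_mul
      (Real.Gamma α * Real.exp R * (R ^ (α - 1))⁻¹ * 2)).congr ?_
    intro s hs
    rw [uIoc_of_le ha.le] at hs
    have g := (Real.Gamma_pos_of_pos hα).ne'
    have hp : 0 < R ^ (α - 1) := Real.rpow_pos_of_pos hR0 _
    simp only [omegaK]
    rw [Real.div_rpow hs.1.le hR0.le]
    field_simp
  · refine Filter.Eventually.of_forall fun s hs => ?_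
    rw [uIoc_of_le ha.le] at hs
    rw [calE_eq _ _ _ _ hs.1]
    exact (mlTerm_summable β d hβ hd hα hs.1).hasSum.mul_left _

lemma omegaK_one {t : ℝ} : omegaK 1 t = 1 := by simp [omegaK]

lemma calE_integral {m : ℕ} (β d : Fin m → ℝ) (hβ : ∀ j, 0 < β j) (hd : ∀ j, 0 ≤ d j)
    {a α : ℝ} (ha : 0 < a) (hα : 0 < α) :
    ∫ s in (0:ℝ)..a, calE β α d s = calE β (α + 1) d a := by
  have := calE_conv_hasSum β d hβ hd ha one_pos hα
  simpa [omegaK_one] using this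

lemma calE_continuousOn {m : ℕ} (β d : Fin m → ℝ) (hβ : ∀ j, 0 < β j) (hd : ∀ j, 0 ≤ d j)
    {α : ℝ} (hα : 0 < α) : ContinuousOn (calE β α d) (Ioi 0) := by
  intro t ht
  have ht : 0 < t := ht
  have hT : 0 < 2 * t := by linarith
  obtain ⟨R, hR, hb⟩ := mlTerm_bound' β d hβ hd hT
  have hR0 : 0 < R := by linarith
  have hc : ContinuousOn (fun s => ∑' k, mlTerm β d k α s) (Ioo (t / 2) (2 * t)) := by
    refine continuousOn_tsum (u := fun k => Real.exp R *
      ((t / 2 / R) ^ (α - 1) + (2 * t / R) ^ (α - 1)) * (1 / 2) ^ k)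
      (fun k => (mlTerm_continuousOn β d k α).mono fun s hs => ?_)
      (summable_geometric_two.mul_left _) ?_
    · exact lt_trans (by positivity) hs.1
    · intro k s hs
      have hs0 : 0 < s := lt_trans (by positivity) hs.1
      refine (hb s hs0 hs.2.le k α hα).trans ?_
      have h1 : 0 < (t / 2 / R) ^ (α - 1) := by positivity
      have h2 : 0 < (2 * t / R) ^ (α - 1) := by positivity
      have h3 : (s / R) ^ (α - 1) ≤ (t / 2 / R) ^ (α - 1) + (2 * t / R) ^ (α - 1) := by
        rcases le_total 1 α with h | h
        · have : (s / R) ^ (α - 1) ≤ (2 * t / R) ^ (α - 1) :=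
            Real.rpow_le_rpow (by positivity) (by gcongr; exact hs.2.le) (by linarith)
          linarith
        · have : (s / R) ^ (α - 1) ≤ (t / 2 / R) ^ (α - 1) :=
            Real.rpow_le_rpow_of_nonpos (by positivity) (by gcongr; exact hs.1.le) (by linarith)
          linarith
      gcongr
  have hmem : Ioo (t / 2) (2 * t) ∈ nhds t := Ioo_mem_nhds (by linarith) (by linarith)
  refine ((hc.continuousAt hmem).congr ?_).continuousWithinAt
  filter_upwards [hmem] with s hs
  exact (calE_eq β d α s (lt_trans (by positivity) hs.1)).symm

lemma calE_integrable {m : ℕ} (β d : Fin m → ℝ) (hβ : ∀ j, 0 < β j) (hd : ∀ j, 0 ≤ d j)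
    {a α : ℝ} (ha : 0 < a) (hα : 0 < α) :
    IntervalIntegrable (calE β α d) volume 0 a := by
  obtain ⟨R, hR, hb⟩ := mlTerm_bound' β d hβ hd ha
  have hR0 : 0 < R := by linarith
  have hi : IntervalIntegrable (fun s : ℝ => Real.exp R * (R ^ (α - 1))⁻¹ * 2 * s ^ (α - 1))
    volume 0 a := (intervalIntegral.intervalIntegrable_rpow' (by linarith)).const_mul _
  refine hi.mono_fun' ?_ ?_
  · rw [uIoc_of_le ha.le]
    exact ((calE_continuousOn β d hβ hd hα).mono fun s hs => hs.1).aestronglyMeasurable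
      measurableSet_Ioc
  · rw [uIoc_of_le ha.le]
    filter_upwards [ae_restrict_mem measurableSet_Ioc] with s hs
    rw [calE_eq β d α s hs.1]
    refine (tsum_of_norm_bounded (summable_geometric_two.mul_left _).hasSum
      fun k => hb s hs.1 hs.2 k α hα).trans (le_of_eq ?_)
    rw [tsum_mul_left, tsum_geometric_two, Real.div_rpow hs.1.le hR0.le]
    ring

lemma calE_hasDerivAt {m : ℕ} (β d : Fin m → ℝ) (hβ : ∀ j, 0 < β j) (hd : ∀ j, 0 ≤ d j)
    {t α : ℝ} (ht : 0 < t) (hα : 0 < α) :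
    HasDerivAt (calE β (α + 1) d) (calE β α d t) t := by
  have hct := calE_continuousOn β d hβ hd hα
  have h := intervalIntegral.integral_hasDerivAt_right (calE_integrable β d hβ hd ht hα)
    (hct.stronglyMeasurableAtFilter isOpen_Ioi t ht) (hct.continuousAt (Ioi_mem_nhds ht))
  refine h.congr_of_eventuallyEq ?_
  filter_upwards [Ioi_mem_nhds ht] with s hs
  exact (calE_integral β d hβ hd hs hα).symm
/-! ### Part 2: extremum principle for the Caputo derivative -/

lemma inner_integral {θ η r : ℝ} (hθ0 : 0 < θ) (hθ1 : θ < 1) (hη : 0 < η) (hr : η < r) :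
    IntervalIntegrable (fun h => h ^ (θ - 2) * (r - h) ^ (-θ)) volume η r ∧
    ∫ h in η..r, h ^ (θ - 2) * (r - h) ^ (-θ) = ((r - η) / η) ^ (1 - θ) / ((1 - θ) * r) := by
  have hr0 : 0 < r := hη.trans hr
  have h1θ : 0 < 1 - θ := by linarith
  set g : ℝ → ℝ := fun h => -(((r - h) / h) ^ (1 - θ) / ((1 - θ) * r)) with hg
  have hcont : ContinuousOn g (Icc η r) := by
    have : ContinuousOn (fun h : ℝ => (r - h) / h) (Icc η r) :=
      (continuousOn_const.sub continuousOn_id).div continuousOn_id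
        fun h hh => (hη.trans_le hh.1).ne'
    exact ((this.rpow_const fun h _ => Or.inr h1θ.le).div_const _).neg
  have hderiv : ∀ h ∈ Ioo η r, HasDerivAt g (h ^ (θ - 2) * (r - h) ^ (-θ)) h := by
    intro h hh
    have hh0 : 0 < h := hη.trans hh.1
    have hrh : 0 < r - h := by linarith [hh.2]
    have d1 : HasDerivAt (fun h : ℝ => (r - h) / h) (((-1) * h - (r - h) * 1) / h ^ 2) h :=
      ((hasDerivAt_id h).const_sub r).div (hasDerivAt_id h) hh0.ne'
    have d2 := ((d1.rpow_const (p := 1 - θ) (Or.inl (by positivity))).div_const ((1 - θ) * r)).neg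
    refine d2.congr_deriv ?_
    rw [show 1 - θ - 1 = -θ by ring, Real.div_rpow hrh.le hh0.le,
      show θ - 2 = -2 - (-θ) by ring, Real.rpow_sub hh0, Real.rpow_neg hh0.le 2]
    have e : h ^ (2:ℝ) = h ^ 2 := by norm_cast
    rw [e]
    have : h ^ (-θ) ≠ 0 := (Real.rpow_pos_of_pos hh0 _).ne'
    field_simp
    ring
  have hpos : ∀ h ∈ Ioo η r, 0 ≤ h ^ (θ - 2) * (r - h) ^ (-θ) := fun h hh =>
    mul_nonneg (Real.rpow_nonneg (hη.trans hh.1).le _) (Real.rpow_nonneg (by linarith [hh.2]) _)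
  have hIntg : IntervalIntegrable (fun h => h ^ (θ - 2) * (r - h) ^ (-θ)) volume η r := by
    rw [intervalIntegrable_iff_integrableOn_Ioc_of_le hr.le]
    exact intervalIntegral.integrableOn_deriv_of_nonneg hcont hderiv hpos
  refine ⟨hIntg, ?_⟩
  rw [intervalIntegral.integral_eq_sub_of_hasDerivAt_of_le hr.le hcont hderiv hIntg]
  simp [hg, Real.zero_rpow h1θ.ne']

lemma inner_lower {θ η r : ℝ} (hθ0 : 0 < θ) (hθ1 : θ < 1) (hη : 0 < η) (hr : η < r) :
    η ^ (θ - 1) / (1 - θ) * (r ^ (-θ) - η * r ^ (-θ - 1))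
      ≤ ((r - η) / η) ^ (1 - θ) / ((1 - θ) * r) := by
  have hr0 : 0 < r := hη.trans hr
  have h1θ : 0 < 1 - θ := by linarith
  have hb : 1 - η / r ≤ (1 - η / r) ^ (1 - θ) := by
    have h0 : 0 ≤ 1 - η / r := by
      rw [sub_nonneg, div_le_one hr0]; exact hr.le
    have h1 : 1 - η / r ≤ 1 := by linarith [div_pos hη hr0]
    exact Real.self_le_rpow_of_le_one h0 h1 (by linarith)
  have e1 : (r - η) / η = r * (1 - η / r) * η⁻¹ := by field_simp
  have h0 : 0 ≤ 1 - η / r := by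
    rw [sub_nonneg, div_le_one hr0]; exact hr.le
  rw [e1, Real.mul_rpow (by positivity) (by positivity), Real.mul_rpow hr0.le h0,
    Real.inv_rpow hη.le, ← Real.rpow_neg hη.le, show -(1 - θ) = θ - 1 by ring]
  have e2 : r ^ (-θ) - η * r ^ (-θ - 1) = r ^ (-θ) * (1 - η / r) := by
    rw [Real.rpow_sub hr0, Real.rpow_one]; ring
  have e3 : r ^ (1 - θ) = r ^ (-θ) * r := by
    rw [show 1 - θ = -θ + 1 by ring, Real.rpow_add hr0, Real.rpow_one]
  rw [e2, e3]
  have hp1 : 0 < r ^ (-θ) := Real.rpow_pos_of_pos hr0 _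
  have hp2 : 0 < η ^ (θ - 1) := Real.rpow_pos_of_pos hη _
  have e4 : r ^ (-θ) * r * (1 - η / r) ^ (1 - θ) * η ^ (θ - 1) / ((1 - θ) * r)
    = η ^ (θ - 1) / (1 - θ) * (r ^ (-θ) * (1 - η / r) ^ (1 - θ)) := by
    field_simp
  rw [e4]
  gcongr

lemma swap_kernel {θ η ε : ℝ} (hθ0 : 0 < θ) (hθ1 : θ < 1) (hη : 0 < η) (hε : η < ε)
    (p : ℝ → ℝ) (hp : Continuous p) (hp0 : ∀ r, 0 ≤ p r) :
    IntervalIntegrable (fun h => h ^ (θ - 2) * ∫ r in h..ε, (r - h) ^ (-θ) * p r) volume η ε ∧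
    ∫ h in η..ε, h ^ (θ - 2) * ∫ r in h..ε, (r - h) ^ (-θ) * p r
      = ∫ r in η..ε, p r * (((r - η) / η) ^ (1 - θ) / ((1 - θ) * r)) := by
  have h1θ : 0 < 1 - θ := by linarith
  set μ := (volume : Measure ℝ).restrict (Ioc η ε) with hμ
  set k : ℝ → ℝ → ℝ := fun r h =>
    (Iio r).indicator (fun h => h ^ (θ - 2) * (r - h) ^ (-θ) * p r) h with hk
  have hslice : ∀ r ∈ Ioc η ε, Integrable (k r) μ ∧
      ∫ h, k r h ∂μ = p r * (((r - η) / η) ^ (1 - θ) / ((1 - θ) * r)) := by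
    intro r hr
    obtain ⟨i1, i2⟩ := inner_integral hθ0 hθ1 hη hr.1
    have hset : Iio r ∩ Ioc η ε = Ioo η r := by
      ext h; simp only [mem_inter_iff, mem_Iio, mem_Ioc, mem_Ioo]
      exact ⟨fun H => ⟨H.2.1, H.1⟩, fun H => ⟨H.2, H.1, H.2.le.trans hr.2⟩⟩
    rw [intervalIntegrable_iff_integrableOn_Ioo_of_le hr.1.le] at i1
    refine ⟨?_, ?_⟩
    · rw [hk]
      simp only
      rw [integrable_indicator_iff measurableSet_Iio, IntegrableOn, hμ,
        Measure.restrict_restrict measurableSet_Iio, hset]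
      exact i1.mul_const _
    · rw [hk]
      simp only
      rw [integral_indicator measurableSet_Iio, hμ, Measure.restrict_restrict measurableSet_Iio,
        hset, integral_mul_const, ← integral_Ioc_eq_integral_Ioo,
        ← intervalIntegral.integral_of_le hr.1.le, i2, mul_comm]
  have hknn : ∀ r h, h ∈ Ioc η ε → 0 ≤ k r h := by
    intro r h hh
    rw [hk]
    simp only [indicator]
    split_ifs with H
    · have : h < r := H
      have h3 : 0 < h := hη.trans hh.1
      exact mul_nonneg (mul_nonneg (Real.rpow_nonneg h3.le _)
        (Real.rpow_nonneg (by linarith) _)) (hp0 r)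
    · exact le_rfl
  have hmeas : Measurable (Function.uncurry k) := by
    have e : Function.uncurry k = {q : ℝ × ℝ | q.2 < q.1}.indicator
        (fun q => q.2 ^ (θ - 2) * (q.1 - q.2) ^ (-θ) * p q.1) := by
      funext ⟨r, h⟩
      simp [hk, Function.uncurry, indicator]
    rw [e]
    refine Measurable.indicator ?_ (measurableSet_lt measurable_snd measurable_fst)
    have := hp.measurable
    fun_prop
  have hIntg : Integrable (Function.uncurry k) (μ.prod μ) := by
    rw [integrable_prod_iff hmeas.aestronglyMeasurable]
    refine ⟨?_, ?_⟩
    · filter_upwards [ae_restrict_mem measurableSet_Ioc] with r hr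
      exact (hslice r hr).1
    · have hc : IntegrableOn (fun r => p r * (((r - η) / η) ^ (1 - θ) / ((1 - θ) * r))) (Ioc η ε) := by
        refine (ContinuousOn.integrableOn_Icc ?_).mono_set Ioc_subset_Icc_self
        refine hp.continuousOn.mul (ContinuousOn.div ?_ (by fun_prop) ?_)
        · refine ContinuousOn.rpow_const (by fun_prop) fun r _ => Or.inr h1θ.le
        · intro r hr
          have : 0 < r := hη.trans_le hr.1
          positivity
      refine hc.congr ?_
      filter_upwards [ae_restrict_mem measurableSet_Ioc] with r hr
      rw [← (hslice r hr).2]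
      refine integral_congr_ae ?_
      filter_upwards [ae_restrict_mem measurableSet_Ioc] with h hh
      exact (abs_of_nonneg (hknn r h hh)).symm
  have hG : ∀ h ∈ Ioc η ε, ∫ r, k r h ∂μ = h ^ (θ - 2) * ∫ r in h..ε, (r - h) ^ (-θ) * p r := by
    intro h hh
    have e : ∀ r, k r h = (Ioi h).indicator (fun r => h ^ (θ - 2) * ((r - h) ^ (-θ) * p r)) r := by
      intro r
      simp only [hk, indicator, mem_Iio, mem_Ioi, mul_assoc]
    have hset : Ioi h ∩ Ioc η ε = Ioc h ε := by
      ext r; simp only [mem_inter_iff, mem_Ioi, mem_Ioc]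
      exact ⟨fun H => ⟨H.1, H.2.2⟩, fun H => ⟨H.1, hh.1.trans H.1, H.2⟩⟩
    simp_rw [e]
    rw [integral_indicator measurableSet_Ioi, hμ, Measure.restrict_restrict measurableSet_Ioi,
      hset, integral_const_mul, intervalIntegral.integral_of_le hh.2]
  refine ⟨?_, ?_⟩
  · rw [intervalIntegrable_iff_integrableOn_Ioc_of_le hε.le]
    refine hIntg.integral_prod_right.congr ?_
    filter_upwards [ae_restrict_mem measurableSet_Ioc] with h hh
    exact hG h hh
  · have hs := integral_integral_swap hIntg
    rw [intervalIntegral.integral_of_le hε.le, intervalIntegral.integral_of_le hε.le]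
    rw [← hμ, ← integral_congr_ae (f := fun h => ∫ r, k r h ∂μ), ← hs]
    · refine integral_congr_ae ?_
      filter_upwards [ae_restrict_mem measurableSet_Ioc] with r hr
      exact (hslice r hr).2
    · filter_upwards [ae_restrict_mem measurableSet_Ioc] with h hh
      exact hG h hh
lemma kernel_integrable {θ τ x y : ℝ} (hθ1 : θ < 1) {q : ℝ → ℝ} (hq : Continuous q) :
    IntervalIntegrable (fun s => (τ - s) ^ (-θ) * q s) volume x y := by
  have h : IntervalIntegrable (fun s : ℝ => s ^ (-θ)) volume (τ - x) (τ - y) :=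
    intervalIntegral.intervalIntegrable_rpow' (by linarith)
  have h2 := h.comp_sub_left τ
  simp only [sub_sub_cancel] at h2
  exact h2.mul_continuousOn hq.continuousOn

lemma marchaud_ineq {θ η ε c e P : ℝ} (hθ0 : 0 < θ) (hθ1 : θ < 1) (hη : 0 < η) (hε : η < ε)
    (p : ℝ → ℝ) (hp : Continuous p) (hp0 : ∀ r, 0 ≤ p r) (hP : 0 ≤ P) (he : 0 ≤ e)
    (hmod : ∀ r, 0 ≤ r → r ≤ ε → p r ≤ e + P * r)
    (hG : ∀ h, 0 ≤ h → h ≤ ε → ∫ r in h..ε, (r - h) ^ (-θ) * p r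
      ≤ (∫ r in (0:ℝ)..ε, r ^ (-θ) * p r) - c * h) :
    c * (ε ^ θ - η ^ θ) / θ * (1 - θ)
      ≤ (e + P * η) / (1 - θ) + e / θ + η ^ θ * P * ε ^ (1 - θ) / (1 - θ) := by
  have h1θ : 0 < 1 - θ := by linarith
  have hε0 : 0 < ε := hη.trans hε
  obtain ⟨s1, s2⟩ := swap_kernel hθ0 hθ1 hη hε p hp hp0
  have h0n : (0:ℝ) ∉ uIcc η ε := by
    rw [uIcc_of_le hε.le]; exact fun H => absurd H.1 (not_le.2 hη)
  have hrp : ∀ a : ℝ, IntervalIntegrable (fun r : ℝ => r ^ a) volume η ε := fun a =>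
    intervalIntegral.intervalIntegrable_rpow (Or.inr h0n)
  have hrpp : ∀ a : ℝ, IntervalIntegrable (fun r : ℝ => r ^ a * p r) volume η ε := fun a =>
    (hrp a).mul_continuousOn hp.continuousOn
  have hk0 : ∀ x y : ℝ, IntervalIntegrable (fun r : ℝ => r ^ (-θ) * p r) volume x y := fun x y =>
    (intervalIntegral.intervalIntegrable_rpow' (by linarith)).mul_continuousOn hp.continuousOn
  set G0 := ∫ r in (0:ℝ)..ε, r ^ (-θ) * p r with hG0
  set A0 := ∫ r in (0:ℝ)..η, r ^ (-θ) * p r with hA0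
  set A := ∫ r in η..ε, r ^ (-θ) * p r with hA
  set B := ∫ r in η..ε, r ^ (-θ - 1) * p r with hB
  have hsum : A0 + A = G0 := intervalIntegral.integral_add_adjacent_intervals (hk0 _ _) (hk0 _ _)
  have hG0nn : 0 ≤ G0 := intervalIntegral.integral_nonneg hε0.le fun r hr =>
    mul_nonneg (Real.rpow_nonneg hr.1 _) (hp0 r)
  -- upper bound
  have u1 : ∫ h in η..ε, h ^ (θ - 2) * ∫ r in h..ε, (r - h) ^ (-θ) * p r
      ≤ ∫ h in η..ε, (G0 * h ^ (θ - 2) - c * h ^ (θ - 1)) := by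
    refine intervalIntegral.integral_mono_on hε.le s1
      (((hrp _).const_mul _).sub ((hrp _).const_mul _)) fun h hh => ?_
    have hh0 : 0 < h := hη.trans_le hh.1
    have := mul_le_mul_of_nonneg_left (hG h hh0.le hh.2) (Real.rpow_nonneg hh0.le (θ - 2))
    refine this.trans (le_of_eq ?_)
    rw [show θ - 1 = (θ - 2) + 1 by ring, Real.rpow_add hh0, Real.rpow_one]; ring
  have u2 : ∫ h in η..ε, (G0 * h ^ (θ - 2) - c * h ^ (θ - 1))
      = G0 * ((η ^ (θ - 1) - ε ^ (θ - 1)) / (1 - θ)) - c * ((ε ^ θ - η ^ θ) / θ) := by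
    rw [intervalIntegral.integral_sub ((hrp _).const_mul _) ((hrp _).const_mul _),
      intervalIntegral.integral_const_mul, intervalIntegral.integral_const_mul,
      integral_rpow (Or.inr ⟨by linarith, h0n⟩), integral_rpow (Or.inr ⟨by linarith, h0n⟩),
      show θ - 2 + 1 = θ - 1 by ring, show θ - 1 + 1 = θ by ring]
    congr 2
    rw [← neg_div_neg_eq]; congr 1 <;> ring
  -- lower bound
  have l1 : η ^ (θ - 1) / (1 - θ) * (A - η * B)
      ≤ ∫ r in η..ε, p r * (((r - η) / η) ^ (1 - θ) / ((1 - θ) * r)) := by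
    have e1 : η ^ (θ - 1) / (1 - θ) * (A - η * B)
      = ∫ r in η..ε, η ^ (θ - 1) / (1 - θ) * (r ^ (-θ) * p r - η * (r ^ (-θ - 1) * p r)) := by
      rw [intervalIntegral.integral_const_mul, intervalIntegral.integral_sub (hrpp _)
        ((hrpp _).const_mul _), intervalIntegral.integral_const_mul]
    rw [e1]
    have hcc : ContinuousOn (fun r => p r * (((r - η) / η) ^ (1 - θ) / ((1 - θ) * r))) (uIcc η ε) := by
      rw [uIcc_of_le hε.le]
      refine hp.continuousOn.mul (ContinuousOn.div ?_ (by fun_prop) ?_)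
      · refine ContinuousOn.rpow_const (by fun_prop) fun r _ => Or.inr h1θ.le
      · intro r hr
        have : 0 < r := hη.trans_le hr.1
        positivity
    refine intervalIntegral.integral_mono_on_of_le_Ioo hε.le
      (((hrpp _).sub ((hrpp _).const_mul _)).const_mul _) hcc.intervalIntegrable fun r hr => ?_
    have := mul_le_mul_of_nonneg_left (inner_lower hθ0 hθ1 hη hr.1) (hp0 r)
    refine le_trans (le_of_eq ?_) this
    ring
  -- bounds on A0 and B
  have b1 : A0 ≤ (e + P * η) * (η ^ (1 - θ) / (1 - θ)) := by
    have e1 : (e + P * η) * (η ^ (1 - θ) / (1 - θ)) = ∫ r in (0:ℝ)..η, (e + P * η) * r ^ (-θ) := by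
      rw [intervalIntegral.integral_const_mul, integral_rpow (Or.inl (by linarith)),
        show -θ + 1 = 1 - θ by ring, Real.zero_rpow h1θ.ne', sub_zero]
    rw [e1]
    refine intervalIntegral.integral_mono_on hη.le (hk0 _ _)
      ((intervalIntegral.intervalIntegrable_rpow' (by linarith)).const_mul _) fun r hr => ?_
    rw [mul_comm]
    refine mul_le_mul_of_nonneg_right ?_ (Real.rpow_nonneg hr.1 _)
    refine (hmod r hr.1 (hr.2.trans hε.le)).trans ?_
    have := mul_le_mul_of_nonneg_left hr.2 hP
    linarith
  have b2 : B ≤ e * (η ^ (-θ) / θ) + P * (ε ^ (1 - θ) / (1 - θ)) := by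
    have e1 : ∫ r in η..ε, (e * r ^ (-θ - 1) + P * r ^ (-θ))
        = e * ((ε ^ (-θ) - η ^ (-θ)) / (-θ)) + P * ((ε ^ (1 - θ) - η ^ (1 - θ)) / (1 - θ)) := by
      rw [intervalIntegral.integral_add ((hrp _).const_mul _) ((hrp _).const_mul _),
        intervalIntegral.integral_const_mul, intervalIntegral.integral_const_mul,
        integral_rpow (Or.inr ⟨by linarith, h0n⟩), integral_rpow (Or.inl (by linarith)),
        show -θ - 1 + 1 = -θ by ring, show -θ + 1 = 1 - θ by ring]
    have e2 : B ≤ ∫ r in η..ε, (e * r ^ (-θ - 1) + P * r ^ (-θ)) := by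
      refine intervalIntegral.integral_mono_on hε.le (hrpp _)
        (((hrp _).const_mul _).add ((hrp _).const_mul _)) fun r hr => ?_
      have hr0 : 0 < r := hη.trans_le hr.1
      have := mul_le_mul_of_nonneg_left (hmod r hr0.le hr.2) (Real.rpow_nonneg hr0.le (-θ - 1))
      refine this.trans (le_of_eq ?_)
      rw [show -θ = (-θ - 1) + 1 by ring, Real.rpow_add hr0, Real.rpow_one]
      ring_nf
    have p1 : 0 < ε ^ (-θ) := Real.rpow_pos_of_pos hε0 _
    have p2 : 0 < η ^ (1 - θ) := Real.rpow_pos_of_pos hη _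
    refine (e2.trans e1.le).trans (add_le_add (mul_le_mul_of_nonneg_left ?_ he)
      (mul_le_mul_of_nonneg_left ?_ hP))
    · rw [← neg_div_neg_eq, neg_neg]
      gcongr
      linarith
    · gcongr
      linarith
  have q1 : η ^ (θ - 1) * η ^ (1 - θ) = 1 := by
    rw [← Real.rpow_add hη]; simp
  have q2 : η ^ (θ - 1) * η * η ^ (-θ) = 1 := by
    rw [← Real.rpow_add_one hη.ne', ← Real.rpow_add hη]; simp
  have q3 : η ^ (θ - 1) * η = η ^ θ := by
    rw [← Real.rpow_add_one hη.ne']; simp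
  have hp1 : 0 < η ^ (θ - 1) := Real.rpow_pos_of_pos hη _
  have hp2 : 0 < ε ^ (θ - 1) := Real.rpow_pos_of_pos hε0 _
  have m1 : η ^ (θ - 1) * (A - η * B) ≤ G0 * (η ^ (θ - 1) - ε ^ (θ - 1))
      - c * ((ε ^ θ - η ^ θ) / θ) * (1 - θ) := by
    have := (l1.trans (s2.symm.le.trans u1)).trans u2.le
    have h3 := mul_le_mul_of_nonneg_right this h1θ.le
    calc _ = η ^ (θ - 1) / (1 - θ) * (A - η * B) * (1 - θ) := by field_simp
      _ ≤ _ := h3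
      _ = _ := by field_simp
  have m2 : c * ((ε ^ θ - η ^ θ) / θ) * (1 - θ) ≤ η ^ (θ - 1) * A0 + η ^ θ * B := by
    have := mul_nonneg hG0nn hp2.le
    have q4 : η ^ (θ - 1) * (A - η * B) = η ^ (θ - 1) * A - η ^ θ * B := by rw [← q3]; ring
    rw [← hsum] at m1 this
    rw [q4] at m1
    linarith
  have m3 := mul_le_mul_of_nonneg_left b1 hp1.le
  have m4 := mul_le_mul_of_nonneg_left b2 (Real.rpow_nonneg hη.le θ)
  calc c * (ε ^ θ - η ^ θ) / θ * (1 - θ) = c * ((ε ^ θ - η ^ θ) / θ) * (1 - θ) := by ring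
    _ ≤ η ^ (θ - 1) * A0 + η ^ θ * B := m2
    _ ≤ _ := add_le_add m3 m4
    _ = (η ^ (θ - 1) * η ^ (1 - θ)) * (e + P * η) / (1 - θ) + (η ^ (θ - 1) * η * η ^ (-θ)) * e / θ
        + η ^ θ * P * ε ^ (1 - θ) / (1 - θ) := by rw [q3]; ring
    _ = _ := by rw [q1, q2]; ring

lemma marchaud_contra {θ ε c : ℝ} (hθ0 : 0 < θ) (hθ1 : θ < 1) (hε : 0 < ε) (hc : 0 < c)
    (p : ℝ → ℝ) (hp : Continuous p) (hp0 : ∀ r, 0 ≤ p r) (hpz : p 0 = 0)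
    (hG : ∀ h, 0 ≤ h → h ≤ ε → ∫ r in h..ε, (r - h) ^ (-θ) * p r
      ≤ (∫ r in (0:ℝ)..ε, r ^ (-θ) * p r) - c * h) : False := by
  have h1θ : 0 < 1 - θ := by linarith
  have hεp : 0 < ε ^ θ := Real.rpow_pos_of_pos hε _
  have key : ∀ e : ℝ, 0 < e → c * ε ^ θ / θ * (1 - θ) ≤ e / (1 - θ) + e / θ := by
    intro e he
    obtain ⟨δ, hδ, hδ'⟩ : ∃ δ > 0, ∀ r, |r| < δ → p r < e := by
      have := Metric.continuousAt_iff.1 (hp.continuousAt (x := (0:ℝ))) e he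
      obtain ⟨δ, hδ, H⟩ := this
      refine ⟨δ, hδ, fun r hr => ?_⟩
      have := H (x := r) (by simpa [Real.dist_eq] using hr)
      rw [Real.dist_eq, hpz, sub_zero] at this
      exact lt_of_abs_lt this
    obtain ⟨Q, hQ⟩ := (isCompact_Icc (a := (0:ℝ)) (b := ε)).bddAbove_image hp.continuousOn
    have hQ' : ∀ r, 0 ≤ r → r ≤ ε → p r ≤ Q := fun r h1 h2 => hQ ⟨r, ⟨h1, h2⟩, rfl⟩
    have hQ0 : 0 ≤ Q := (hp0 0).trans (hQ' 0 le_rfl hε.le)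
    have hmod : ∀ r, 0 ≤ r → r ≤ ε → p r ≤ e + Q / δ * r := by
      intro r h1 h2
      rcases lt_or_ge r δ with h | h
      · have := hδ' r (by rwa [abs_of_nonneg h1])
        have : 0 ≤ Q / δ * r := by positivity
        linarith
      · have h3 : Q ≤ Q / δ * r := by
          rw [div_mul_eq_mul_div, le_div_iff₀ hδ]; gcongr
        linarith [hQ' r h1 h2]
    have hev : ∀ᶠ η in nhdsWithin (0:ℝ) (Ioi 0), c * (ε ^ θ - η ^ θ) / θ * (1 - θ)
      ≤ (e + Q / δ * η) / (1 - θ) + e / θ + η ^ θ * (Q / δ) * ε ^ (1 - θ) / (1 - θ) := by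
      filter_upwards [Ioo_mem_nhdsGT hε] with η hη
      exact marchaud_ineq hθ0 hθ1 hη.1 hη.2 p hp hp0 (by positivity) he.le hmod hG
    have ht : Filter.Tendsto (fun η : ℝ => η ^ θ) (nhdsWithin (0:ℝ) (Ioi 0)) (nhds 0) := by
      have := (Real.continuousAt_rpow_const 0 θ (Or.inr hθ0.le)).tendsto
      rw [Real.zero_rpow hθ0.ne'] at this
      exact this.mono_left nhdsWithin_le_nhds
    have hid : Filter.Tendsto (fun η : ℝ => η) (nhdsWithin (0:ℝ) (Ioi 0)) (nhds 0) :=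
      Filter.tendsto_id.mono_left nhdsWithin_le_nhds
    have t1 : Filter.Tendsto (fun η : ℝ => c * (ε ^ θ - η ^ θ) / θ * (1 - θ))
        (nhdsWithin (0:ℝ) (Ioi 0)) (nhds (c * (ε ^ θ - 0) / θ * (1 - θ))) :=
      (((tendsto_const_nhds.sub ht).const_mul c).div_const θ).mul_const _
    have t2 : Filter.Tendsto (fun η : ℝ => (e + Q / δ * η) / (1 - θ) + e / θ
          + η ^ θ * (Q / δ) * ε ^ (1 - θ) / (1 - θ))
        (nhdsWithin (0:ℝ) (Ioi 0)) (nhds ((e + Q / δ * 0) / (1 - θ) + e / θ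
          + 0 * (Q / δ) * ε ^ (1 - θ) / (1 - θ))) :=
      (((tendsto_const_nhds.add (hid.const_mul _)).div_const _).add tendsto_const_nhds).add
        (((ht.mul_const _).mul_const _).div_const _)
    have := le_of_tendsto_of_tendsto t1 t2 hev
    simpa using this
  have hpos : 0 < c * ε ^ θ / θ * (1 - θ) := by positivity
  set X := c * ε ^ θ / θ * (1 - θ) with hX
  set Y := 1 / (1 - θ) + 1 / θ with hY
  have hYp : 0 < Y := by positivity
  have h := key (X / (2 * Y)) (by positivity)
  have h2 : X / (2 * Y) / (1 - θ) + X / (2 * Y) / θ = X / (2 * Y) * Y := by rw [hY]; ring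
  rw [h2] at h
  have h3 : X / (2 * Y) * Y = X / 2 := by field_simp
  rw [h3] at h
  linarith

lemma caputo_nonneg_of_max {θ t : ℝ} (hθ0 : 0 < θ) (hθ1 : θ < 1) (ht : 0 < t) (v : ℝ → ℝ)
    (hv : ContinuousOn v (Icc 0 t)) (hmax : ∀ s, 0 ≤ s → s ≤ t → v s ≤ v t)
    (hd : DifferentiableAt ℝ (caputoKernel θ v) t) : 0 ≤ caputo θ v t := by
  by_contra hneg
  push Not at hneg
  have h1θ : 0 < 1 - θ := by linarith
  set L := caputo θ v t with hL
  have hder : HasDerivAt (caputoKernel θ v) L t := hd.hasDerivAt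
  set W : ℝ → ℝ := fun s => v t - v (max 0 (min s t)) with hW
  have hWc : Continuous W := by
    refine continuous_const.sub (hv.comp_continuous (by fun_prop) fun s => ?_)
    exact ⟨le_max_left _ _, max_le ht.le (min_le_right _ _)⟩
  have hW0 : ∀ s, 0 ≤ W s := fun s => sub_nonneg.2
    (hmax _ (le_max_left _ _) (max_le ht.le (min_le_right _ _)))
  have hWeq : ∀ s, 0 ≤ s → s ≤ t → W s = v t - v s := by
    intro s h1 h2
    simp only [hW]
    rw [min_eq_left h2, max_eq_right h1]
  have hΓ : 0 < Real.Gamma (1 - θ) := Real.Gamma_pos_of_pos h1θ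
  -- local inequality for the kernel
  obtain ⟨ε₀, hε₀, hloc⟩ : ∃ ε₀ > 0, ∀ h, 0 ≤ h → h ≤ ε₀ →
      caputoKernel θ v t + (-L / 2) * h ≤ caputoKernel θ v (t - h) := by
    have h1 := hder.isLittleO
    have h2 := h1.def (show 0 < -L / 2 by linarith)
    obtain ⟨r, hr, H⟩ := Metric.eventually_nhds_iff.1 h2
    refine ⟨r / 2, by positivity, fun h hh0 hh1 => ?_⟩
    have := H (y := t - h) (by rw [Real.dist_eq]; simp [abs_of_nonneg hh0]; linarith)
    simp only [sub_sub_cancel_left, Real.norm_eq_abs, abs_neg, abs_of_nonneg hh0, smul_eq_mul] at this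
    have := (abs_le.1 this).1
    nlinarith
  set ε := min ε₀ (t / 2) with hε
  have hεp : 0 < ε := lt_min hε₀ (by linarith)
  have hεt : ε ≤ t / 2 := min_le_right _ _
  set a := t - ε with ha
  have ha0 : 0 ≤ a := by linarith
  have hat : a < t := by linarith
  -- representation
  have hrep : ∀ τ, a ≤ τ → τ ≤ t → 0 < τ → Real.Gamma (1 - θ) * caputoKernel θ v τ
      = (v t - v 0) * (τ ^ (1 - θ) / (1 - θ)) - (∫ s in (0:ℝ)..a, (τ - s) ^ (-θ) * W s)
        - ∫ s in a..τ, (τ - s) ^ (-θ) * W s := by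
    intro τ h1 h2 h3
    unfold caputoKernel
    rw [mul_inv_cancel_left₀ hΓ.ne']
    have e1 : ∫ s in (0:ℝ)..τ, (τ - s) ^ (-θ) * (v s - v 0)
        = ∫ s in (0:ℝ)..τ, ((τ - s) ^ (-θ) * (v t - v 0) - (τ - s) ^ (-θ) * W s) := by
      refine intervalIntegral.integral_congr fun s hs => ?_
      rw [uIcc_of_le h3.le] at hs
      show (τ - s) ^ (-θ) * (v s - v 0) = (τ - s) ^ (-θ) * (v t - v 0) - (τ - s) ^ (-θ) * W s
      rw [hWeq s hs.1 (hs.2.trans h2)]; ring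
    rw [e1, intervalIntegral.integral_sub (kernel_integrable hθ1 continuous_const)
      (kernel_integrable hθ1 hWc), intervalIntegral.integral_mul_const,
      ← intervalIntegral.integral_add_adjacent_intervals (b := a)
      (kernel_integrable hθ1 hWc) (kernel_integrable hθ1 hWc),
      intervalIntegral.integral_comp_sub_left (fun x => x ^ (-θ)) τ,
      integral_rpow (Or.inl (by linarith)), sub_self, sub_zero, show -θ + 1 = 1 - θ by ring,
      Real.zero_rpow h1θ.ne', sub_zero]
    ring
  refine marchaud_contra hθ0 hθ1 hεp (c := Real.Gamma (1 - θ) * (-L / 2))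
    (mul_pos hΓ (by linarith)) (fun r => W (t - r)) (by fun_prop) (fun r => hW0 _) ?_ ?_
  · simp only [sub_zero]; rw [hWeq t ht.le le_rfl, sub_self]
  · intro h hh0 hh1
    have hsub : ∀ h, ∫ r in h..ε, (r - h) ^ (-θ) * W (t - r)
        = ∫ s in a..(t - h), (t - h - s) ^ (-θ) * W s := by
      intro h
      have := intervalIntegral.integral_comp_sub_left (a := h) (b := ε)
        (fun s => (t - h - s) ^ (-θ) * W s) t
      rw [← ha] at this
      rw [← this]
      refine intervalIntegral.integral_congr fun r _ => ?_
      show (r - h) ^ (-θ) * W (t - r) = (t - h - (t - r)) ^ (-θ) * W (t - r)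
      congr 2; ring
    have hsub0 := hsub 0
    simp only [sub_zero] at hsub0
    rw [hsub, hsub0]
    have hta : 0 < t - h := by linarith
    have r1 := hrep t hat.le le_rfl ht
    have r2 := hrep (t - h) (by linarith) (by linarith) hta
    have r3 := hloc h hh0 (hh1.trans (min_le_left _ _))
    have r4 : (∫ s in (0:ℝ)..a, (t - s) ^ (-θ) * W s)
        ≤ ∫ s in (0:ℝ)..a, (t - h - s) ^ (-θ) * W s := by
      refine intervalIntegral.integral_mono_on_of_le_Ioo ha0 (kernel_integrable hθ1 hWc)
        (kernel_integrable hθ1 hWc) fun s hs => ?_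
      refine mul_le_mul_of_nonneg_right ?_ (hW0 s)
      exact Real.rpow_le_rpow_of_nonpos (by linarith [hs.2]) (by linarith) (by linarith)
    have r5 : (t - h) ^ (1 - θ) ≤ t ^ (1 - θ) :=
      Real.rpow_le_rpow hta.le (by linarith) h1θ.le
    have r6 : (v t - v 0) * ((t - h) ^ (1 - θ) / (1 - θ))
        ≤ (v t - v 0) * (t ^ (1 - θ) / (1 - θ)) := by
      refine mul_le_mul_of_nonneg_left (by gcongr) (sub_nonneg.2 (hmax 0 le_rfl ht.le))
    have r7 := mul_le_mul_of_nonneg_left r3 hΓ.le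
    linarith
/-! ### Part 3: the relaxation function and the comparison argument -/

lemma kernel_integrable_on {θ τ : ℝ} (hθ1 : θ < 1) {q : ℝ → ℝ} (hτ : 0 ≤ τ)
    (hq : ContinuousOn q (Ici 0)) :
    IntervalIntegrable (fun s => (τ - s) ^ (-θ) * q s) volume 0 τ := by
  have h : IntervalIntegrable (fun s : ℝ => s ^ (-θ)) volume (τ - 0) (τ - τ) :=
    intervalIntegral.intervalIntegrable_rpow' (by linarith)
  have h2 := h.comp_sub_left τ
  simp only [sub_sub_cancel] at h2
  refine h2.mul_continuousOn (hq.mono ?_)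
  rw [uIcc_of_le hτ]; exact fun s hs => hs.1

lemma caputoKernel_comb {θ τ A N : ℝ} (hθ1 : θ < 1) (hτ : 0 ≤ τ) {u h : ℝ → ℝ}
    (hu : ContinuousOn u (Ici 0)) (hh : ContinuousOn h (Ici 0)) :
    caputoKernel θ (fun s => u s - A - N * h s) τ
      = caputoKernel θ u τ - N * caputoKernel θ h τ := by
  unfold caputoKernel
  have i1 : IntervalIntegrable (fun s => (τ - s) ^ (-θ) * (u s - u 0)) volume 0 τ :=
    kernel_integrable_on hθ1 hτ (hu.sub (continuousOn_const (c := u 0)))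
  have i2 : IntervalIntegrable (fun s => (τ - s) ^ (-θ) * (h s - h 0)) volume 0 τ :=
    kernel_integrable_on hθ1 hτ (hh.sub (continuousOn_const (c := h 0)))
  have e : ∀ s, (τ - s) ^ (-θ) * (u s - A - N * h s - (u 0 - A - N * h 0))
      = (τ - s) ^ (-θ) * (u s - u 0) - N * ((τ - s) ^ (-θ) * (h s - h 0)) := fun s => by ring
  simp_rw [e]
  rw [intervalIntegral.integral_sub i1 (i2.const_mul N), intervalIntegral.integral_const_mul]
  ring

lemma compare_time {θ t A N : ℝ} (hθ0 : 0 < θ) (hθ1 : θ < 1) (ht : 0 < t) {u h : ℝ → ℝ}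
    (hu : ContinuousOn u (Ici 0)) (hh : ContinuousOn h (Ici 0))
    (hdu : DifferentiableAt ℝ (caputoKernel θ u) t)
    (hdh : DifferentiableAt ℝ (caputoKernel θ h) t)
    (hmax : ∀ s, 0 ≤ s → s ≤ t → u s - A - N * h s ≤ u t - A - N * h t) :
    N * caputo θ h t ≤ caputo θ u t := by
  have hd : HasDerivAt (caputoKernel θ (fun s => u s - A - N * h s))
      (caputo θ u t - N * caputo θ h t) t := by
    refine (hdu.hasDerivAt.sub (hdh.hasDerivAt.const_mul N)).congr_of_eventuallyEq ?_
    filter_upwards [Ioi_mem_nhds ht] with τ hτ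
    exact caputoKernel_comb hθ1 (le_of_lt hτ) hu hh
  have hc : ContinuousOn (fun s => u s - A - N * h s) (Icc 0 t) :=
    ((hu.sub continuousOn_const).sub (hh.const_mul N)).mono fun s hs => hs.1
  have := caputo_nonneg_of_max hθ0 hθ1 ht _ hc hmax hd.differentiableAt
  rw [caputo, hd.deriv] at this
  linarith

/-- The relaxation function. -/
noncomputable def hFun (M : ℕ) (ν : ℝ) (νs : Fin M → ℝ) (ρ : ℝ) (ρs : Fin M → ℝ)
    (C t : ℝ) : ℝ :=
  1 - C / ρ * ∫ s in (0:ℝ)..t,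
    calE (Fin.cons ν fun i => ν - νs i) ν (Fin.cons (C / ρ) fun i => ρs i / ρ) s

section relax

variable {M : ℕ} {ν : ℝ} {νs : Fin M → ℝ} {ρ : ℝ} {ρs : Fin M → ℝ} {C : ℝ}

lemma beta_pos' (hν0 : 0 < ν) (hνsν : ∀ i, νs i < ν) :
    ∀ j, 0 < (Fin.cons ν (fun i => ν - νs i) : Fin (M + 1) → ℝ) j := by
  intro j
  refine Fin.cases ?_ (fun i => ?_) j
  · simpa using hν0
  · simpa using hνsν i

lemma d_nonneg' (hρ : 0 < ρ) (hρs : ∀ i, 0 ≤ ρs i) (hC : 0 < C) :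
    ∀ j, 0 ≤ (Fin.cons (C / ρ) (fun i => ρs i / ρ) : Fin (M + 1) → ℝ) j := by
  intro j
  refine Fin.cases ?_ (fun i => ?_) j
  · simp only [Fin.cons_zero]; positivity
  · simp only [Fin.cons_succ]; exact div_nonneg (hρs i) hρ.le

lemma hFun_zero : hFun M ν νs ρ ρs C 0 = 1 := by simp [hFun]

lemma hFun_pos_eq (hν0 : 0 < ν) (hνsν : ∀ i, νs i < ν) (hρ : 0 < ρ) (hρs : ∀ i, 0 ≤ ρs i)
    (hC : 0 < C) {t : ℝ} (ht : 0 < t) :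
    hFun M ν νs ρ ρs C t = 1 - C / ρ *
      calE (Fin.cons ν fun i => ν - νs i) (ν + 1) (Fin.cons (C / ρ) fun i => ρs i / ρ) t := by
  rw [hFun, calE_integral _ _ (beta_pos' hν0 hνsν) (d_nonneg' hρ hρs hC) ht hν0]

lemma hFun_cont (hν0 : 0 < ν) (hνsν : ∀ i, νs i < ν) (hρ : 0 < ρ) (hρs : ∀ i, 0 ≤ ρs i)
    (hC : 0 < C) : ContinuousOn (hFun M ν νs ρ ρs C) (Ici 0) := by
  intro t ht
  have ht : 0 ≤ t := ht
  have hi := calE_integrable _ _ (beta_pos' hν0 hνsν) (d_nonneg' hρ hρs hC)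
    (show 0 < t + 1 by linarith) hν0
  have h1 := intervalIntegral.continuousOn_primitive_interval' hi left_mem_uIcc
  have h2 : ContinuousOn (hFun M ν νs ρ ρs C) (uIcc 0 (t + 1)) :=
    continuousOn_const.sub (h1.const_mul _)
  rw [uIcc_of_le (by linarith)] at h2
  refine (h2 t ⟨ht, by linarith⟩).mono_of_mem_nhdsWithin ?_
  rw [← Ici_inter_Iic]
  exact inter_mem_nhdsWithin _ (Iic_mem_nhds (by linarith))

lemma hFun_caputo (hν0 : 0 < ν) (hνsν : ∀ i, νs i < ν) (hρ : 0 < ρ) (hρs : ∀ i, 0 ≤ ρs i)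
    (hC : 0 < C) {t θ : ℝ} (ht : 0 < t) (hθ1 : θ < 1) :
    HasDerivAt (caputoKernel θ (hFun M ν νs ρ ρs C)) (-(C / ρ) *
      calE (Fin.cons ν fun i => ν - νs i) (1 + ν - θ)
        (Fin.cons (C / ρ) fun i => ρs i / ρ) t) t := by
  have hβ := beta_pos' hν0 hνsν (M := M)
  have hd := d_nonneg' hρ hρs hC (M := M)
  refine ((calE_hasDerivAt _ _ hβ hd ht (show 0 < 1 + ν - θ by linarith)).const_mul
    (-(C / ρ))).congr_of_eventuallyEq ?_
  filter_upwards [Ioi_mem_nhds ht] with τ hτ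
  have hτ : 0 < τ := hτ
  have h1 := calE_conv_hasSum _ _ hβ hd hτ (show 0 < 1 - θ by linarith)
    (show 0 < ν + 1 by linarith)
  rw [show 1 + ν - θ + 1 = ν + 1 + (1 - θ) by ring, ← h1, caputoKernel,
    ← intervalIntegral.integral_const_mul, ← intervalIntegral.integral_const_mul]
  refine intervalIntegral.integral_congr_ae (Filter.Eventually.of_forall fun s hs => ?_)
  rw [uIoc_of_le hτ.le] at hs
  rw [hFun_pos_eq hν0 hνsν hρ hρs hC hs.1, hFun_zero, omegaK, show 1 - θ - 1 = -θ by ring]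
  ring

lemma hFun_rec (hν0 : 0 < ν) (hνsν : ∀ i, νs i < ν) (hρ : 0 < ρ) (hρs : ∀ i, 0 ≤ ρs i)
    (hC : 0 < C) {t : ℝ} (ht : 0 < t) :
    hFun M ν νs ρ ρs C t
      = (∑ i, ρs i / ρ * calE (Fin.cons ν fun i => ν - νs i) (1 + ν - νs i)
          (Fin.cons (C / ρ) fun i => ρs i / ρ) t)
        + calE (Fin.cons ν fun i => ν - νs i) 1 (Fin.cons (C / ρ) fun i => ρs i / ρ) t := by
  have hβ := beta_pos' hν0 hνsν (M := M)
  have hd := d_nonneg' hρ hρs hC (M := M)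
  have h := calE_rec _ _ hβ hd one_pos ht
  rw [Fin.sum_univ_succ] at h
  simp only [Fin.cons_zero, Fin.cons_succ, omegaK_one] at h
  rw [hFun_pos_eq hν0 hνsν hρ hρs hC ht, h, add_comm ν 1]
  have : ∀ i, 1 + (ν - νs i) = 1 + ν - νs i := fun i => by ring
  simp_rw [this]
  ring

lemma hFun_eqn (hν0 : 0 < ν) (hν1 : ν < 1) (hνsν : ∀ i, νs i < ν) (hρ : 0 < ρ)
    (hρs : ∀ i, 0 ≤ ρs i) (hC : 0 < C) {t : ℝ} (ht : 0 < t) :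
    ρ * caputo ν (hFun M ν νs ρ ρs C) t + ∑ i, ρs i * caputo (νs i) (hFun M ν νs ρ ρs C) t
      = -C * hFun M ν νs ρ ρs C t := by
  have e1 : ∀ θ, θ < 1 → caputo θ (hFun M ν νs ρ ρs C) t = _ := fun θ hθ =>
    (hFun_caputo hν0 hνsν hρ hρs hC ht hθ).deriv
  have e2 : ∀ i, ρs i * caputo (νs i) (hFun M ν νs ρ ρs C) t
      = -C * (ρs i / ρ * calE (Fin.cons ν fun i => ν - νs i) (1 + ν - νs i)
          (Fin.cons (C / ρ) fun i => ρs i / ρ) t) := by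
    intro i
    rw [e1 _ ((hνsν i).trans hν1)]
    field_simp
  simp_rw [e2]
  rw [e1 ν hν1, hFun_rec hν0 hνsν hρ hρs hC ht, ← Finset.mul_sum,
    show 1 + ν - ν = 1 by ring]
  field_simp
  ring

lemma hFun_nonneg (hν0 : 0 < ν) (hν1 : ν < 1) (hνs0 : ∀ i, 0 < νs i) (hνsν : ∀ i, νs i < ν)
    (hρ : 0 < ρ) (hρs : ∀ i, 0 ≤ ρs i) (hC : 0 < C) {t : ℝ} (ht : 0 ≤ t) :
    0 ≤ hFun M ν νs ρ ρs C t := by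
  by_contra hneg
  push Not at hneg
  have hc := hFun_cont hν0 hνsν hρ hρs hC (M := M)
  obtain ⟨τ, hτ, hmin⟩ := isCompact_Icc.exists_isMinOn (nonempty_Icc.2 ht)
    (hc.mono (fun s (hs : s ∈ Icc 0 t) => hs.1))
  have hτneg : hFun M ν νs ρ ρs C τ < 0 := (hmin (right_mem_Icc.2 ht)).trans_lt hneg
  have hτ0 : 0 < τ := by
    rcases eq_or_lt_of_le hτ.1 with h | h
    · rw [← h, hFun_zero] at hτneg; linarith
    · exact h
  have hcap : ∀ θ, 0 < θ → θ < 1 → caputo θ (hFun M ν νs ρ ρs C) τ ≤ 0 := by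
    intro θ h0 h1
    have hz : HasDerivAt (caputoKernel θ (fun _ => (0:ℝ))) 0 τ := by
      have : caputoKernel θ (fun _ => (0:ℝ)) = fun _ => 0 := by
        funext s; simp [caputoKernel]
      rw [this]; exact hasDerivAt_const _ _
    have := compare_time (A := 0) (N := 1) h0 h1 hτ0 (continuousOn_const (c := (0:ℝ))) hc
      hz.differentiableAt (hFun_caputo hν0 hνsν hρ hρs hC hτ0 h1).differentiableAt
      (fun s hs0 hs1 => by
        have := hmin (show s ∈ Icc 0 t from ⟨hs0, hs1.trans hτ.2⟩)
        have : hFun M ν νs ρ ρs C τ ≤ hFun M ν νs ρ ρs C s := this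
        linarith)
    rw [caputo, caputo, hz.deriv] at this
    rw [caputo]; linarith
  have heq := hFun_eqn hν0 hν1 hνsν hρ hρs hC hτ0 (M := M)
  have s1 : ρ * caputo ν (hFun M ν νs ρ ρs C) τ ≤ 0 :=
    mul_nonpos_of_nonneg_of_nonpos hρ.le (hcap ν hν0 hν1)
  have s2 : ∑ i, ρs i * caputo (νs i) (hFun M ν νs ρ ρs C) τ ≤ 0 :=
    Finset.sum_nonpos fun i _ => mul_nonpos_of_nonneg_of_nonpos (hρs i)
      (hcap _ (hνs0 i) ((hνsν i).trans hν1))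
  nlinarith

lemma gFun_ge (hν0 : 0 < ν) (hν1 : ν < 1) (hνs0 : ∀ i, 0 < νs i) (hνsν : ∀ i, νs i < ν)
    (hρ : 0 < ρ) (hρs : ∀ i, 0 ≤ ρs i) (hC : 0 < C) {t : ℝ} (ht : 0 < t) :
    hFun M ν νs ρ ρs C t ≤ gFun M ν νs ρ ρs C t := by
  have hβ := beta_pos' hν0 hνsν (M := M)
  have hd := d_nonneg' hρ hρs hC (M := M)
  have hnn := hFun_nonneg hν0 hν1 hνs0 hνsν hρ hρs hC ht.le
  have e : gFun M ν νs ρ ρs C t = |hFun M ν νs ρ ρs C t| + hFun M ν νs ρ ρs C t := by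
    have c1 : ∀ i, ∫ s in (0:ℝ)..t, omegaK (1 - νs i) (t - s) *
          calE (Fin.cons ν fun i => ν - νs i) ν (Fin.cons (C / ρ) fun i => ρs i / ρ) s
        = calE (Fin.cons ν fun i => ν - νs i) (1 + ν - νs i)
          (Fin.cons (C / ρ) fun i => ρs i / ρ) t := by
      intro i
      rw [calE_conv_hasSum _ _ hβ hd ht (by linarith [hνsν i]) hν0]
      congr 1; ring
    rw [hFun_rec hν0 hνsν hρ hρs hC ht, ← hFun_rec hν0 hνsν hρ hρs hC ht, gFun]
    simp_rw [c1]
    rw [calE_conv_hasSum _ _ hβ hd ht (by linarith) hν0, show ν + (1 - ν) = 1 by ring,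
      add_assoc, ← hFun_rec hν0 hνsν hρ hρs hC ht]
    rfl
  rw [e]
  linarith [abs_nonneg (hFun M ν νs ρ ρs C t)]

end relax

lemma second_deriv_nonpos {φ φ' : ℝ → ℝ} {φ'' x : ℝ}
    (h1 : ∀ᶠ y in nhds x, HasDerivAt φ (φ' y) y) (h2 : HasDerivAt φ' φ'' x)
    (hm : IsLocalMax φ x) : φ'' ≤ 0 := by
  by_contra hpos
  push Not at hpos
  have e : deriv φ =ᶠ[nhds x] φ' := h1.mono fun y hy => hy.deriv
  have hd2 : deriv (deriv φ) x = φ'' := by rw [e.deriv_eq, h2.deriv]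
  have hmin := isLocalMin_of_deriv_deriv_pos (f := φ) (x₀ := x) (by rw [hd2]; exact hpos)
    hm.deriv_eq_zero h1.self_of_nhds.continuousAt
  have hconst : φ =ᶠ[nhds x] fun _ => φ x := by
    filter_upwards [hm, hmin] with y ha hb
    exact le_antisymm ha hb
  have : deriv φ =ᶠ[nhds x] fun _ => 0 := by
    refine hconst.deriv.trans (Filter.Eventually.of_forall fun y => ?_)
    simp
  have h3 := this.deriv_eq
  rw [hd2] at h3
  simp at h3
  linarith

lemma upper_bound
    {x₀ x₁ : ℝ} {M : ℕ} {ν : ℝ} {νs : Fin M → ℝ}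
    (hν1 : ν < 1) (hν0 : 0 < ν) (hνs0 : ∀ i, 0 < νs i) (hνsν : ∀ i, νs i < ν)
    {ρ : ℝ} {ρs : Fin M → ℝ} (hρ : 0 < ρ) (hρs : ∀ i, 0 ≤ ρs i)
    {a₁ a₀ a₁x : ℝ → ℝ → ℝ} {δ₁ δ₀ : ℝ} (hδ₁ : 0 < δ₁) (hδ₀ : 0 < δ₀)
    (ha₁low : ∀ x ∈ Icc x₀ x₁, ∀ t ∈ Ici (0:ℝ), δ₁ ≤ a₁ x t)
    (ha₀up : ∀ x ∈ Icc x₀ x₁, ∀ t ∈ Ici (0:ℝ), δ₀ ≤ -a₀ x t)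
    {f : ℝ → ℝ} {K : ℝ} (hK : 0 ≤ K) (hf : ∀ y, 0 < y → -K ≤ f y)
    {u ux uxx : ℝ → ℝ → ℝ}
    (huc : ContinuousOn (fun p : ℝ × ℝ => u p.1 p.2) (Icc x₀ x₁ ×ˢ Ici 0))
    (hux : ∀ t ∈ Ioi (0:ℝ), ∀ x ∈ Icc x₀ x₁, HasDerivAt (fun y => u y t) (ux x t) x)
    (huxx : ∀ t ∈ Ioi (0:ℝ), ∀ x ∈ Icc x₀ x₁, HasDerivAt (fun y => ux y t) (uxx x t) x)
    (hbc : ∀ t ∈ Ici (0:ℝ), u x₀ t = 0 ∧ u x₁ t = 0)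
    (hdiff : ∀ x ∈ Ioo x₀ x₁, ∀ t ∈ Ioi (0:ℝ),
        DifferentiableAt ℝ (caputoKernel ν (fun s => u x s)) t ∧
        ∀ i, DifferentiableAt ℝ (caputoKernel (νs i) (fun s => u x s)) t)
    (heq : ∀ x ∈ Ioo x₀ x₁, ∀ t ∈ Ioi (0:ℝ),
        ρ * caputo ν (fun s => u x s) t
            + ∑ i, ρs i * caputo (νs i) (fun s => u x s) t
          = a₁x x t * ux x t + a₁ x t * uxx x t + a₀ x t * u x t - f (u x t))
    {N : ℝ} (hN : 0 ≤ N) (huN : ∀ x ∈ Icc x₀ x₁, u x 0 ≤ N)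
    {t : ℝ} (ht : 0 < t) {x : ℝ} (hx : x ∈ Icc x₀ x₁) :
    u x t ≤ (K + 1) / δ₀ + N * hFun M ν νs ρ ρs δ₀ t := by
  by_contra hcon
  push Not at hcon
  set h := hFun M ν νs ρ ρs δ₀ with hh
  set A := (K + 1) / δ₀ with hA
  have hA0 : 0 < A := by positivity
  have hc : ContinuousOn h (Ici 0) := hFun_cont hν0 hνsν hρ hρs hδ₀
  have hnn : ∀ s, 0 ≤ s → 0 ≤ h s := fun s hs =>
    hFun_nonneg hν0 hν1 hνs0 hνsν hρ hρs hδ₀ hs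
  have hzc : ContinuousOn (fun p : ℝ × ℝ => u p.1 p.2 - A - N * h p.2)
      (Icc x₀ x₁ ×ˢ Icc 0 t) := by
    refine ((huc.mono (prod_mono_right fun s hs => hs.1)).sub continuousOn_const).sub
      (ContinuousOn.const_mul ?_ N)
    exact hc.comp continuousOn_snd fun p hp => hp.2.1
  obtain ⟨⟨y, τ⟩, ⟨hy, hτ⟩, hmax⟩ := (isCompact_Icc.prod isCompact_Icc).exists_isMaxOn
    ⟨(x, t), hx, right_mem_Icc.2 ht.le⟩ hzc
  have hmax' : ∀ y' ∈ Icc x₀ x₁, ∀ s ∈ Icc 0 t,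
      u y' s - A - N * h s ≤ u y τ - A - N * h τ := fun y' hy' s hs =>
    hmax (show (y', s) ∈ Icc x₀ x₁ ×ˢ Icc 0 t from ⟨hy', hs⟩)
  have hτ0' : 0 ≤ τ := hτ.1
  have hypos : 0 < u y τ - A - N * h τ := by
    have := hmax' x hx t (right_mem_Icc.2 ht.le)
    linarith
  have hNh : 0 ≤ N * h τ := mul_nonneg hN (hnn τ hτ0')
  have hτ0 : 0 < τ := by
    rcases eq_or_lt_of_le hτ0' with e | e
    · have h1 := huN y hy
      rw [← e, hh, hFun_zero] at hypos
      linarith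
    · exact e
  have hyI : y ∈ Ioo x₀ x₁ := by
    refine ⟨lt_of_le_of_ne hy.1 fun e => ?_, lt_of_le_of_ne hy.2 fun e => ?_⟩
    · rw [← e, (hbc τ hτ0').1] at hypos; linarith
    · rw [e, (hbc τ hτ0').2] at hypos; linarith
  have hut : ContinuousOn (fun s => u y s) (Ici 0) :=
    huc.comp (f := fun s : ℝ => (y, s)) (by fun_prop) fun s hs => ⟨hy, hs⟩
  have hcmp : ∀ θ, 0 < θ → θ < 1 → DifferentiableAt ℝ (caputoKernel θ (fun s => u y s)) τ →
      N * caputo θ h τ ≤ caputo θ (fun s => u y s) τ := by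
    intro θ h0 h1 hd
    exact compare_time (A := A) h0 h1 hτ0 hut hc hd
      (hFun_caputo hν0 hνsν hρ hρs hδ₀ hτ0 h1).differentiableAt
      fun s hs0 hs1 => hmax' y hy s ⟨hs0, hs1.trans hτ.2⟩
  obtain ⟨hd1, hd2⟩ := hdiff y hyI τ hτ0
  have hlow : N * (-δ₀ * h τ) ≤ ρ * caputo ν (fun s => u y s) τ
      + ∑ i, ρs i * caputo (νs i) (fun s => u y s) τ := by
    rw [← hFun_eqn hν0 hν1 hνsν hρ hρs hδ₀ hτ0, mul_add, Finset.mul_sum]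
    refine add_le_add ?_ (Finset.sum_le_sum fun i _ => ?_)
    · have := mul_le_mul_of_nonneg_left (hcmp ν hν0 hν1 hd1) hρ.le
      linarith
    · have := mul_le_mul_of_nonneg_left (hcmp _ (hνs0 i) ((hνsν i).trans hν1) (hd2 i)) (hρs i)
      linarith
  rw [heq y hyI τ hτ0] at hlow
  have hlm : IsLocalMax (fun y => u y τ) y := by
    filter_upwards [Ioo_mem_nhds hyI.1 hyI.2] with z hz
    have := hmax' z ⟨hz.1.le, hz.2.le⟩ τ hτ
    linarith
  have hux0 : ux y τ = 0 := hlm.hasDerivAt_eq_zero (hux τ hτ0 y hy)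
  have huxx0 : uxx y τ ≤ 0 := by
    refine second_deriv_nonpos ?_ (huxx τ hτ0 y hy) hlm
    filter_upwards [Ioo_mem_nhds hyI.1 hyI.2] with z hz
    exact hux τ hτ0 z ⟨hz.1.le, hz.2.le⟩
  have hup : 0 < u y τ := by linarith
  have hf1 := hf _ hup
  have e1 : a₁ y τ * uxx y τ ≤ 0 :=
    mul_nonpos_of_nonneg_of_nonpos (hδ₁.le.trans (ha₁low y hy τ hτ0')) huxx0
  have e2 : δ₀ * u y τ ≤ -a₀ y τ * u y τ :=
    mul_le_mul_of_nonneg_right (ha₀up y hy τ hτ0') hup.le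
  rw [hux0] at hlow
  have e3 : δ₀ * (u y τ - N * h τ) ≤ K := by nlinarith
  have e4 : δ₀ * A = K + 1 := by rw [hA]; field_simp
  have e5 : δ₀ * A < δ₀ * (u y τ - N * h τ) := mul_lt_mul_of_pos_left (by linarith) hδ₀
  linarith

lemma sobolev {x₀ x₁ : ℝ} (hx : x₀ < x₁) {u₀ u₀' : ℝ → ℝ}
    (hd : ∀ x ∈ Icc x₀ x₁, HasDerivAt u₀ (u₀' x) x) (hc : ContinuousOn u₀' (Icc x₀ x₁))
    (h0 : u₀ x₀ = 0) {x : ℝ} (hxm : x ∈ Icc x₀ x₁) :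
    |u₀ x| ≤ Real.sqrt (x₁ - x₀) * Real.sqrt (∫ x in x₀..x₁, ((u₀ x) ^ 2 + (u₀' x) ^ 2)) := by
  set I := ∫ x in x₀..x₁, ((u₀ x) ^ 2 + (u₀' x) ^ 2) with hI
  have hℓ : 0 < x₁ - x₀ := by linarith
  have huc : ContinuousOn u₀ (Icc x₀ x₁) := fun y hy => (hd y hy).continuousAt.continuousWithinAt
  have hsub : uIcc x₀ x ⊆ Icc x₀ x₁ := by
    rw [uIcc_of_le hxm.1]; exact Icc_subset_Icc_right hxm.2
  have hIntg : IntervalIntegrable u₀' volume x₀ x := (hc.mono hsub).intervalIntegrable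
  have hftc : ∫ y in x₀..x, u₀' y = u₀ x := by
    rw [intervalIntegral.integral_eq_sub_of_hasDerivAt (fun y hy => hd y (hsub hy)) hIntg, h0,
      sub_zero]
  have hI0 : 0 ≤ I := intervalIntegral.integral_nonneg hx.le fun y _ => by positivity
  have key : ∀ e : ℝ, 0 < e → |u₀ x| ≤ (e * (x₁ - x₀) + I / e) / 2 := by
    intro e he
    have hci : ContinuousOn (fun y => (e + ((u₀ y) ^ 2 + (u₀' y) ^ 2) / e) / 2) (Icc x₀ x₁) := by
      fun_prop
    have hci2 : ContinuousOn (fun y => (u₀ y) ^ 2 + (u₀' y) ^ 2) (Icc x₀ x₁) := by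
      fun_prop
    have hA : |u₀ x| ≤ ∫ y in x₀..x, (e + ((u₀ y) ^ 2 + (u₀' y) ^ 2) / e) / 2 := by
      rw [← hftc]
      refine (intervalIntegral.abs_integral_le_integral_abs hxm.1).trans ?_
      refine intervalIntegral.integral_mono_on hxm.1 hIntg.abs
        (hci.mono hsub).intervalIntegrable fun y hy => ?_
      have h1 : 0 ≤ (e - |u₀' y|) ^ 2 := sq_nonneg _
      have h2 := sq_abs (u₀' y)
      have h3 : |u₀' y| * (2 * e) ≤ e * e + ((u₀ y) ^ 2 + (u₀' y) ^ 2) := by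
        nlinarith [sq_nonneg (u₀ y)]
      have h4 : (e + ((u₀ y) ^ 2 + (u₀' y) ^ 2) / e) / 2
        = (e * e + ((u₀ y) ^ 2 + (u₀' y) ^ 2)) / (2 * e) := by field_simp
      rw [h4, le_div_iff₀ (by positivity)]
      exact h3
    have hB : ∫ y in x₀..x, (e + ((u₀ y) ^ 2 + (u₀' y) ^ 2) / e) / 2
        ≤ ∫ y in x₀..x₁, (e + ((u₀ y) ^ 2 + (u₀' y) ^ 2) / e) / 2 := by
      refine intervalIntegral.integral_mono_interval le_rfl hxm.1 hxm.2 ?_ ?_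
      · exact Filter.Eventually.of_forall fun y => by
          simp only [Pi.zero_apply]; positivity
      · exact ContinuousOn.intervalIntegrable (by rwa [uIcc_of_le hx.le])
    have hCc : ∫ y in x₀..x₁, (e + ((u₀ y) ^ 2 + (u₀' y) ^ 2) / e) / 2
        = (e * (x₁ - x₀) + I / e) / 2 := by
      have hi2 : IntervalIntegrable (fun y => (u₀ y) ^ 2 + (u₀' y) ^ 2) volume x₀ x₁ :=
        ContinuousOn.intervalIntegrable (by rwa [uIcc_of_le hx.le])
      rw [intervalIntegral.integral_div, intervalIntegral.integral_add
        intervalIntegrable_const (hi2.div_const e), intervalIntegral.integral_div,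
        intervalIntegral.integral_const, smul_eq_mul]
      ring
    exact (hA.trans hB).trans hCc.le
  rcases eq_or_lt_of_le hI0 with e | e
  · rw [← e, Real.sqrt_zero, mul_zero]
    refine le_of_forall_pos_le_add fun ε hε => ?_
    have := key (ε / (x₁ - x₀)) (by positivity)
    rw [← e, zero_div, add_zero, div_mul_cancel₀ _ hℓ.ne'] at this
    linarith
  · have s1 : 0 < Real.sqrt I := Real.sqrt_pos.2 e
    have s2 : 0 < Real.sqrt (x₁ - x₀) := Real.sqrt_pos.2 hℓ
    have := key (Real.sqrt I / Real.sqrt (x₁ - x₀)) (by positivity)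
    refine this.trans (le_of_eq ?_)
    have q1 := Real.mul_self_sqrt hI0
    have q2 := Real.mul_self_sqrt hℓ.le
    set a := Real.sqrt I
    set b := Real.sqrt (x₁ - x₀)
    rw [← q1, ← q2]
    field_simp
    ring

lemma caputoKernel_neg (θ : ℝ) (v : ℝ → ℝ) :
    caputoKernel θ (fun s => -v s) = fun τ => -caputoKernel θ v τ := by
  funext τ
  unfold caputoKernel
  have : ∀ s, (τ - s) ^ (-θ) * (-v s - -v 0) = -((τ - s) ^ (-θ) * (v s - v 0)) := fun s => by ring
  simp_rw [this]
  rw [intervalIntegral.integral_neg]; ring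

lemma caputo_neg (θ : ℝ) (v : ℝ → ℝ) (t : ℝ) :
    caputo θ (fun s => -v s) t = -caputo θ v t := by
  unfold caputo
  rw [caputoKernel_neg]
  exact deriv.fun_neg

/-- Corollary 1 (one-dimensional case): pointwise decay estimate for classical solutions
of the homogeneous Dirichlet problem with constant coefficients in the fractional
differential operator and without the memory term (`𝒦 ≡ 0`), `γ ≥ 1`. -/
theorem stmt3
    -- the domain Ω = (x₀, x₁)
    (x₀ x₁ : ℝ) (hx : x₀ < x₁)
    -- h1: orders of the fractional derivatives
    (M : ℕ) (ν : ℝ) (νs : Fin M → ℝ)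
    (hν1 : ν < 1) (hν0 : 0 < ν) (hνs0 : ∀ i, 0 < νs i)
    (hνsmono : StrictMono νs) (hνsν : ∀ i, νs i < ν)
    -- constant coefficients of the fractional differential operator
    (ρ : ℝ) (ρs : Fin M → ℝ) (hρ : 0 < ρ) (hρs : ∀ i, 0 ≤ ρs i)
    -- h2, h3: the coefficients a₁, a₀ and their regularity
    (a₁ a₀ a₁x a₀x : ℝ → ℝ → ℝ)
    (δ₁ δ₀ : ℝ) (hδ₁ : 0 < δ₁) (hδ₀ : 0 < δ₀)
    (ha₁c : ContinuousOn (fun p : ℝ × ℝ => a₁ p.1 p.2) (Icc x₀ x₁ ×ˢ Ici 0))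
    (ha₀c : ContinuousOn (fun p : ℝ × ℝ => a₀ p.1 p.2) (Icc x₀ x₁ ×ˢ Ici 0))
    (ha₁d : ∀ t ∈ Ici (0:ℝ), ∀ x ∈ Icc x₀ x₁, HasDerivAt (fun y => a₁ y t) (a₁x x t) x)
    (ha₀d : ∀ t ∈ Ici (0:ℝ), ∀ x ∈ Icc x₀ x₁, HasDerivAt (fun y => a₀ y t) (a₀x x t) x)
    (ha₁xc : ContinuousOn (fun p : ℝ × ℝ => a₁x p.1 p.2) (Icc x₀ x₁ ×ˢ Ici 0))
    (ha₀xc : ContinuousOn (fun p : ℝ × ℝ => a₀x p.1 p.2) (Icc x₀ x₁ ×ˢ Ici 0))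
    (Ba : ℝ)
    (hBa : ∀ x ∈ Icc x₀ x₁, ∀ t ∈ Ici (0:ℝ),
      |a₁ x t| ≤ Ba ∧ |a₀ x t| ≤ Ba ∧ |a₁x x t| ≤ Ba ∧ |a₀x x t| ≤ Ba)
    (ha₁low : ∀ x ∈ Icc x₀ x₁, ∀ t ∈ Ici (0:ℝ), δ₁ ≤ a₁ x t)
    (ha₀up : ∀ x ∈ Icc x₀ x₁, ∀ t ∈ Ici (0:ℝ), δ₀ ≤ -a₀ x t)
    -- h5: the nonlinearity f, with γ ≥ 1
    (f f' : ℝ → ℝ) (hfd : ∀ y : ℝ, HasDerivAt f (f' y) y) (hf'c : Continuous f')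
    (L₁ L₂ L₃ L₄ γ : ℝ)
    (hL₁ : 0 ≤ L₁) (hL₂ : 0 ≤ L₂) (hL₃ : 0 < L₃) (hL₄ : 0 ≤ L₄) (hγ : 1 ≤ γ)
    (hfg : ∀ y : ℝ, |f y| ≤ L₁ * (1 + |y| ^ γ))
    (hfc : ∀ y : ℝ, -L₂ + L₃ * |y| ^ (γ + 1) ≤ y * f y)
    (hf'low : ∀ y : ℝ, -L₄ ≤ f' y)
    -- condition (3.1): Sa₁ is the sup-norm bound of ∂a₁/∂x
    (Sa₁ : ℝ) (hSa₁ : ∀ x ∈ Icc x₀ x₁, ∀ t ∈ Ici (0:ℝ), |a₁x x t| ≤ Sa₁)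
    (h31 : (∀ x ∈ Icc x₀ x₁, ∀ t ∈ Ici (0:ℝ), a₁x x t = 0) ∨
      ∃ δstar : ℝ, 0 < δstar ∧ δstar < δ₁ ∧ 0 < δstar * (δ₁ + δ₀) - Sa₁ ^ 2) :
    -- conclusion: constants C₀, C₀* depending only on the structural data
    ∃ C₀ > (0:ℝ), ∃ C₀star > (0:ℝ), ∀ (u ux uxx : ℝ → ℝ → ℝ) (u₀ u₀' : ℝ → ℝ),
      -- initial datum u₀ ∈ C¹(Ω̄) with u₀(x₀)=u₀(x₁)=0
      (∀ x ∈ Icc x₀ x₁, HasDerivAt u₀ (u₀' x) x) →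
      ContinuousOn u₀' (Icc x₀ x₁) →
      u₀ x₀ = 0 → u₀ x₁ = 0 →
      -- regularity of the classical solution u
      ContinuousOn (fun p : ℝ × ℝ => u p.1 p.2) (Icc x₀ x₁ ×ˢ Ici 0) →
      (∀ t ∈ Ioi (0:ℝ), ∀ x ∈ Icc x₀ x₁, HasDerivAt (fun y => u y t) (ux x t) x) →
      (∀ t ∈ Ioi (0:ℝ), ∀ x ∈ Icc x₀ x₁, HasDerivAt (fun y => ux y t) (uxx x t) x) →
      ContinuousOn (fun p : ℝ × ℝ => ux p.1 p.2) (Icc x₀ x₁ ×ˢ Ioi 0) →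
      ContinuousOn (fun p : ℝ × ℝ => uxx p.1 p.2) (Icc x₀ x₁ ×ˢ Ioi 0) →
      -- initial and boundary conditions
      (∀ x ∈ Icc x₀ x₁, u x 0 = u₀ x) →
      (∀ t ∈ Ici (0:ℝ), u x₀ t = 0 ∧ u x₁ t = 0) →
      -- existence of the Caputo derivatives
      (∀ x ∈ Ioo x₀ x₁, ∀ t ∈ Ioi (0:ℝ),
        DifferentiableAt ℝ (caputoKernel ν (fun s => u x s)) t ∧
        ∀ i, DifferentiableAt ℝ (caputoKernel (νs i) (fun s => u x s)) t) →
      -- the equation (with 𝒦 ≡ 0)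
      (∀ x ∈ Ioo x₀ x₁, ∀ t ∈ Ioi (0:ℝ),
        ρ * caputo ν (fun s => u x s) t
            + ∑ i, ρs i * caputo (νs i) (fun s => u x s) t
          = a₁x x t * ux x t + a₁ x t * uxx x t + a₀ x t * u x t - f (u x t)) →
      -- the pointwise estimate with the decaying factor 𝔤
      ∀ t > (0:ℝ), ∀ x ∈ Icc x₀ x₁,
        |u x t| ≤ C₀ * (1 + Real.sqrt (∫ x in x₀..x₁, ((u₀ x) ^ 2 + (u₀' x) ^ 2))
          * gFun M ν νs ρ ρs C₀star t) := by
  -- the constants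
  set K := 2 * L₁ + L₂ with hKdef
  have hK : 0 ≤ K := by positivity
  have hf0 : ∀ y : ℝ, y ≠ 0 → |y| * (-K) ≤ y * f y := by
    intro y hy
    have hyp : 0 < |y| := abs_pos.2 hy
    rcases le_total |y| 1 with h | h
    · have h1 := hfg y
      have h2 : |y| ^ γ ≤ 1 := Real.rpow_le_one hyp.le h (by linarith)
      have h3 : |f y| ≤ K := by nlinarith
      have h4 : |y * f y| ≤ |y| * K := by
        rw [abs_mul]; exact mul_le_mul_of_nonneg_left h3 hyp.le
      have := (abs_le.1 h4).1
      linarith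
    · have h1 := hfc y
      have h2 : 0 ≤ L₃ * |y| ^ (γ + 1) := mul_nonneg hL₃.le (Real.rpow_nonneg hyp.le _)
      nlinarith
  have hfpos : ∀ y, 0 < y → -K ≤ f y := by
    intro y hy
    have := hf0 y hy.ne'
    rw [abs_of_pos hy] at this
    exact le_of_mul_le_mul_left this hy
  have hfneg : ∀ y, 0 < y → -K ≤ -f (-y) := by
    intro y hy
    have := hf0 (-y) (neg_ne_zero.2 hy.ne')
    rw [abs_neg, abs_of_pos hy] at this
    refine le_of_mul_le_mul_left ?_ hy
    linarith
  have hAp : 0 < (K + 1) / δ₀ := by positivity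
  have hS : 0 ≤ Real.sqrt (x₁ - x₀) := Real.sqrt_nonneg _
  refine ⟨(K + 1) / δ₀ + Real.sqrt (x₁ - x₀), by positivity, δ₀, hδ₀, ?_⟩
  intro u ux uxx u₀ u₀' hu₀ hu₀c hb0 hb1 huc hux huxx _ _ hinit hbc hdiff heq t ht x hxm
  set n := Real.sqrt (∫ x in x₀..x₁, ((u₀ x) ^ 2 + (u₀' x) ^ 2)) with hn
  have hn0 : 0 ≤ n := Real.sqrt_nonneg _
  have hN : 0 ≤ Real.sqrt (x₁ - x₀) * n := mul_nonneg hS hn0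
  have hsob : ∀ y ∈ Icc x₀ x₁, |u y 0| ≤ Real.sqrt (x₁ - x₀) * n := by
    intro y hy
    rw [hinit y hy]
    exact sobolev hx hu₀ hu₀c hb0 hy
  have hup := upper_bound hν1 hν0 hνs0 hνsν hρ hρs hδ₁ hδ₀ ha₁low ha₀up hK hfpos huc hux huxx
    hbc hdiff heq hN (fun y hy => (le_abs_self _).trans (hsob y hy)) ht hxm
  have hlo := upper_bound (u := fun x t => -u x t) (ux := fun x t => -ux x t)
    (uxx := fun x t => -uxx x t) (f := fun y => -f (-y)) (a₁x := a₁x)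
    hν1 hν0 hνs0 hνsν hρ hρs hδ₁ hδ₀ ha₁low ha₀up hK hfneg
    huc.neg (fun t ht x hx => (hux t ht x hx).neg) (fun t ht x hx => (huxx t ht x hx).neg)
    (fun t ht => by simp [(hbc t ht).1, (hbc t ht).2])
    (fun x hx t ht => by
      obtain ⟨h1, h2⟩ := hdiff x hx t ht
      simp only [caputoKernel_neg]
      exact ⟨h1.neg, fun i => (h2 i).neg⟩)
    (fun x hx t ht => by
      have h1 := heq x hx t ht
      simp only [caputo_neg, mul_neg, Finset.sum_neg_distrib, neg_neg]
      linarith)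
    hN (fun y hy => (neg_le_abs _).trans (hsob y hy)) ht hxm
  have hg := gFun_ge hν0 hν1 hνs0 hνsν hρ hρs hδ₀ ht (M := M)
  have hh := hFun_nonneg hν0 hν1 hνs0 hνsν hρ hρs hδ₀ (le_of_lt ht) (M := M)
  set h := hFun M ν νs ρ ρs δ₀ t
  set g := gFun M ν νs ρ ρs δ₀ t
  have h1 : |u x t| ≤ (K + 1) / δ₀ + Real.sqrt (x₁ - x₀) * n * h :=
    abs_le.2 ⟨by linarith, hup⟩
  have h2 : Real.sqrt (x₁ - x₀) * n * h ≤ Real.sqrt (x₁ - x₀) * n * g :=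
    mul_le_mul_of_nonneg_left hg hN
  have h3 : 0 ≤ (K + 1) / δ₀ * (n * g) :=
    mul_nonneg hAp.le (mul_nonneg hn0 (hh.trans hg))
  calc |u x t| ≤ _ := h1
    _ ≤ ((K + 1) / δ₀ + Real.sqrt (x₁ - x₀)) * (1 + n * g) := by
      ring_nf at h2 h3 ⊢
      linarith
end

section
/- Let m≥2, let 0<β_m<β_{m−1}<⋯<β₂<β₁=β₀<1, and let d₁,…,d_m>0. Let θ∈[0,1] and let k:(0,∞)→[0,∞) be integrable on (0,∞) with k(t) ≤ C·t^{−θ} for some C>0 and all t>0. Then the function G(t) = ∫₀ᵗ ℰ_{β̄,β₀}(t−s;d̄)·k(s) ds is nonnegative for all t>0 and belongs to L¹(0,∞). -/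
open MeasureTheory Set

lemma ml_gamma_lb (R : ℝ) (hR : 0 < R) : ∃ c > 0, ∀ x > 0, c * R ^ x ≤ Real.Gamma x := by
  refine ⟨Real.exp (-(R + 1)) / (R + 1), by positivity, fun x hx => ?_⟩
  rw [Real.Gamma_eq_integral hx]
  have hint := Real.GammaIntegral_convergent hx
  have h1 : ∫ u in Ioc R (R + 1), Real.exp (-(R + 1)) / (R + 1) * R ^ x
      ≤ ∫ u in Ioc R (R + 1), Real.exp (-u) * u ^ (x - 1) := by
    refine setIntegral_mono_on ?_ (hint.mono_set ?_) measurableSet_Ioc ?_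
    · exact integrableOn_const (by simp)
    · exact fun u hu => hR.trans hu.1
    · intro u hu
      have hu0 : 0 < u := hR.trans hu.1
      rw [Real.rpow_sub_one hu0.ne', div_mul_eq_mul_div, ← mul_div_assoc]
      have := hu.1.le
      have := hu.2
      gcongr
  have h2 : ∫ u in Ioc R (R + 1), Real.exp (-u) * u ^ (x - 1)
      ≤ ∫ u in Ioi (0:ℝ), Real.exp (-u) * u ^ (x - 1) := by
    refine setIntegral_mono_set hint ?_ ?_
    · filter_upwards [ae_restrict_mem measurableSet_Ioi] with u hu
      have : (0:ℝ) < u := hu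
      simp only [Pi.zero_apply]
      positivity
    · exact Filter.Eventually.of_forall fun u (hu : u ∈ Ioc R (R+1)) => hR.trans hu.1
  simp only [MeasureTheory.integral_const, MeasurableSet.univ, measureReal_restrict_apply,
    univ_inter, Real.volume_real_Ioc, add_sub_cancel_left, smul_eq_mul] at h1
  norm_num at h1
  have e : -1 + -R = -(R + 1) := by ring
  rw [e] at h1
  linarith

lemma ml_beta (a b t : ℝ) (ha : 0 < a) (hb : 0 < b) (ht : 0 < t) :
    IntervalIntegrable (fun s => ((t - s) ^ (a - 1) / Real.Gamma a) *
      (s ^ (b - 1) / Real.Gamma b)) volume 0 t ∧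
    ∫ s in (0:ℝ)..t, ((t - s) ^ (a - 1) / Real.Gamma a) *
      (s ^ (b - 1) / Real.Gamma b) = t ^ (a + b - 1) / Real.Gamma (a + b) := by
  have hga := Real.Gamma_pos_of_pos ha
  have hgb := Real.Gamma_pos_of_pos hb
  have hgab := Real.Gamma_pos_of_pos (add_pos ha hb)
  have e : ∫ s in (0:ℝ)..t, ((t - s) ^ (a - 1) / Real.Gamma a) *
      (s ^ (b - 1) / Real.Gamma b) = t ^ (a + b - 1) / Real.Gamma (a + b) := by
    have h := Complex.betaIntegral_scaled (b : ℂ) (a : ℂ) ht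
    rw [Complex.betaIntegral_eq_Gamma_mul_div _ _ (by simpa) (by simpa)] at h
    have h2 : ∫ x in (0:ℝ)..t, (x : ℂ) ^ ((b:ℂ) - 1) * ((t : ℂ) - x) ^ ((a:ℂ) - 1)
        = ∫ x in (0:ℝ)..t, ((x ^ (b - 1) * (t - x) ^ (a - 1) : ℝ) : ℂ) := by
      refine intervalIntegral.integral_congr fun x hx => ?_
      rw [uIcc_of_le ht.le] at hx
      have hx2 : 0 ≤ t - x := by linarith [hx.2]
      push_cast
      rw [Complex.ofReal_cpow hx.1, Complex.ofReal_cpow hx2]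
      push_cast
      rfl
    rw [h2, intervalIntegral.integral_ofReal, ← Complex.ofReal_add, Complex.Gamma_ofReal,
      Complex.Gamma_ofReal, Complex.Gamma_ofReal] at h
    have h3 : ((t:ℂ) ^ (((b + a : ℝ) : ℂ) - 1)) = ((t ^ (b + a - 1) : ℝ) : ℂ) := by
      rw [Complex.ofReal_cpow ht.le]; push_cast; rfl
    rw [h3] at h
    norm_cast at h
    have h4 : ∫ s in (0:ℝ)..t, ((t - s) ^ (a - 1) / Real.Gamma a) * (s ^ (b - 1) / Real.Gamma b)
        = ∫ s in (0:ℝ)..t, (Real.Gamma a * Real.Gamma b)⁻¹ * (s ^ (b - 1) * (t - s) ^ (a - 1)) := by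
      congr 1; ext s; field_simp
    rw [h4, intervalIntegral.integral_const_mul, h, add_comm b a]
    field_simp
  refine ⟨?_, e⟩
  by_contra hn
  rw [intervalIntegral.integral_undef hn] at e
  have : 0 < t ^ (a + b - 1) / Real.Gamma (a + b) := by positivity
  linarith

/-- multinomial sum -/
noncomputable def mlS {m : ℕ} (β d : Fin m → ℝ) (k : ℕ) (F : ℝ → ℝ) : ℝ :=
  ∑ κ ∈ Finset.Nat.antidiagonalTuple m k,
    (((k.factorial : ℝ) / ∏ j, ((κ j).factorial : ℝ)) * ∏ j, d j ^ κ j) *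
      F (∑ j, β j * (κ j : ℝ))

open AddMonoidAlgebra in
lemma mlS_eq {m : ℕ} (β d : Fin m → ℝ) (k : ℕ) (F : ℝ → ℝ) :
    mlS β d k F = Finsupp.linearCombination ℝ F
      ((∑ j, single (β j) (d j) : AddMonoidAlgebra ℝ ℝ) ^ k).coeff := by
  rw [Finset.sum_pow_eq_sum_piAntidiag, Finset.piAntidiag_univ_fin_eq_antidiagonalTuple,
    AddMonoidAlgebra.coeff_sum, map_sum, mlS]
  refine Finset.sum_congr rfl fun κ hκ => ?_
  rw [Finset.Nat.mem_antidiagonalTuple] at hκ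
  have h1 : (∏ i, (single (β i) (d i) : AddMonoidAlgebra ℝ ℝ) ^ κ i)
      = single (∑ j, β j * (κ j : ℝ)) (∏ j, d j ^ κ j) := by
    simp_rw [AddMonoidAlgebra.single_pow, nsmul_eq_mul, mul_comm]
    induction (Finset.univ : Finset (Fin m)) using Finset.induction_on with
    | empty => simp [AddMonoidAlgebra.one_def]
    | insert a s ha ih =>
      rw [Finset.prod_insert ha, Finset.sum_insert ha, Finset.prod_insert ha, ih,
        AddMonoidAlgebra.single_mul_single]
  have h2 : ((k.factorial : ℝ) / ∏ j, ((κ j).factorial : ℝ))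
      = (Nat.multinomial Finset.univ κ : ℝ) := by
    have := Nat.multinomial_spec Finset.univ κ
    rw [hκ] at this
    rw [← this]
    push_cast
    rw [mul_comm, mul_div_assoc, div_self, mul_one]
    exact Finset.prod_ne_zero_iff.mpr fun j _ => by positivity
  rw [h1, h2, ← nsmul_eq_mul (α := AddMonoidAlgebra ℝ ℝ), AddMonoidAlgebra.coeff_smul, map_nsmul,
    AddMonoidAlgebra.coeff_single, Finsupp.linearCombination_single]
  simp [mul_assoc]

open AddMonoidAlgebra in
lemma mlS_succ {m : ℕ} (β d : Fin m → ℝ) (k : ℕ) (F : ℝ → ℝ) :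
    mlS β d (k + 1) F = ∑ j, d j * mlS β d k (fun e => F (β j + e)) := by
  simp_rw [mlS_eq]
  rw [pow_succ', Finset.sum_mul, AddMonoidAlgebra.coeff_sum, map_sum]
  refine Finset.sum_congr rfl fun j _ => ?_
  generalize (∑ j, single (β j) (d j) : AddMonoidAlgebra ℝ ℝ) ^ k = p
  induction p using AddMonoidAlgebra.induction_linear with
  | zero => simp
  | add p q hp hq =>
    rw [mul_add, AddMonoidAlgebra.coeff_add, map_add, hp, hq, AddMonoidAlgebra.coeff_add, map_add,
      mul_add]
  | single e r =>
    rw [AddMonoidAlgebra.single_mul_single, AddMonoidAlgebra.coeff_single,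
      AddMonoidAlgebra.coeff_single, Finsupp.linearCombination_single,
      Finsupp.linearCombination_single, smul_eq_mul, smul_eq_mul, mul_assoc]

lemma mlS_zero {m : ℕ} (β d : Fin m → ℝ) (F : ℝ → ℝ) : mlS β d 0 F = F 0 := by
  rw [mlS_eq, pow_zero, AddMonoidAlgebra.one_def, AddMonoidAlgebra.coeff_single,
    Finsupp.linearCombination_single, smul_eq_mul, one_mul]

lemma mlS_mono {m : ℕ} (β d : Fin m → ℝ) (hβ : ∀ i, 0 < β i) (hd : ∀ i, 0 < d i) (k : ℕ)
    (F G : ℝ → ℝ) (h : ∀ e, 0 ≤ e → F e ≤ G e) : mlS β d k F ≤ mlS β d k G := by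
  refine Finset.sum_le_sum fun κ _ => ?_
  refine mul_le_mul_of_nonneg_left (h _ ?_) ?_
  · exact Finset.sum_nonneg fun j _ => mul_nonneg (hβ j).le (by positivity)
  · have : 0 ≤ ∏ j, d j ^ κ j := Finset.prod_nonneg fun j _ => pow_nonneg (hd j).le _
    positivity

lemma mlS_congr {m : ℕ} (β d : Fin m → ℝ) (hβ : ∀ i, 0 < β i) (k : ℕ)
    (F G : ℝ → ℝ) (h : ∀ e, 0 ≤ e → F e = G e) : mlS β d k F = mlS β d k G := by
  refine Finset.sum_congr rfl fun κ _ => ?_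
  rw [h]
  exact Finset.sum_nonneg fun j _ => mul_nonneg (hβ j).le (by positivity)

lemma mlS_mul {m : ℕ} (β d : Fin m → ℝ) (k : ℕ) (c : ℝ)
    (F : ℝ → ℝ) : mlS β d k (fun e => c * F e) = c * mlS β d k F := by
  simp only [mlS, Finset.mul_sum]
  refine Finset.sum_congr rfl fun κ _ => by ring


lemma mlS_pow {m : ℕ} (β d : Fin m → ℝ) (k : ℕ) (x : ℝ) (hx : 0 < x) :
    mlS β d k (fun e => x ^ e) = (∑ j, d j * x ^ β j) ^ k := by
  induction k with
  | zero => simp [mlS_zero]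
  | succ k ih =>
    rw [mlS_succ, pow_succ', Finset.sum_mul]
    refine Finset.sum_congr rfl fun j _ => ?_
    simp_rw [Real.rpow_add hx]
    rw [mlS_mul, ih, mul_assoc]

/-- unsigned term -/
noncomputable def mlU {m : ℕ} (β d : Fin m → ℝ) (β₀ : ℝ) (k : ℕ) (t : ℝ) : ℝ :=
  mlS β d k (fun e => t ^ e / Real.Gamma (β₀ + e))

lemma mML_eq {m : ℕ} (β d : Fin m → ℝ) (β₀ : ℝ) (hβ : ∀ i, 0 < β i) (t : ℝ) (ht : 0 ≤ t) :
    mML β β₀ (fun j => -(d j) * t ^ (β j)) = ∑' k : ℕ, (-1) ^ k * mlU β d β₀ k t := by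
  unfold mML mlU mlS
  congr 1
  ext k
  rw [Finset.mul_sum]
  refine Finset.sum_congr rfl fun κ hκ => ?_
  rw [Finset.Nat.mem_antidiagonalTuple] at hκ
  have h1 : ∏ j, (-(d j) * t ^ (β j)) ^ κ j
      = (-1) ^ k * (∏ j, d j ^ κ j) * t ^ (∑ j, β j * (κ j : ℝ)) := by
    rw [Real.rpow_sum_of_nonneg ht (fun j _ => mul_nonneg (hβ j).le (by positivity)), ← hκ,
      ← Finset.prod_pow_eq_pow_sum, ← Finset.prod_mul_distrib, ← Finset.prod_mul_distrib]
    refine Finset.prod_congr rfl fun j _ => ?_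
    rw [Real.rpow_mul_natCast ht, neg_mul, neg_pow, mul_pow, mul_assoc]
  rw [h1]
  ring

lemma mlU_nonneg {m : ℕ} (β d : Fin m → ℝ) (β₀ : ℝ) (hβ : ∀ i, 0 < β i) (hd : ∀ i, 0 < d i)
    (hβ₀ : 0 < β₀) (k : ℕ) (t : ℝ) (ht : 0 ≤ t) : 0 ≤ mlU β d β₀ k t := by
  have := mlS_mono β d hβ hd k (fun _ => 0) (fun e => t ^ e / Real.Gamma (β₀ + e)) (by
    intro e he
    have : 0 < Real.Gamma (β₀ + e) := Real.Gamma_pos_of_pos (by linarith)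
    positivity)
  unfold mlU
  refine le_trans (le_of_eq ?_) this
  simp [mlS]

lemma mlU_bound {m : ℕ} (β d : Fin m → ℝ) (β₀ : ℝ) (hβ : ∀ i, 0 < β i) (hd : ∀ i, 0 < d i)
    (hβ₀ : 0 < β₀) (T : ℝ) (hT : 0 < T) :
    ∃ M r : ℝ, 0 ≤ r ∧ r < 1 ∧ ∀ k t, 0 ≤ t → t ≤ T → mlU β d β₀ k t ≤ M * r ^ k := by
  have hx : ∃ x : ℝ, 0 < x ∧ ∑ j, d j * x ^ β j < 1 := by
    have hc : Continuous fun x : ℝ => ∑ j, d j * x ^ β j :=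
      continuous_finsetSum _ fun j _ => continuous_const.mul
        (Real.continuous_rpow_const (hβ j).le)
    have h0 : ∑ j, d j * (0:ℝ) ^ β j < 1 := by
      rw [Finset.sum_eq_zero]
      · norm_num
      · intro j _
        rw [Real.zero_rpow (hβ j).ne', mul_zero]
    have := (hc.tendsto 0).eventually_lt_const h0
    have h2 := (this.filter_mono nhdsWithin_le_nhds : ∀ᶠ x in nhdsWithin (0:ℝ) (Ioi 0), _)
    obtain ⟨x, h3, h4⟩ := (h2.and self_mem_nhdsWithin).exists
    exact ⟨x, h4, h3⟩
  obtain ⟨x, hx, hx1⟩ := hx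
  obtain ⟨c, hc, hcb⟩ := ml_gamma_lb (T / x) (by positivity)
  refine ⟨c⁻¹ * (T / x) ^ (-β₀), ∑ j, d j * x ^ β j, ?_, hx1, fun k t ht htT => ?_⟩
  · exact Finset.sum_nonneg fun j _ => mul_nonneg (hd j).le (by positivity)
  rw [← mlS_pow β d k x hx, ← mlS_mul]
  refine mlS_mono β d hβ hd k _ _ fun e he => ?_
  have h := hcb (β₀ + e) (by linarith)
  have hp : 0 < T / x := by positivity
  calc t ^ e / Real.Gamma (β₀ + e) ≤ T ^ e / (c * (T / x) ^ (β₀ + e)) := by gcongr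
    _ = c⁻¹ * (T / x) ^ (-β₀) * x ^ e := by
      rw [Real.rpow_add hp, Real.rpow_neg hp.le, Real.div_rpow hT.le hx.le e]
      have := Real.rpow_pos_of_pos hp β₀
      field_simp

lemma mlU_cont {m : ℕ} (β d : Fin m → ℝ) (β₀ : ℝ) (hβ : ∀ i, 0 < β i) (k : ℕ) :
    Continuous (mlU β d β₀ k) := by
  unfold mlU mlS
  refine continuous_finsetSum _ fun κ _ => continuous_const.mul (Continuous.div_const ?_ _)
  exact Real.continuous_rpow_const
    (Finset.sum_nonneg fun j _ => mul_nonneg (hβ j).le (by positivity))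

lemma mlU_summable {m : ℕ} (β d : Fin m → ℝ) (β₀ : ℝ) (hβ : ∀ i, 0 < β i) (hd : ∀ i, 0 < d i)
    (hβ₀ : 0 < β₀) (t : ℝ) (ht : 0 ≤ t) : Summable (fun k => mlU β d β₀ k t) := by
  obtain ⟨M, r, hr, hr1, h⟩ := mlU_bound β d β₀ hβ hd hβ₀ (t + 1) (by linarith)
  exact Summable.of_nonneg_of_le (fun k => mlU_nonneg β d β₀ hβ hd hβ₀ k t ht)
    (fun k => h k t ht (by linarith)) ((summable_geometric_of_lt_one hr hr1).mul_left M)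

lemma mML_cont {m : ℕ} (β d : Fin m → ℝ) (β₀ : ℝ) (hβ : ∀ i, 0 < β i) (hd : ∀ i, 0 < d i)
    (hβ₀ : 0 < β₀) : ContinuousOn (fun t : ℝ => mML β β₀ (fun j => -(d j) * t ^ (β j))) (Ici 0) := by
  have key : ∀ T > 0, ContinuousOn (fun t : ℝ => mML β β₀ (fun j => -(d j) * t ^ (β j)))
      (Icc 0 T) := by
    intro T hT
    obtain ⟨M, r, hr, hr1, h⟩ := mlU_bound β d β₀ hβ hd hβ₀ T hT
    have : ContinuousOn (fun t => ∑' k : ℕ, (-1) ^ k * mlU β d β₀ k t) (Icc 0 T) := by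
      refine continuousOn_tsum (u := fun k => M * r ^ k)
        (fun k => (continuous_const.mul (mlU_cont β d β₀ hβ k)).continuousOn)
        ((summable_geometric_of_lt_one hr hr1).mul_left M) ?_
      intro k t ht
      rw [norm_mul, norm_pow, norm_neg, norm_one, one_pow, one_mul,
        Real.norm_of_nonneg (mlU_nonneg β d β₀ hβ hd hβ₀ k t ht.1)]
      exact h k t ht.1 ht.2
    exact this.congr fun t ht => mML_eq β d β₀ hβ t ht.1
  intro t ht
  have ht' : (0:ℝ) ≤ t := ht
  have h1 := key (t + 1) (by linarith) t ⟨ht, by linarith⟩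
  refine h1.mono_of_mem_nhdsWithin ?_
  rw [← Ici_inter_Iic]
  exact Filter.inter_mem self_mem_nhdsWithin (mem_nhdsWithin_of_mem_nhds (Iic_mem_nhds (by linarith)))

/-- the kernel -/
noncomputable def mlH {m : ℕ} (β d : Fin m → ℝ) (t : ℝ) : ℝ :=
  ∑ j, d j * (t ^ (β j - 1) / Real.Gamma (β j))

lemma mlphi_eq {m : ℕ} (β d : Fin m → ℝ) (β₀ : ℝ)
    (k : ℕ) (t : ℝ) (ht : 0 < t) :
    t ^ (β₀ - 1) * mlU β d β₀ k t
      = mlS β d k (fun e => t ^ (β₀ + e - 1) / Real.Gamma (β₀ + e)) := by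
  unfold mlU
  rw [← mlS_mul]
  congr 1
  ext e
  rw [← mul_div_assoc, ← Real.rpow_add ht]
  congr 2
  ring

lemma ml_conv {m : ℕ} (β d : Fin m → ℝ) (β₀ : ℝ) (hβ : ∀ i, 0 < β i)
    (hβ₀ : 0 < β₀) (k : ℕ) (t : ℝ) (ht : 0 < t) :
    IntervalIntegrable (fun s => mlH β d (t - s) * (s ^ (β₀ - 1) * mlU β d β₀ k s)) volume 0 t ∧
    ∫ s in (0:ℝ)..t, mlH β d (t - s) * (s ^ (β₀ - 1) * mlU β d β₀ k s)
      = t ^ (β₀ - 1) * mlU β d β₀ (k + 1) t := by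
  let c : (Fin m → ℕ) → ℝ := fun κ =>
    ((k.factorial : ℝ) / ∏ j, ((κ j).factorial : ℝ)) * ∏ j, d j ^ κ j
  let E : (Fin m → ℕ) → ℝ := fun κ => ∑ j, β j * (κ j : ℝ)
  have hE : ∀ κ, 0 ≤ E κ := fun κ => 
    Finset.sum_nonneg fun j _ => mul_nonneg (hβ j).le (by positivity)
  let Z : ℝ → ℝ := fun s => ∑ j, ∑ κ ∈ Finset.Nat.antidiagonalTuple m k,
    (d j * c κ) * (((t - s) ^ (β j - 1) / Real.Gamma (β j)) *
      (s ^ (β₀ + E κ - 1) / Real.Gamma (β₀ + E κ)))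
  have hZ : ∀ s ∈ uIoc 0 t, Z s = mlH β d (t - s) * (s ^ (β₀ - 1) * mlU β d β₀ k s) := by
    intro s hs
    rw [uIoc_of_le ht.le] at hs
    rw [mlphi_eq β d β₀ k s hs.1]
    unfold mlH mlS
    rw [Finset.sum_mul]
    refine Finset.sum_congr rfl fun j _ => ?_
    rw [Finset.mul_sum]
    refine Finset.sum_congr rfl fun κ _ => ?_
    simp only [c, E]
    ring
  have hI : ∀ j, ∀ κ, IntervalIntegrable (fun s =>
      (d j * c κ) * (((t - s) ^ (β j - 1) / Real.Gamma (β j)) *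
      (s ^ (β₀ + E κ - 1) / Real.Gamma (β₀ + E κ)))) volume 0 t := fun j κ =>
    (ml_beta (β j) (β₀ + E κ) t (hβ j) (by linarith [hE κ]) ht).1.const_mul _
  have hI2 : ∀ j, IntervalIntegrable (fun s => ∑ κ ∈ Finset.Nat.antidiagonalTuple m k,
      (d j * c κ) * (((t - s) ^ (β j - 1) / Real.Gamma (β j)) *
      (s ^ (β₀ + E κ - 1) / Real.Gamma (β₀ + E κ)))) volume 0 t := fun j => by
    have := IntervalIntegrable.sum (Finset.Nat.antidiagonalTuple m k) (fun κ _ => hI j κ)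
    exact this.congr fun s _ => by simp
  have hZI : IntervalIntegrable Z volume 0 t := by
    have := IntervalIntegrable.sum Finset.univ (fun j _ => hI2 j)
    exact this.congr fun s _ => by simp [Z]
  refine ⟨hZI.congr hZ, ?_⟩
  rw [← intervalIntegral.integral_congr_ae (Filter.Eventually.of_forall hZ)]
  rw [mlphi_eq β d β₀ _ t ht, mlS_succ]
  simp only [Z]
  rw [intervalIntegral.integral_finsetSum (fun j _ => hI2 j)]
  refine Finset.sum_congr rfl fun j _ => ?_
  rw [intervalIntegral.integral_finsetSum (fun κ _ => hI j κ)]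
  unfold mlS
  rw [Finset.mul_sum]
  refine Finset.sum_congr rfl fun κ _ => ?_
  rw [intervalIntegral.integral_const_mul,
    (ml_beta (β j) (β₀ + E κ) t (hβ j) (by linarith [hE κ]) ht).2]
  simp only [c, E, mul_assoc]
  rw [show β j + (β₀ + ∑ j, β j * (κ j : ℝ)) = β₀ + (β j + ∑ j, β j * (κ j : ℝ)) by ring]

lemma mlH_nonneg {m : ℕ} (β d : Fin m → ℝ) (hβ : ∀ i, 0 < β i) (hd : ∀ i, 0 < d i)
    (t : ℝ) (ht : 0 ≤ t) : 0 ≤ mlH β d t := 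
  Finset.sum_nonneg fun j _ => by
    have := hd j
    have := Real.Gamma_pos_of_pos (hβ j)
    positivity

lemma ml_volterra {m : ℕ} (β d : Fin m → ℝ) (β₀ : ℝ) (hβ : ∀ i, 0 < β i) (hd : ∀ i, 0 < d i)
    (hβ₀ : 0 < β₀) (t : ℝ) (ht : 0 < t) :
    IntervalIntegrable (fun s => mlH β d (t - s) * calE β β₀ d s) volume 0 t ∧
    calE β β₀ d t + ∫ s in (0:ℝ)..t, mlH β d (t - s) * calE β β₀ d s
      = t ^ (β₀ - 1) / Real.Gamma β₀ := by
  let P : ℕ → ℝ → ℝ := fun k s => mlH β d (t - s) * (s ^ (β₀ - 1) * mlU β d β₀ k s)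
  have hPnn : ∀ k, ∀ s ∈ Ioc 0 t, 0 ≤ P k s := fun k s hs =>
    mul_nonneg (mlH_nonneg β d hβ hd _ (by linarith [hs.2])) (mul_nonneg
      (Real.rpow_nonneg hs.1.le _) (mlU_nonneg β d β₀ hβ hd hβ₀ k s hs.1.le))
  have hPi : ∀ k, Integrable (P k) (volume.restrict (Ioc 0 t)) := fun k => by
    have := (ml_conv β d β₀ hβ hβ₀ k t ht).1
    rwa [intervalIntegrable_iff_integrableOn_Ioc_of_le ht.le] at this
  have hPint : ∀ k, ∫ s in Ioc 0 t, P k s = t ^ (β₀ - 1) * mlU β d β₀ (k + 1) t := fun k => by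
    rw [← (ml_conv β d β₀ hβ hβ₀ k t ht).2, intervalIntegral.integral_of_le ht.le]
  have hsumt := (mlU_summable β d β₀ hβ hd hβ₀ t ht.le)
  have hF : ∀ s ∈ Ioc 0 t, HasSum (fun k => (-1) ^ k * P k s) (mlH β d (t - s) * calE β β₀ d s) := by
    intro s hs
    have h1 : Summable (fun k => (-1) ^ k * mlU β d β₀ k s) := by
      refine Summable.of_norm ?_
      refine (mlU_summable β d β₀ hβ hd hβ₀ s hs.1.le).congr fun k => ?_
      rw [norm_mul, norm_pow, norm_neg, norm_one, one_pow, one_mul,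
        Real.norm_of_nonneg (mlU_nonneg β d β₀ hβ hd hβ₀ k s hs.1.le)]
    have h2 := (h1.hasSum.mul_left (s ^ (β₀ - 1))).mul_left (mlH β d (t - s))
    unfold calE
    rw [mML_eq β d β₀ hβ s hs.1.le]
    refine h2.congr_fun fun k => ?_
    simp only [P]
    ring
  have hnorm : ∀ k, ∫ s in Ioc 0 t, ‖(-1) ^ k * P k s‖ = t ^ (β₀ - 1) * mlU β d β₀ (k + 1) t := by
    intro k
    rw [← hPint]
    refine setIntegral_congr_fun measurableSet_Ioc fun s hs => ?_
    rw [norm_mul, norm_pow, norm_neg, norm_one, one_pow, one_mul, Real.norm_of_nonneg (hPnn k s hs)]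
  have hsum : Summable fun k => ∫ s in Ioc 0 t, ‖(-1) ^ k * P k s‖ := by
    simp_rw [hnorm]
    exact ((summable_nat_add_iff 1).mpr hsumt).mul_left _
  have hmain := hasSum_integral_of_summable_integral_norm (F := fun k s => (-1) ^ k * P k s)
    (μ := volume.restrict (Ioc 0 t)) (fun k => (hPi k).const_mul _) hsum
  have hcong : ∀ s ∈ Ioc 0 t, (∑' k, (-1) ^ k * P k s) = mlH β d (t - s) * calE β β₀ d s :=
    fun s hs => (hF s hs).tsum_eq
  rw [setIntegral_congr_fun measurableSet_Ioc hcong] at hmain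
  have hsgn : Summable (fun k => (-1) ^ k * mlU β d β₀ k t) := by
    refine Summable.of_norm ?_
    refine hsumt.congr fun k => ?_
    rw [norm_mul, norm_pow, norm_neg, norm_one, one_pow, one_mul,
      Real.norm_of_nonneg (mlU_nonneg β d β₀ hβ hd hβ₀ k t ht.le)]
  constructor
  · have h0 := (ml_conv β d β₀ hβ hβ₀ 0 t ht).1
    have hc : ContinuousOn (fun s : ℝ => Real.Gamma β₀ * mML β β₀ (fun j => -(d j) * s ^ (β j)))
        (uIcc 0 t) := by
      rw [uIcc_of_le ht.le]
      exact (continuousOn_const.mul (mML_cont β d β₀ hβ hd hβ₀)).mono fun s hs => hs.1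
    refine (h0.mul_continuousOn hc).congr fun s _ => ?_
    have := (Real.Gamma_pos_of_pos hβ₀).ne'
    simp only [mlU, mlS_zero, calE, add_zero, Real.rpow_zero]
    field_simp
  · rw [intervalIntegral.integral_of_le ht.le, ← hmain.tsum_eq]
    simp_rw [integral_const_mul, hPint]
    unfold calE
    rw [mML_eq β d β₀ hβ t ht.le, hsgn.tsum_eq_zero_add, mul_add, ← tsum_mul_left]
    rw [add_assoc, ← Summable.tsum_add]
    · have : ∀ k : ℕ, t ^ (β₀ - 1) * ((-1) ^ (k + 1) * mlU β d β₀ (k + 1) t)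
        + (-1) ^ k * (t ^ (β₀ - 1) * mlU β d β₀ (k + 1) t) = 0 := fun k => by ring
      simp_rw [this]
      simp [mlU, mlS_zero, div_eq_mul_inv]
    · exact ((summable_nat_add_iff 1).mpr hsgn).mul_left _
    · have := (((summable_nat_add_iff 1).mpr hsgn).mul_left (-t ^ (β₀ - 1)))
      refine this.congr fun k => by ring

lemma mlH_scale {m : ℕ} (β d : Fin m → ℝ) (β₀ : ℝ) (hβ : ∀ i, 0 < β i) (hd : ∀ i, 0 < d i)
    (hle : ∀ i, β i ≤ β₀) (hβ₀1 : β₀ < 1) (s t T : ℝ) (hs : 0 < s) (hst : s < t) (htT : t < T) :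
    mlH β d (T - s) ≤ (T / t) ^ (β₀ - 1) * mlH β d (t - s) := by
  have ht : 0 < t := hs.trans hst
  have hT : 0 < T := ht.trans htT
  unfold mlH
  rw [Finset.mul_sum]
  refine Finset.sum_le_sum fun j _ => ?_
  have hg := Real.Gamma_pos_of_pos (hβ j)
  have hdj := hd j
  have h1 : 0 < T / t * (t - s) := mul_pos (by positivity) (by linarith)
  have h2 : T / t * (t - s) ≤ T - s := by
    rw [mul_sub, div_mul_cancel₀ _ ht.ne']
    have : s ≤ T / t * s := by
      have : 1 ≤ T / t := (one_le_div ht).mpr htT.le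
      nlinarith
    linarith
  have h3 : (T - s) ^ (β j - 1) ≤ (T / t) ^ (β₀ - 1) * (t - s) ^ (β j - 1) := by
    calc (T - s) ^ (β j - 1) ≤ (T / t * (t - s)) ^ (β j - 1) :=
          Real.rpow_le_rpow_of_nonpos h1 h2 (by linarith [hle j])
      _ = (T / t) ^ (β j - 1) * (t - s) ^ (β j - 1) :=
          Real.mul_rpow (by positivity) (by linarith)
      _ ≤ _ := by
          refine mul_le_mul_of_nonneg_right ?_ (Real.rpow_nonneg (by linarith) _)
          exact Real.rpow_le_rpow_of_exponent_le ((one_le_div ht).mpr htT.le)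
            (by linarith [hle j])
  calc d j * ((T - s) ^ (β j - 1) / Real.Gamma (β j))
      ≤ d j * (((T / t) ^ (β₀ - 1) * (t - s) ^ (β j - 1)) / Real.Gamma (β j)) := by gcongr
    _ = _ := by ring

lemma mlH_int {m : ℕ} (β d : Fin m → ℝ) (hβ : ∀ i, 0 < β i) (a b : ℝ) :
    IntervalIntegrable (mlH β d) volume a b := by
  have := IntervalIntegrable.sum (μ := volume) (a := a) (b := b)
    (f := fun (j : Fin m) (t : ℝ) => d j * (t ^ (β j - 1) / Real.Gamma (β j))) Finset.univ
    (fun j _ => ((intervalIntegral.intervalIntegrable_rpow'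
      (by linarith [hβ j])).div_const _).const_mul _)
  exact this.congr fun s _ => by simp [mlH]

lemma calE_int {m : ℕ} (β d : Fin m → ℝ) (β₀ : ℝ) (hβ : ∀ i, 0 < β i) (hd : ∀ i, 0 < d i)
    (hβ₀ : 0 < β₀) (t : ℝ) (ht : 0 ≤ t) : IntervalIntegrable (calE β β₀ d) volume 0 t := by
  have hc : ContinuousOn (fun s : ℝ => mML β β₀ (fun j => -(d j) * s ^ (β j)))
      (uIcc 0 t) := by
    rw [uIcc_of_le ht]
    exact (mML_cont β d β₀ hβ hd hβ₀).mono fun s hs => hs.1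
  exact (intervalIntegral.intervalIntegrable_rpow' (r := β₀ - 1) (by linarith)).mul_continuousOn hc

lemma mML_zero_val {m : ℕ} (β d : Fin m → ℝ) (β₀ : ℝ) (hβ : ∀ i, 0 < β i) :
    mML β β₀ (fun j => -(d j) * (0:ℝ) ^ (β j)) = 1 / Real.Gamma β₀ := by
  rw [mML_eq β d β₀ hβ 0 le_rfl, tsum_eq_single 0]
  · simp [mlU, mlS_zero]
  · intro k hk
    obtain ⟨k, rfl⟩ := Nat.exists_eq_succ_of_ne_zero hk
    have : mlU β d β₀ (k + 1) 0 = 0 := by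
      unfold mlU
      rw [mlS_succ]
      refine Finset.sum_eq_zero fun j _ => ?_
      rw [mlS_congr β d hβ k _ (fun _ => 0)]
      · simp [mlS]
      · intro e he
        rw [Real.zero_rpow (by linarith [hβ j]), zero_div]
    rw [this, mul_zero]

lemma calE_pos {m : ℕ} (β d : Fin m → ℝ) (β₀ : ℝ) (hβ : ∀ i, 0 < β i) (hd : ∀ i, 0 < d i)
    (hβ₀ : 0 < β₀) (hle : ∀ i, β i ≤ β₀) (hβ₀1 : β₀ < 1) (t : ℝ) (ht : 0 < t) :
    0 < calE β β₀ d t := by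
  set f := calE β β₀ d with hf
  have hcW := mML_cont β d β₀ hβ hd hβ₀
  have hfc : ContinuousOn f (Ioi 0) := by
    refine ContinuousOn.mul ?_ (hcW.mono Ioi_subset_Ici_self)
    exact fun s hs => (Real.continuousAt_rpow_const s _ (Or.inl (ne_of_gt hs))).continuousWithinAt
  obtain ⟨δ, hδ, hδf⟩ : ∃ δ > 0, ∀ s, 0 < s → s < δ → 0 < f s := by
    have h0 := hcW 0 (by simp)
    have hg := Real.Gamma_pos_of_pos hβ₀
    have h1 : 0 < mML β β₀ (fun j => -(d j) * (0:ℝ) ^ (β j)) := by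
      rw [mML_zero_val β d β₀ hβ]; positivity
    have h2 := h0.tendsto.eventually_const_lt h1
    rw [eventually_nhdsWithin_iff, Metric.eventually_nhds_iff] at h2
    obtain ⟨δ, hδ, h⟩ := h2
    refine ⟨δ, hδ, fun s hs hsδ => ?_⟩
    refine mul_pos (Real.rpow_pos_of_pos hs _) (h ?_ hs.le)
    rw [Real.dist_eq, sub_zero, abs_of_pos hs]; exact hsδ
  by_contra hneg
  push Not at hneg
  let A : Set ℝ := Ici δ ∩ f ⁻¹' Iic 0
  have hAc : IsClosed A := (hfc.mono fun s (hs : δ ≤ s) =>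
    lt_of_lt_of_le hδ hs).preimage_isClosed_of_isClosed isClosed_Ici isClosed_Iic
  have htA : t ∈ A := by
    refine ⟨?_, hneg⟩
    by_contra h
    simp only [mem_Ici, not_le] at h
    exact absurd (hδf t ht h) (not_lt.mpr hneg)
  have hbdd : BddBelow A := ⟨δ, fun s hs => hs.1⟩
  have ht0A : sInf A ∈ A := hAc.csInf_mem ⟨t, htA⟩ hbdd
  set T := sInf A with hT
  have hT0 : 0 < T := lt_of_lt_of_le hδ ht0A.1
  have hfT : f T ≤ 0 := ht0A.2
  have hpos : ∀ s, 0 < s → s < T → 0 < f s := by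
    intro s hs hsT
    by_contra h
    push Not at h
    have : s ∉ A := notMem_of_lt_csInf hsT hbdd
    refine this ⟨?_, h⟩
    by_contra h'
    simp only [mem_Ici, not_le] at h'
    exact absurd (hδf s hs h') (not_lt.mpr h)
  obtain ⟨ε, hε, hεH⟩ : ∃ ε > 0, ∀ x, 0 ≤ x → x < ε → ∫ s in (0:ℝ)..x, mlH β d s < 1 / 2 := by
    have hc := intervalIntegral.continuous_primitive (mlH_int β d hβ) 0
    have h2 := (hc.tendsto 0).eventually_lt_const (u := 1 / 2) (by simp)
    rw [Metric.eventually_nhds_iff] at h2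
    obtain ⟨ε, hε, h⟩ := h2
    refine ⟨ε, hε, fun x hx hxε => h ?_⟩
    rw [Real.dist_eq, sub_zero, abs_of_nonneg hx]; exact hxε
  obtain ⟨τ, hτ1, hτ2, hτT⟩ : ∃ τ, T / 2 ≤ τ ∧ T - ε < τ ∧ τ < T :=
    ⟨max (T / 2) (T - ε / 2), le_max_left _ _,
      lt_of_lt_of_le (by linarith) (le_max_right _ _), max_lt (by linarith) (by linarith)⟩
  have hτ0 : 0 < τ := by linarith
  obtain ⟨r, hr, hrmax⟩ := isCompact_Icc.exists_isMaxOn (nonempty_Icc.mpr hτT.le)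
    (hfc.mono fun s (hs : s ∈ Icc τ T) => lt_of_lt_of_le hτ0 hs.1)
  have hfr : 0 < f r := lt_of_lt_of_le (hpos τ hτ0 hτT) (hrmax ⟨le_rfl, hτT.le⟩)
  have hrT : r < T := by
    rcases lt_or_eq_of_le hr.2 with h | h
    · exact h
    · rw [h] at hfr; linarith
  have hr0 : 0 < r := by linarith [hr.1]
  obtain ⟨hI1, hV1⟩ := ml_volterra β d β₀ hβ hd hβ₀ T hT0
  obtain ⟨hI2, hV2⟩ := ml_volterra β d β₀ hβ hd hβ₀ r hr0
  rw [← hf] at hI1 hV1 hI2 hV2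
  have hIa : IntervalIntegrable (fun s => mlH β d (T - s) * f s) volume 0 r :=
    hI1.mono_set (by rw [uIcc_of_le hr0.le, uIcc_of_le hT0.le]; exact Icc_subset_Icc_right hrT.le)
  have hIb : IntervalIntegrable (fun s => mlH β d (T - s) * f s) volume r T :=
    hI1.mono_set (by rw [uIcc_of_le hrT.le, uIcc_of_le hT0.le]; exact Icc_subset_Icc_left hr0.le)
  rw [← intervalIntegral.integral_add_adjacent_intervals hIa hIb] at hV1
  set ρ := (T / r) ^ (β₀ - 1) with hρ
  have hA : ∫ s in (0:ℝ)..r, mlH β d (T - s) * f s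
      ≤ ρ * ∫ s in (0:ℝ)..r, mlH β d (r - s) * f s := by
    rw [← intervalIntegral.integral_const_mul]
    refine intervalIntegral.integral_mono_on_of_le_Ioo hr0.le hIa (hI2.const_mul _) ?_
    intro s hs
    rw [← mul_assoc]
    exact mul_le_mul_of_nonneg_right
      (mlH_scale β d β₀ hβ hd hle hβ₀1 s r T hs.1 hs.2 hrT) (hpos s hs.1 (hs.2.trans hrT)).le
  have hB : ∫ s in r..T, mlH β d (T - s) * f s ≤ (∫ s in (0:ℝ)..(T - r), mlH β d s) * f r := by
    have e : ∫ s in (0:ℝ)..(T - r), mlH β d s = ∫ s in r..T, mlH β d (T - s) := by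
      rw [intervalIntegral.integral_comp_sub_left (mlH β d) T, sub_self]
    have hI : IntervalIntegrable (fun s => mlH β d (T - s)) volume r T := by
      have := (mlH_int β d hβ (T - r) 0).comp_sub_left T
      simpa using this
    rw [e, ← intervalIntegral.integral_mul_const]
    refine intervalIntegral.integral_mono_on hrT.le hIb (hI.mul_const _) ?_
    intro s hs
    exact mul_le_mul_of_nonneg_left (hrmax ⟨hr.1.trans hs.1, hs.2⟩)
      (mlH_nonneg β d hβ hd _ (by linarith [hs.2]))
  have hg : T ^ (β₀ - 1) / Real.Gamma β₀ = ρ * (r ^ (β₀ - 1) / Real.Gamma β₀) := by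
    have := Real.rpow_pos_of_pos hr0 (β₀ - 1)
    rw [hρ, Real.div_rpow hT0.le hr0.le]
    field_simp
  have hρ2 : 1 / 2 ≤ ρ := by
    have h2 : T / r ≤ 2 := by rw [div_le_iff₀ hr0]; linarith [hr.1]
    have h1 : 1 ≤ T / r := (one_le_div hr0).mpr hrT.le
    calc (1/2 : ℝ) = 2 ^ (-1 : ℝ) := by rw [Real.rpow_neg_one]; norm_num
      _ ≤ 2 ^ (β₀ - 1) := Real.rpow_le_rpow_of_exponent_le (by norm_num) (by linarith)
      _ ≤ ρ := Real.rpow_le_rpow_of_nonpos (by linarith) h2 (by linarith)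
  have hsm := hεH (T - r) (by linarith) (by linarith [hr.1])
  have h5 : (∫ s in (0:ℝ)..(T - r), mlH β d s) * f r < ρ * f r :=
    mul_lt_mul_of_pos_right (by linarith) hfr
  rw [hg, ← hV2, mul_add] at hV1
  linarith

lemma calE_integrable_s14 {m : ℕ} (β d : Fin m → ℝ) (β₀ : ℝ) (hβ : ∀ i, 0 < β i) (hd : ∀ i, 0 < d i)
    (hβ₀ : 0 < β₀) (hle : ∀ i, β i ≤ β₀) (hβ₀1 : β₀ < 1) (j₀ : Fin m) (hj : β j₀ = β₀) :
    IntegrableOn (calE β β₀ d) (Ioi 0) := by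
  refine integrableOn_Ioi_of_intervalIntegral_norm_bounded (l := Filter.atTop) (b := id)
    (1 / d j₀) 0 (fun t => ?_) Filter.tendsto_id ?_
  · rcases le_total 0 t with h | h
    · have := calE_int β d β₀ hβ hd hβ₀ t h
      rwa [intervalIntegrable_iff_integrableOn_Ioc_of_le h] at this
    · simp [h]
  filter_upwards [Filter.eventually_gt_atTop 0] with t ht
  simp only [id]
  obtain ⟨hI, hV⟩ := ml_volterra β d β₀ hβ hd hβ₀ t ht
  have hg := Real.Gamma_pos_of_pos hβ₀
  have hdj := hd j₀
  have htp := Real.rpow_pos_of_pos ht (β₀ - 1)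
  have hn : ∫ s in (0:ℝ)..t, ‖calE β β₀ d s‖ = ∫ s in (0:ℝ)..t, calE β β₀ d s := by
    refine intervalIntegral.integral_congr_ae (Filter.Eventually.of_forall fun s hs => ?_)
    rw [uIoc_of_le ht.le] at hs
    exact Real.norm_of_nonneg (calE_pos β d β₀ hβ hd hβ₀ hle hβ₀1 s hs.1).le
  rw [hn]
  have hlow : (d j₀ * (t ^ (β₀ - 1) / Real.Gamma β₀)) * ∫ s in (0:ℝ)..t, calE β β₀ d s
      ≤ ∫ s in (0:ℝ)..t, mlH β d (t - s) * calE β β₀ d s := by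
    rw [← intervalIntegral.integral_const_mul]
    refine intervalIntegral.integral_mono_on_of_le_Ioo ht.le
      ((calE_int β d β₀ hβ hd hβ₀ t ht.le).const_mul _) hI fun s hs => ?_
    refine mul_le_mul_of_nonneg_right ?_ (calE_pos β d β₀ hβ hd hβ₀ hle hβ₀1 s hs.1).le
    have hts : 0 < t - s := by linarith [hs.2]
    calc d j₀ * (t ^ (β₀ - 1) / Real.Gamma β₀)
        ≤ d j₀ * ((t - s) ^ (β₀ - 1) / Real.Gamma β₀) := by
          have := Real.rpow_le_rpow_of_nonpos hts (show t - s ≤ t by linarith [hs.1])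
            (show β₀ - 1 ≤ 0 by linarith)
          gcongr
      _ ≤ mlH β d (t - s) := by
          unfold mlH
          have := Finset.single_le_sum (s := Finset.univ)
            (f := fun j => d j * ((t - s) ^ (β j - 1) / Real.Gamma (β j)))
            (fun j _ => by
              have := hd j
              have := Real.Gamma_pos_of_pos (hβ j)
              positivity) (Finset.mem_univ j₀)
          simpa only [hj] using this
  have hp := calE_pos β d β₀ hβ hd hβ₀ hle hβ₀1 t ht
  have h6 : (d j₀ * (t ^ (β₀ - 1) / Real.Gamma β₀)) * ∫ s in (0:ℝ)..t, calE β β₀ d s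
      ≤ t ^ (β₀ - 1) / Real.Gamma β₀ := by linarith
  have hq : 0 < t ^ (β₀ - 1) / Real.Gamma β₀ := by positivity
  rw [le_div_iff₀ hdj]
  by_contra hcon
  push Not at hcon
  nlinarith

theorem stmt14 (m : ℕ) (hm : 2 ≤ m) (β : Fin m → ℝ) (β₀ : ℝ)
    (hβpos : ∀ i, 0 < β i) (hβanti : StrictAnti β)
    (hβeq : β ⟨0, by omega⟩ = β₀) (hβ₀1 : β₀ < 1)
    (d : Fin m → ℝ) (hd : ∀ i, 0 < d i)
    (θ : ℝ) (hθ : θ ∈ Icc (0:ℝ) 1)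
    (k : ℝ → ℝ) (hknn : ∀ t > (0:ℝ), 0 ≤ k t)
    (hkint : IntegrableOn k (Ioi 0))
    (C : ℝ) (hC : 0 < C) (hkbd : ∀ t > (0:ℝ), k t ≤ C * t ^ (-θ)) :
    (∀ t > (0:ℝ), 0 ≤ ∫ s in (0:ℝ)..t, calE β β₀ d (t - s) * k s) ∧
    IntegrableOn (fun t => ∫ s in (0:ℝ)..t, calE β β₀ d (t - s) * k s) (Ioi 0) := by
  have hβ₀ : 0 < β₀ := hβeq ▸ hβpos _
  have hle : ∀ i, β i ≤ β₀ := fun i => by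
    rw [← hβeq]
    exact hβanti.antitone (Fin.mk_le_of_le_val (by simp))
  have hpos := calE_pos β d β₀ hβpos hd hβ₀ hle hβ₀1
  have hint := calE_integrable_s14 β d β₀ hβpos hd hβ₀ hle hβ₀1 _ hβeq
  constructor
  · intro t ht
    rw [intervalIntegral.integral_of_le ht.le, integral_Ioc_eq_integral_Ioo]
    refine setIntegral_nonneg measurableSet_Ioo fun s hs => ?_
    exact mul_nonneg (hpos _ (by linarith [hs.2])).le (hknn s hs.1)
  · have h := integrable_posConvolution (μ := volume) (ν := volume) hkint hint (ContinuousLinearMap.mul ℝ ℝ)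
    refine h.integrableOn.congr_fun (fun t ht => ?_) measurableSet_Ioi
    rw [posConvolution, indicator_of_mem ht]
    simp [mul_comm]
end

section
/- Let m≥1, let 0<β_m<β_{m−1}<⋯<β₁<β₀≤1, and let d₁,…,d_m>0. Then lim_{t→+∞} d₁·Γ(β₀−β₁)·t^{1+β₁−β₀}·ℰ_{β̄,β₀}(t;d̄) = 1; that is, ℰ_{β̄,β₀}(t;d̄) is asymptotic to t^{β₀−β₁−1}/( d₁·Γ(β₀−β₁) ) as t→+∞. -/
open MeasureTheory Set Filter

open Complex in
/-- The kernel `exp (t e^w)`. -/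
noncomputable def Ek (t : ℝ) (w : ℂ) : ℂ := cexp (t * cexp w)

/-- Hankel-type contour integral in logarithmic coordinates. -/
noncomputable def Jk (t : ℝ) (g : ℂ → ℂ) (a : ℝ) : ℂ :=
  (∫ x in Ioi a, ((Real.exp (-(t * Real.exp x)) : ℝ) : ℂ) *
    (g (x + Real.pi * Complex.I) - g (x - Real.pi * Complex.I))) +
  Complex.I * ∫ y in (-Real.pi)..Real.pi, Ek t (a + y * Complex.I) * g (a + y * Complex.I)

lemma image_exp_univ : Real.exp '' (univ : Set ℝ) = Ioi 0 := by
  rw [Set.image_univ, Real.range_exp]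

lemma kernel_integrable_s17 {t α : ℝ} (ht : 0 < t) (hα : 0 < α) :
    Integrable (fun x : ℝ => Real.exp (-(t * Real.exp x)) * Real.exp (α * x)) := by
  have h := (integrableOn_image_iff_integrableOn_abs_deriv_smul (s := univ) (f := Real.exp)
    (f' := Real.exp) MeasurableSet.univ (fun x _ => (Real.hasDerivAt_exp x).hasDerivWithinAt)
    Real.exp_injective.injOn (fun r : ℝ => r ^ (α - 1) * Real.exp (-(t * r)))).1 (by
      rw [image_exp_univ]
      have := integrableOn_rpow_mul_exp_neg_mul_rpow (s := α - 1) (p := 1) (b := t) (by linarith) (by norm_num) ht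
      simpa using this)
  rw [integrableOn_univ] at h
  refine h.congr (Eventually.of_forall fun x => ?_)
  simp only [smul_eq_mul, abs_of_pos (Real.exp_pos x)]
  simp only [← Real.exp_mul, ← Real.exp_add]
  congr 1; ring

lemma kernel_integral {t α : ℝ} (ht : 0 < t) (hα : 0 < α) :
    ∫ x : ℝ, Real.exp (-(t * Real.exp x)) * Real.exp (α * x) = (1 / t) ^ α * Real.Gamma α := by
  rw [← Real.integral_rpow_mul_exp_neg_mul_Ioi hα ht, ← image_exp_univ,
    integral_image_eq_integral_abs_deriv_smul (s := univ) (f := Real.exp)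
    (f' := Real.exp) MeasurableSet.univ (fun x _ => (Real.hasDerivAt_exp x).hasDerivWithinAt)
    Real.exp_injective.injOn, setIntegral_univ]
  refine integral_congr_ae (Eventually.of_forall fun x => ?_)
  simp only [smul_eq_mul, abs_of_pos (Real.exp_pos x)]
  simp only [← Real.exp_mul, ← Real.exp_add]
  congr 1; ring

lemma kernel_integrableOn {t : ℝ} (ht : 0 < t) (α a : ℝ) :
    IntegrableOn (fun x : ℝ => Real.exp (-(t * Real.exp x)) * Real.exp (α * x)) (Ioi a) := by
  have h := ((kernel_integrable_s17 ht (α := |α| + 1) (by positivity)).const_mul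
    (Real.exp ((α - (|α| + 1)) * a))).integrableOn (s := Ioi a)
  refine h.mono' (by fun_prop) ?_
  refine (ae_restrict_iff' measurableSet_Ioi).2 (Eventually.of_forall fun x hx => ?_)
  have hx : a < x := hx
  rw [Real.norm_of_nonneg (by positivity)]
  simp only [← Real.exp_add]
  refine Real.exp_le_exp.2 ?_
  have := le_abs_self α
  nlinarith

lemma Ek_top (t x : ℝ) : Ek t (x + Real.pi * Complex.I) = ((Real.exp (-(t * Real.exp x)) : ℝ) : ℂ) := by
  simp [Ek, Complex.exp_add]

lemma Ek_bot (t x : ℝ) : Ek t (x - Real.pi * Complex.I) = ((Real.exp (-(t * Real.exp x)) : ℝ) : ℂ) := by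
  simp [Ek, Complex.exp_sub, Complex.exp_pi_mul_I, div_neg]

lemma Ek_differentiable (t : ℝ) : Differentiable ℂ (Ek t) := by
  unfold Ek; fun_prop

lemma Ek_norm_le {t : ℝ} (ht : 0 < t) (w : ℂ) : ‖Ek t w‖ ≤ Real.exp (t * Real.exp w.re) := by
  rw [Ek, Complex.norm_exp]
  simp only [Complex.re_ofReal_mul]
  gcongr
  exact (Complex.re_le_norm _).trans (by rw [Complex.norm_exp])

/-- differentiable on the closed strip -/
def StripReg (g : ℂ → ℂ) : Prop := ∀ w : ℂ, |w.im| ≤ Real.pi → DifferentiableAt ℂ g w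

/-- exponential bound on the half strip -/
def StripBd (g : ℂ → ℂ) (C α a : ℝ) : Prop :=
  ∀ w : ℂ, |w.im| ≤ Real.pi → a ≤ w.re → ‖g w‖ ≤ C * Real.exp (α * w.re)

lemma im_top (x : ℝ) : |((x : ℂ) + Real.pi * Complex.I).im| ≤ Real.pi := by
  simp [abs_of_pos Real.pi_pos]
lemma im_bot (x : ℝ) : |((x : ℂ) - Real.pi * Complex.I).im| ≤ Real.pi := by
  simp [abs_of_pos Real.pi_pos]

lemma StripReg.cont_top {g} (h : StripReg g) :
    Continuous (fun x : ℝ => g (x + Real.pi * Complex.I)) := by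
  rw [continuous_iff_continuousAt]
  intro x
  exact ContinuousAt.comp (f := fun x : ℝ => (x : ℂ) + Real.pi * Complex.I) (g := g)
    (h _ (im_top x)).continuousAt (by fun_prop)

lemma StripReg.cont_bot {g} (h : StripReg g) :
    Continuous (fun x : ℝ => g (x - Real.pi * Complex.I)) := by
  rw [continuous_iff_continuousAt]
  intro x
  exact ContinuousAt.comp (f := fun x : ℝ => (x : ℂ) - Real.pi * Complex.I) (g := g)
    (h _ (im_bot x)).continuousAt (by fun_prop)

lemma StripReg.cont_vert {g} (h : StripReg g) (a : ℝ) :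
    ContinuousOn (fun y : ℝ => g (a + y * Complex.I)) (uIcc (-Real.pi) Real.pi) := by
  intro y hy
  rw [uIcc_of_le (by linarith [Real.pi_pos])] at hy
  refine ContinuousAt.continuousWithinAt ?_
  exact ContinuousAt.comp (f := fun y : ℝ => (a : ℂ) + y * Complex.I) (g := g)
    (h _ (by simpa [abs_le] using hy)).continuousAt (by fun_prop)

lemma StripReg.Ek_mul {g} (h : StripReg g) (t : ℝ) : StripReg (fun w => Ek t w * g w) :=
  fun w hw => (Ek_differentiable t w).mul (h w hw)

lemma StripBd.diff {g C α a} (h : StripBd g C α a) {x : ℝ} (hx : a ≤ x) :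
    ‖g (x + Real.pi * Complex.I) - g (x - Real.pi * Complex.I)‖ ≤ 2 * C * Real.exp (α * x) := by
  have h1 := h _ (im_top x) (by simpa using hx)
  have h2 := h _ (im_bot x) (by simpa using hx)
  simp only [Complex.add_re, Complex.sub_re, Complex.ofReal_re, Complex.mul_re, Complex.I_re,
    Complex.ofReal_im, Complex.I_im, mul_zero, zero_mul, sub_zero, add_zero] at h1 h2
  refine (norm_sub_le _ _).trans ?_
  linarith

lemma horiz_norm {t : ℝ} {g C α a} (h : StripBd g C α a) {x : ℝ} (hx : a ≤ x) :
    ‖((Real.exp (-(t * Real.exp x)) : ℝ) : ℂ) *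
      (g (x + Real.pi * Complex.I) - g (x - Real.pi * Complex.I))‖ ≤
    2 * C * (Real.exp (-(t * Real.exp x)) * Real.exp (α * x)) := by
  rw [norm_mul, Complex.norm_real, Real.norm_of_nonneg (Real.exp_pos _).le]
  calc _ ≤ Real.exp (-(t * Real.exp x)) * (2 * C * Real.exp (α * x)) := by
        gcongr; exact h.diff hx
    _ = _ := by ring

lemma horiz_cont {g} (t : ℝ) (hg : StripReg g) :
    Continuous (fun x : ℝ => ((Real.exp (-(t * Real.exp x)) : ℝ) : ℂ) *
      (g (x + Real.pi * Complex.I) - g (x - Real.pi * Complex.I))) := by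
  exact (Complex.continuous_ofReal.comp (by fun_prop)).mul (hg.cont_top.sub hg.cont_bot)

lemma horiz_integrableOn {t : ℝ} (ht : 0 < t) {g C α a} (hg : StripReg g) (h : StripBd g C α a) :
    IntegrableOn (fun x : ℝ => ((Real.exp (-(t * Real.exp x)) : ℝ) : ℂ) *
      (g (x + Real.pi * Complex.I) - g (x - Real.pi * Complex.I))) (Ioi a) := by
  refine ((kernel_integrableOn ht α a).const_mul (2 * C)).mono'
    (horiz_cont t hg).aestronglyMeasurable ?_
  refine (ae_restrict_iff' measurableSet_Ioi).2 (Eventually.of_forall fun x hx => ?_)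
  exact horiz_norm h (le_of_lt hx)

lemma horiz_integrable {t : ℝ} (ht : 0 < t) {g C α} (hα : 0 < α) (hg : StripReg g)
    (h : ∀ a, StripBd g C α a) :
    Integrable (fun x : ℝ => ((Real.exp (-(t * Real.exp x)) : ℝ) : ℂ) *
      (g (x + Real.pi * Complex.I) - g (x - Real.pi * Complex.I))) := by
  refine ((kernel_integrable_s17 ht hα).const_mul (2 * C)).mono'
    (horiz_cont t hg).aestronglyMeasurable ?_
  exact Eventually.of_forall fun x => horiz_norm (h x) le_rfl

lemma Jk_indep {t : ℝ} (ht : 0 < t) {g C α a} (hg : StripReg g) (h : StripBd g C α a)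
    {b : ℝ} (hab : a ≤ b) : Jk t g a = Jk t g b := by
  have hI := horiz_integrableOn ht hg h
  have hsplit : (∫ x in a..b, ((Real.exp (-(t * Real.exp x)) : ℝ) : ℂ) *
      (g (x + Real.pi * Complex.I) - g (x - Real.pi * Complex.I))) +
      (∫ x in Ioi b, ((Real.exp (-(t * Real.exp x)) : ℝ) : ℂ) *
      (g (x + Real.pi * Complex.I) - g (x - Real.pi * Complex.I))) =
      ∫ x in Ioi a, ((Real.exp (-(t * Real.exp x)) : ℝ) : ℂ) *
      (g (x + Real.pi * Complex.I) - g (x - Real.pi * Complex.I)) := by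
    rw [intervalIntegral.integral_of_le hab, ← Ioc_union_Ioi_eq_Ioi hab,
      setIntegral_union (Set.Ioc_disjoint_Ioi le_rfl) measurableSet_Ioi
        (hI.mono_set Ioc_subset_Ioi_self) (hI.mono_set (Ioi_subset_Ioi hab))]
  have hrect := Complex.integral_boundary_rect_eq_zero_of_differentiableOn
    (fun w => Ek t w * g w) (a + (-Real.pi : ℝ) * Complex.I) (b + (Real.pi : ℝ) * Complex.I) (by
      intro w hw
      refine (hg.Ek_mul t w ?_).differentiableWithinAt
      have h2 := hw.2
      simp only [Complex.add_im, Complex.ofReal_im, Complex.mul_im, Complex.ofReal_re,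
        Complex.I_im, Complex.I_re, mul_one, mul_zero, add_zero, zero_add, Set.mem_preimage] at h2
      rw [uIcc_of_le (by linarith [Real.pi_pos])] at h2
      exact abs_le.2 h2)
  simp only [Complex.add_im, Complex.ofReal_im, Complex.mul_im, Complex.ofReal_re, Complex.add_re,
        Complex.mul_re, sub_zero, smul_eq_mul,
        Complex.I_im, Complex.I_re, mul_one, mul_zero, add_zero, zero_add] at hrect
  have e : ∀ x : ℝ, (x : ℂ) + ((-Real.pi : ℝ) : ℂ) * Complex.I = x - Real.pi * Complex.I := by
    intro x; push_cast; ring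
  simp only [e, Ek_top, Ek_bot] at hrect
  have hs2 : (∫ x in a..b, ((Real.exp (-(t * Real.exp x)) : ℝ) : ℂ) *
      (g (x + Real.pi * Complex.I) - g (x - Real.pi * Complex.I))) =
      (∫ x in a..b, ((Real.exp (-(t * Real.exp x)) : ℝ) : ℂ) * g (x + Real.pi * Complex.I)) -
      (∫ x in a..b, ((Real.exp (-(t * Real.exp x)) : ℝ) : ℂ) * g (x - Real.pi * Complex.I)) := by
    have h1 := hg.cont_top
    have h2 := hg.cont_bot
    rw [← intervalIntegral.integral_sub]
    · simp only [mul_sub]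
    · exact ((Complex.continuous_ofReal.comp (by fun_prop)).mul h1).intervalIntegrable _ _
    · exact ((Complex.continuous_ofReal.comp (by fun_prop)).mul h2).intervalIntegrable _ _
  unfold Jk
  rw [← hsplit, hs2]
  linear_combination -hrect

/-- collapsing the contour onto the negative axis -/
lemma Jk_collapse {t : ℝ} (ht : 0 < t) {g C α} (hα : 0 < α) (hg : StripReg g)
    (h : ∀ a, StripBd g C α a) (a : ℝ) :
    Jk t g a = ∫ x : ℝ, ((Real.exp (-(t * Real.exp x)) : ℝ) : ℂ) *
      (g (x + Real.pi * Complex.I) - g (x - Real.pi * Complex.I)) := by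
  have hC : 0 ≤ C := by
    have := (norm_nonneg _).trans (h 0 0 (by simp [Real.pi_pos.le]) (by simp))
    simpa using this
  have hI := horiz_integrable ht hα hg h
  have hlim1 := (aecover_Ioi (μ := volume) (l := atBot) (a := fun x : ℝ => x)
    tendsto_id).integral_tendsto_of_countably_generated hI
  have hlim2 : Tendsto (fun a : ℝ => Complex.I * ∫ y in (-Real.pi)..Real.pi,
      Ek t (a + y * Complex.I) * g (a + y * Complex.I)) atBot (nhds 0) := by
    have hb : ∀ a : ℝ, ‖Complex.I * ∫ y in (-Real.pi)..Real.pi,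
      Ek t (a + y * Complex.I) * g (a + y * Complex.I)‖ ≤
        (Real.exp (t * Real.exp a) * (C * Real.exp (α * a))) * |Real.pi - (-Real.pi)| := by
      intro a
      rw [norm_mul, Complex.norm_I, one_mul]
      refine intervalIntegral.norm_integral_le_of_norm_le_const fun y hy => ?_
      rw [uIoc_of_le (by linarith [Real.pi_pos])] at hy
      rw [norm_mul]
      have h1 := Ek_norm_le ht (a + y * Complex.I)
      have h2 := h a (a + y * Complex.I) (by simpa [abs_le] using ⟨hy.1.le, hy.2⟩) (by simp)
      simp only [Complex.add_re, Complex.ofReal_re, Complex.mul_re, Complex.I_re,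
        Complex.ofReal_im, Complex.I_im, mul_zero, zero_mul, sub_zero, add_zero] at h1 h2
      gcongr
    refine squeeze_zero_norm hb ?_
    have e1 : Tendsto (fun a : ℝ => Real.exp (t * Real.exp a)) atBot (nhds (Real.exp (t * 0))) :=
      (Real.continuous_exp.tendsto _).comp (Real.tendsto_exp_atBot.const_mul t)
    have e2 : Tendsto (fun a : ℝ => Real.exp (α * a)) atBot (nhds 0) :=
      Real.tendsto_exp_atBot.comp (tendsto_id.const_mul_atBot hα)
    have := (e1.mul (e2.const_mul C)).mul_const |Real.pi - (-Real.pi)|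
    simpa using this
  have hlim := hlim1.add hlim2
  rw [add_zero] at hlim
  refine tendsto_nhds_unique (tendsto_const_nhds.congr' ?_) hlim
  filter_upwards [eventually_le_atBot a] with b hb
  exact (Jk_indep ht hg (h b) hb).symm

lemma exp_stripReg (γ : ℝ) : StripReg (fun w => Complex.exp ((γ : ℂ) * w)) := by
  intro w _; fun_prop

lemma exp_stripBd (γ a : ℝ) : StripBd (fun w => Complex.exp ((γ : ℂ) * w)) 1 γ a := by
  intro w _ _
  simp [Complex.norm_exp]

lemma exp_diff (γ x : ℝ) : Complex.exp ((γ : ℂ) * (x + Real.pi * Complex.I)) -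
    Complex.exp ((γ : ℂ) * (x - Real.pi * Complex.I)) =
    ((Real.exp (γ * x) : ℝ) : ℂ) * (2 * Complex.I * (Real.sin (Real.pi * γ) : ℝ)) := by
  have h1 : (γ : ℂ) * (x + Real.pi * Complex.I) = γ * x + (Real.pi * γ) * Complex.I := by ring
  have h2 : (γ : ℂ) * (x - Real.pi * Complex.I) = γ * x + (-(Real.pi * γ)) * Complex.I := by ring
  rw [h1, h2, Complex.exp_add, Complex.exp_add, Complex.exp_mul_I, Complex.exp_mul_I]
  push_cast
  rw [Complex.cos_neg, Complex.sin_neg]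
  ring

lemma hankel_base {t β : ℝ} (ht : 0 < t) (h0 : 0 < β) (h1 : β < 1) (a : ℝ) :
    Jk t (fun w => Complex.exp (((1 - β : ℝ) : ℂ) * w)) a =
      2 * Real.pi * Complex.I * ((t ^ (β - 1) / Real.Gamma β : ℝ) : ℂ) := by
  rw [Jk_collapse ht (by linarith : 0 < 1 - β) (exp_stripReg _) (exp_stripBd _)]
  simp only [exp_diff]
  have : ∀ x : ℝ, ((Real.exp (-(t * Real.exp x)) : ℝ) : ℂ) *
      (((Real.exp ((1 - β) * x) : ℝ) : ℂ) *
        (2 * Complex.I * (Real.sin (Real.pi * (1 - β)) : ℝ))) =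
      ((Real.exp (-(t * Real.exp x)) * Real.exp ((1 - β) * x) : ℝ) : ℂ) *
        (2 * Complex.I * (Real.sin (Real.pi * (1 - β)) : ℝ)) := by
    intro x; push_cast; ring
  simp only [this]
  rw [integral_mul_const, integral_complex_ofReal, kernel_integral ht (by linarith)]
  have hs : Real.sin (Real.pi * (1 - β)) = Real.sin (Real.pi * β) := by
    rw [← Real.sin_pi_sub]; congr 1; ring
  have hsp : 0 < Real.sin (Real.pi * β) :=
    Real.sin_pos_of_pos_of_lt_pi (by have := Real.pi_pos; positivity) (by nlinarith [Real.pi_pos])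
  have hG := Real.Gamma_mul_Gamma_one_sub β
  have hGp := Real.Gamma_pos_of_pos h0
  have key : (1 / t) ^ (1 - β) * Real.Gamma (1 - β) * Real.sin (Real.pi * β) =
      Real.pi * (t ^ (β - 1) / Real.Gamma β) := by
    have : (1 / t) ^ (1 - β) = t ^ (β - 1) := by
      rw [one_div, Real.inv_rpow ht.le, ← Real.rpow_neg ht.le]; congr 1; ring
    rw [this]
    rw [eq_div_iff hsp.ne'] at hG
    rw [mul_div_assoc', eq_div_iff hGp.ne']
    linear_combination t ^ (β - 1) * hG
  rw [hs]
  have key' := congrArg (fun r : ℝ => (r : ℂ)) key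
  simp only [Complex.ofReal_mul] at key' ⊢
  linear_combination (2 * Complex.I) * key'

lemma hankel_one (t : ℝ) (a : ℝ) :
    Jk t (fun w => Complex.exp (((1 - 1 : ℝ) : ℂ) * w)) a = 2 * Real.pi * Complex.I := by
  have e : ∀ y : ℝ, Ek t (a + y * Complex.I) =
      (fun s => Complex.exp (t * s)) (circleMap 0 (Real.exp a) y) := by
    intro y; simp [Ek, circleMap, Complex.exp_add]
  have hc : Real.circleAverage (fun s => Complex.exp (t * s)) 0 (Real.exp a) = 1 := by
    rw [DiffContOnCl.circleAverage]
    · simp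
    · exact Differentiable.diffContOnCl (by fun_prop)
  have hper : Function.Periodic (fun y : ℝ => (fun s => Complex.exp (t * s))
      (circleMap 0 (Real.exp a) y)) (2 * Real.pi) := by
    intro y
    simp only [periodic_circleMap 0 (Real.exp a) y]
  have hp := hper.intervalIntegral_add_eq (-Real.pi) 0
  rw [show -Real.pi + 2 * Real.pi = Real.pi by ring, zero_add] at hp
  rw [Real.circleAverage_def, ← hp] at hc
  unfold Jk
  simp only [sub_self, Complex.ofReal_zero, zero_mul, Complex.exp_zero, mul_zero, mul_one, e,
    integral_zero, zero_add]
  rw [Complex.real_smul] at hc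
  have hpi : (Real.pi : ℂ) ≠ 0 := by exact_mod_cast Real.pi_ne_zero
  push_cast at hc
  field_simp at hc
  rw [hc]; ring

lemma hankel_rec {t : ℝ} (ht : 0 < t) (β a : ℝ) :
    t * Jk t (fun w => Complex.exp (((1 - β : ℝ) : ℂ) * w)) a =
      β * Jk t (fun w => Complex.exp (((1 - (β + 1) : ℝ) : ℂ) * w)) a := by
  set G : ℂ → ℂ := fun w => Ek t w * Complex.exp (((-β : ℝ) : ℂ) * w) with hG
  set g1 : ℂ → ℂ := fun w => Complex.exp (((1 - β : ℝ) : ℂ) * w) with hg1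
  set g2 : ℂ → ℂ := fun w => Complex.exp (((1 - (β + 1) : ℝ) : ℂ) * w) with hg2
  have hder : ∀ w, HasDerivAt G (Ek t w * (t * g1 w - β * g2 w)) w := by
    intro w
    have h1 : HasDerivAt (Ek t) (Ek t w * (t * Complex.exp w)) w := by
      unfold Ek
      exact ((Complex.hasDerivAt_exp w).const_mul (t : ℂ)).cexp
    have h2 : HasDerivAt (fun w : ℂ => Complex.exp (((-β : ℝ) : ℂ) * w))
        (Complex.exp (((-β : ℝ) : ℂ) * w) * (((-β : ℝ) : ℂ) * 1)) w :=
      ((hasDerivAt_id w).const_mul _).cexp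
    refine (h1.mul h2).congr_deriv ?_
    have e1 : g1 w = Complex.exp w * Complex.exp (((-β : ℝ) : ℂ) * w) := by
      simp only [hg1]; rw [← Complex.exp_add]; congr 1; push_cast; ring
    have e2 : g2 w = Complex.exp (((-β : ℝ) : ℂ) * w) := by
      rw [hg2]; simp only; congr 1; push_cast; ring
    rw [e1, e2]; push_cast; ring
  have hr1 : StripReg g1 := exp_stripReg _
  have hr2 : StripReg g2 := exp_stripReg _
  have hb1 : StripBd g1 1 _ a := exp_stripBd _ a
  have hb2 : StripBd g2 1 _ a := exp_stripBd _ a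
  have hI1 := horiz_integrableOn ht hr1 hb1
  have hI2 := horiz_integrableOn ht hr2 hb2
  have hhor : (∫ x in Ioi a, ((t : ℂ) * (((Real.exp (-(t * Real.exp x)) : ℝ) : ℂ) *
      (g1 (x + Real.pi * Complex.I) - g1 (x - Real.pi * Complex.I))) -
      (β : ℂ) * (((Real.exp (-(t * Real.exp x)) : ℝ) : ℂ) *
      (g2 (x + Real.pi * Complex.I) - g2 (x - Real.pi * Complex.I))))) =
      0 - (G (a + Real.pi * Complex.I) - G (a - Real.pi * Complex.I)) := by
    have hd : ∀ x : ℝ, HasDerivAt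
        (fun x : ℝ => G (x + Real.pi * Complex.I) - G (x - Real.pi * Complex.I))
        ((t : ℂ) * (((Real.exp (-(t * Real.exp x)) : ℝ) : ℂ) *
      (g1 (x + Real.pi * Complex.I) - g1 (x - Real.pi * Complex.I))) -
      (β : ℂ) * (((Real.exp (-(t * Real.exp x)) : ℝ) : ℂ) *
      (g2 (x + Real.pi * Complex.I) - g2 (x - Real.pi * Complex.I)))) x := by
      intro x
      have k1 : HasDerivAt (fun x : ℝ => (x : ℂ) + Real.pi * Complex.I) 1 x :=
        (Complex.ofRealCLM.hasDerivAt (x := x)).add_const _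
      have k2 : HasDerivAt (fun x : ℝ => (x : ℂ) - Real.pi * Complex.I) 1 x :=
        (Complex.ofRealCLM.hasDerivAt (x := x)).sub_const _
      have := ((hder (x + Real.pi * Complex.I)).comp x k1).sub
        ((hder (x - Real.pi * Complex.I)).comp x k2)
      refine this.congr_deriv ?_
      rw [Ek_top, Ek_bot]; ring
    refine integral_Ioi_of_hasDerivAt_of_tendsto (hd a).continuousAt.continuousWithinAt
      (fun x _ => hd x) ((hI1.const_mul _).sub (hI2.const_mul _)) ?_
    have hn : ∀ x : ℝ, ‖G (x + Real.pi * Complex.I) - G (x - Real.pi * Complex.I)‖ ≤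
        2 * (Real.exp (-(t * Real.exp x)) * Real.exp (-β * x)) := by
      intro x
      have := horiz_norm (t := t) (exp_stripBd (-β) x) le_rfl
      simp only [hG, Ek_top, Ek_bot]
      rw [← mul_sub]
      simpa using this
    refine squeeze_zero_norm hn ?_
    have : Tendsto (fun r : ℝ => 2 * (r ^ (-β) * Real.exp (-t * r))) atTop (nhds (2 * 0)) :=
      (tendsto_rpow_mul_exp_neg_mul_atTop_nhds_zero (-β) t ht).const_mul 2
    rw [mul_zero] at this
    refine (this.comp Real.tendsto_exp_atTop).congr fun x => ?_
    simp only [Function.comp, ← Real.exp_mul, ← Real.exp_add]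
    congr 2; ring
  have hver : (∫ y in (-Real.pi)..Real.pi, (((t : ℂ) * (Ek t (a + y * Complex.I) *
      g1 (a + y * Complex.I)) - β * (Ek t (a + y * Complex.I) * g2 (a + y * Complex.I))) *
      Complex.I)) =
      G (a + Real.pi * Complex.I) - G (a - Real.pi * Complex.I) := by
    have hd : ∀ y : ℝ, HasDerivAt (fun y : ℝ => G (a + y * Complex.I))
      (((t : ℂ) * (Ek t (a + y * Complex.I) *
      g1 (a + y * Complex.I)) - β * (Ek t (a + y * Complex.I) * g2 (a + y * Complex.I))) *
      Complex.I) y := by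
      intro y
      have k1 : HasDerivAt (fun y : ℝ => (a : ℂ) + y * Complex.I) (1 * Complex.I) y :=
        ((Complex.ofRealCLM.hasDerivAt (x := y)).mul_const _).const_add _
      refine ((hder (a + y * Complex.I)).comp y k1).congr_deriv ?_
      ring
    rw [intervalIntegral.integral_eq_sub_of_hasDerivAt (fun y _ => hd y)]
    · push_cast; congr 2; ring
    · refine Continuous.intervalIntegrable ?_ _ _
      simp only [hg1, hg2, Ek]; fun_prop
  have c1 : IntervalIntegrable (fun y : ℝ => Ek t (a + y * Complex.I) * g1 (a + y * Complex.I))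
      volume (-Real.pi) Real.pi := by
    refine Continuous.intervalIntegrable ?_ _ _
    simp only [hg1, Ek]; fun_prop
  have c2 : IntervalIntegrable (fun y : ℝ => Ek t (a + y * Complex.I) * g2 (a + y * Complex.I))
      volume (-Real.pi) Real.pi := by
    refine Continuous.intervalIntegrable ?_ _ _
    simp only [hg2, Ek]; fun_prop
  rw [intervalIntegral.integral_mul_const, intervalIntegral.integral_sub (c1.const_mul _)
    (c2.const_mul _), intervalIntegral.integral_const_mul, intervalIntegral.integral_const_mul]
    at hver
  rw [integral_sub (hI1.const_mul _) (hI2.const_mul _), integral_const_mul, integral_const_mul]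
    at hhor
  unfold Jk
  linear_combination hhor + hver

lemma hankel {t : ℝ} (ht : 0 < t) (a : ℝ) {β : ℝ} (hβ : 0 < β) :
    Jk t (fun w => Complex.exp (((1 - β : ℝ) : ℂ) * w)) a =
      2 * Real.pi * Complex.I * ((t ^ (β - 1) / Real.Gamma β : ℝ) : ℂ) := by
  have main : ∀ n : ℕ, ∀ β : ℝ, 0 < β → β ≤ n + 1 →
      Jk t (fun w => Complex.exp (((1 - β : ℝ) : ℂ) * w)) a =
      2 * Real.pi * Complex.I * ((t ^ (β - 1) / Real.Gamma β : ℝ) : ℂ) := by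
    intro n
    induction n with
    | zero =>
      intro β h0 h1
      rcases lt_or_eq_of_le h1 with h | h
      · exact hankel_base ht h0 (by simpa using h) a
      · have : β = 1 := by simpa using h
        subst this
        rw [hankel_one]; simp
    | succ n ih =>
      intro β h0 h1
      by_cases h : β ≤ 1
      · exact ih β h0 (h.trans (by linarith [Nat.cast_nonneg (α := ℝ) n]))
      push Not at h
      have h3 := hankel_rec ht (β - 1) a
      rw [ih (β - 1) (by linarith) (by push_cast at h1; linarith), sub_add_cancel] at h3
      have hb : ((β - 1 : ℝ) : ℂ) ≠ 0 := by
        exact_mod_cast (by linarith : β - 1 ≠ 0)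
      have hG : Real.Gamma β = (β - 1) * Real.Gamma (β - 1) := by
        rw [← Real.Gamma_add_one (by linarith), sub_add_cancel]
      have hp : t ^ (β - 1) = t * t ^ (β - 1 - 1) := by
        rw [Real.rpow_sub_one ht.ne' (β - 1)]; field_simp
      have hGp : Real.Gamma (β - 1) ≠ 0 := (Real.Gamma_pos_of_pos (by linarith)).ne'
      have e : t * (t ^ (β - 1 - 1) / Real.Gamma (β - 1)) = (β - 1) * (t ^ (β - 1) / Real.Gamma β) := by
        rw [hG, hp]
        have : β - 1 ≠ 0 := by linarith
        field_simp
      have e' := congrArg (fun r : ℝ => (r : ℂ)) e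
      rw [Complex.ofReal_mul, Complex.ofReal_mul] at e'
      apply mul_left_cancel₀ hb
      rw [← h3]
      linear_combination (2 * Real.pi * Complex.I) * e'
  obtain ⟨n, hn⟩ := exists_nat_ge β
  exact main n β hβ (by linarith)

lemma Jk_hasSum {t : ℝ} (ht : 0 < t) {F : ℕ → ℂ → ℂ} {G : ℂ → ℂ} {ρ α a : ℝ}
    (h0 : 0 ≤ ρ) (h1 : ρ < 1) (hr : ∀ k, StripReg (F k)) (hb : ∀ k, StripBd (F k) (ρ ^ k) α a)
    (hs : ∀ w : ℂ, |w.im| ≤ Real.pi → a ≤ w.re → HasSum (fun k => F k w) (G w)) :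
    HasSum (fun k => Jk t (F k) a) (Jk t G a) := by
  have hgs : Summable (fun k : ℕ => ρ ^ k) := summable_geometric_of_lt_one h0 h1
  unfold Jk
  refine HasSum.add ?_ (HasSum.mul_left _ ?_)
  · refine hasSum_integral_of_dominated_convergence
      (fun k x => ρ ^ k * (2 * (Real.exp (-(t * Real.exp x)) * Real.exp (α * x))))
      (fun k => (horiz_cont t (hr k)).aestronglyMeasurable) ?_ ?_ ?_ ?_
    · intro k
      refine (ae_restrict_iff' measurableSet_Ioi).2 (Eventually.of_forall fun x hx => ?_)
      refine (horiz_norm (hb k) (le_of_lt hx)).trans (le_of_eq ?_)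
      ring
    · exact Eventually.of_forall fun x => hgs.mul_right _
    · simp only [tsum_mul_right]
      exact ((kernel_integrableOn ht α a).const_mul 2).const_mul _
    · refine (ae_restrict_iff' measurableSet_Ioi).2 (Eventually.of_forall fun x hx => ?_)
      have hx : a < x := hx
      exact ((hs _ (im_top x) (by simpa using hx.le)).sub
        (hs _ (im_bot x) (by simpa using hx.le))).mul_left _
  · have hle : -Real.pi ≤ Real.pi := by linarith [Real.pi_pos]
    refine intervalIntegral.hasSum_integral_of_dominated_convergence
      (fun k _ => ρ ^ k * (Real.exp (t * Real.exp a) * Real.exp (α * a))) ?_ ?_ ?_ ?_ ?_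
    · intro k
      refine (ContinuousOn.mono (((hr k).Ek_mul t).cont_vert a)
        uIoc_subset_uIcc).aestronglyMeasurable measurableSet_uIoc
    · intro k
      refine Eventually.of_forall fun y hy => ?_
      rw [uIoc_of_le hle] at hy
      rw [norm_mul]
      have e1 := Ek_norm_le ht (a + y * Complex.I)
      have e2 := hb k (a + y * Complex.I) (by simpa [abs_le] using ⟨hy.1.le, hy.2⟩) (by simp)
      simp only [Complex.add_re, Complex.ofReal_re, Complex.mul_re, Complex.I_re,
        Complex.ofReal_im, Complex.I_im, mul_zero, zero_mul, sub_zero, add_zero] at e1 e2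
      calc _ ≤ Real.exp (t * Real.exp a) * (ρ ^ k * Real.exp (α * a)) := by gcongr
        _ = _ := by ring
    · exact Eventually.of_forall fun x _ => hgs.mul_right _
    · exact intervalIntegrable_const
    · refine Eventually.of_forall fun y hy => ?_
      rw [uIoc_of_le hle] at hy
      exact (hs _ (by simpa [abs_le] using ⟨hy.1.le, hy.2⟩) (by simp)).mul_left _

lemma Jk_exp_sum {t : ℝ} (ht : 0 < t) {ι : Type*} (s : Finset ι) (c : ι → ℂ) (γ : ι → ℝ) (a : ℝ) :
    Jk t (fun w => ∑ i ∈ s, c i * Complex.exp ((γ i : ℂ) * w)) a =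
      ∑ i ∈ s, c i * Jk t (fun w => Complex.exp ((γ i : ℂ) * w)) a := by
  unfold Jk
  conv_rhs => enter [2, i]; rw [mul_add]
  rw [Finset.sum_add_distrib]
  congr 1
  · simp only [← integral_const_mul]
    rw [← integral_finsetSum]
    · refine integral_congr_ae (Eventually.of_forall fun x => ?_)
      simp only
      rw [← Finset.sum_sub_distrib, Finset.mul_sum]
      refine Finset.sum_congr rfl fun i _ => ?_
      ring
    · intro i _
      exact (horiz_integrableOn ht (exp_stripReg (γ i)) (exp_stripBd (γ i) a)).const_mul _
  · have : ∀ i ∈ s, c i * (Complex.I * ∫ y in (-Real.pi)..Real.pi, Ek t (a + y * Complex.I) *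
        Complex.exp ((γ i : ℂ) * (a + y * Complex.I))) =
        Complex.I * ∫ y in (-Real.pi)..Real.pi, c i * (Ek t (a + y * Complex.I) *
        Complex.exp ((γ i : ℂ) * (a + y * Complex.I))) := by
      intro i _
      rw [intervalIntegral.integral_const_mul]; ring
    rw [Finset.sum_congr rfl this, ← Finset.mul_sum, ← intervalIntegral.integral_finset_sum]
    · congr 2
      ext y
      rw [Finset.mul_sum]
      refine Finset.sum_congr rfl fun i _ => ?_
      ring
    · intro i _
      refine Continuous.intervalIntegrable ?_ _ _
      unfold Ek; fun_prop

/-- `∑ d_j e^{-β_j w}` -/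
noncomputable def qf {m : ℕ} (β d : Fin m → ℝ) (w : ℂ) : ℂ :=
  ∑ j, (d j : ℂ) * Complex.exp (((-β j : ℝ) : ℂ) * w)

/-- `e^{b w} + ∑ d_j e^{(b-β_j) w}` -/
noncomputable def Df {m : ℕ} (b : ℝ) (β d : Fin m → ℝ) (w : ℂ) : ℂ :=
  Complex.exp ((b : ℂ) * w) + ∑ j, (d j : ℂ) * Complex.exp (((b - β j : ℝ) : ℂ) * w)

/-- the transformed symbol -/
noncomputable def Pf {m : ℕ} (b β₀ : ℝ) (β d : Fin m → ℝ) (w : ℂ) : ℂ :=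
  Complex.exp (((1 - β₀ + b : ℝ) : ℂ) * w) / Df b β d w

lemma Df_eq {m : ℕ} (b : ℝ) (β d : Fin m → ℝ) (w : ℂ) :
    Df b β d w = Complex.exp ((b : ℂ) * w) * (1 + qf β d w) := by
  unfold Df qf
  rw [mul_add, mul_one, Finset.mul_sum]
  congr 1
  refine Finset.sum_congr rfl fun j _ => ?_
  rw [mul_left_comm, ← Complex.exp_add]
  congr 2; push_cast; ring

lemma Df_lower {m : ℕ} {b : ℝ} {β d : Fin m → ℝ} (z : Fin m) (hz : β z = b) (hb1 : b < 1)
    (hpos : ∀ j, 0 < β j) (hle : ∀ j, β j ≤ b) (hd : ∀ j, 0 < d j) (w : ℂ)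
    (hw : |w.im| ≤ Real.pi) : Real.cos (b * Real.pi / 2) * d z ≤ ‖Df b β d w‖ := by
  have hpi := Real.pi_pos
  have hb0 : 0 < b := hz ▸ hpos z
  have hcos : 0 ≤ Real.cos (b * Real.pi / 2) :=
    Real.cos_nonneg_of_neg_pi_div_two_le_of_le (by nlinarith) (by nlinarith)
  set u : ℂ := Complex.exp (((-(b * w.im / 2) : ℝ) : ℂ) * Complex.I) with hu
  have hun : ‖u‖ = 1 := Complex.norm_exp_ofReal_mul_I _
  have hterm : ∀ c : ℝ, 0 ≤ c → c ≤ b → Real.cos (b * Real.pi / 2) * Real.exp (c * w.re) ≤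
      (Complex.exp ((c : ℂ) * w) * u).re := by
    intro c hc0 hcb
    rw [hu, ← Complex.exp_add, Complex.exp_re]
    have e1 : ((c : ℂ) * w + ((-(b * w.im / 2) : ℝ) : ℂ) * Complex.I).re = c * w.re := by
      simp
    have e2 : ((c : ℂ) * w + ((-(b * w.im / 2) : ℝ) : ℂ) * Complex.I).im =
        (c - b / 2) * w.im := by
      simp; ring
    rw [e1, e2, mul_comm]
    refine mul_le_mul_of_nonneg_left ?_ (Real.exp_pos _).le
    rw [← Real.cos_abs ((c - b / 2) * w.im)]
    refine Real.cos_le_cos_of_nonneg_of_le_pi (abs_nonneg _) (by nlinarith) ?_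
    rw [abs_mul]
    have : |c - b / 2| ≤ b / 2 := abs_le.2 ⟨by linarith, by linarith⟩
    calc |c - b / 2| * |w.im| ≤ b / 2 * Real.pi := by gcongr
      _ = _ := by ring
  calc Real.cos (b * Real.pi / 2) * d z ≤ (Df b β d w * u).re := by
        have e : (Df b β d w * u).re = (Complex.exp ((b : ℂ) * w) * u).re +
            ∑ j, d j * (Complex.exp (((b - β j : ℝ) : ℂ) * w) * u).re := by
          unfold Df
          rw [add_mul, Complex.add_re, Finset.sum_mul, Complex.re_sum]
          congr 1
          refine Finset.sum_congr rfl fun j _ => ?_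
          rw [mul_assoc, Complex.re_ofReal_mul]
        rw [e]
        have t1 : 0 ≤ (Complex.exp ((b : ℂ) * w) * u).re :=
          le_trans (by positivity) (hterm b hb0.le le_rfl)
        have t2 : ∀ j, 0 ≤ d j * (Complex.exp (((b - β j : ℝ) : ℂ) * w) * u).re := fun j =>
          mul_nonneg (hd j).le (le_trans (by positivity)
            (hterm (b - β j) (by linarith [hle j]) (by linarith [hpos j])))
        have t3 := Finset.single_le_sum (fun j _ => t2 j) (Finset.mem_univ z)
        have t4 := hterm (b - β z) (by linarith [hle z]) (by linarith [hpos z])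
        have t5 : Real.exp ((b - β z) * w.re) = 1 := by rw [hz]; simp
        rw [t5, mul_one] at t4
        have t6 := mul_le_mul_of_nonneg_left t4 (hd z).le
        linarith
    _ ≤ ‖Df b β d w * u‖ := Complex.re_le_norm _
    _ = ‖Df b β d w‖ := by rw [norm_mul, hun, mul_one]

lemma Df_lim {m : ℕ} {b : ℝ} {β d : Fin m → ℝ} (z : Fin m) (hb : 0 < b) (hz : β z = b)
    (hlt : ∀ j, j ≠ z → β j < b) (s : ℝ → ℂ) (hs : Tendsto (fun τ => (s τ).re) atTop atBot) :
    Tendsto (fun τ => Df b β d (s τ)) atTop (nhds (d z : ℂ)) := by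
  have hexp : ∀ c : ℝ, 0 < c → Tendsto (fun τ => Complex.exp ((c : ℂ) * s τ)) atTop (nhds 0) := by
    intro c hc
    rw [tendsto_zero_iff_norm_tendsto_zero]
    simp only [Complex.norm_exp, Complex.re_ofReal_mul]
    exact Real.tendsto_exp_atBot.comp (hs.const_mul_atBot hc)
  unfold Df
  have h2 : Tendsto (fun τ => ∑ j, (d j : ℂ) * Complex.exp (((b - β j : ℝ) : ℂ) * s τ)) atTop
      (nhds (∑ j, if j = z then (d z : ℂ) else 0)) := by
    refine tendsto_finsetSum _ fun j _ => ?_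
    split_ifs with h
    · subst h
      simp [hz]
    · simpa using (hexp (b - β j) (by linarith [hlt j h])).const_mul (d j : ℂ)
  simpa using (hexp b hb).add h2

lemma qf_pow {m : ℕ} (β d : Fin m → ℝ) (β₀ : ℝ) (k : ℕ) (w : ℂ) :
    (-qf β d w) ^ k * Complex.exp (((1 - β₀ : ℝ) : ℂ) * w) =
    ∑ κ ∈ Finset.Nat.antidiagonalTuple m k,
      ((((k.factorial : ℝ) / ∏ j, ((κ j).factorial : ℝ)) * ∏ j, (-d j) ^ κ j : ℝ) : ℂ) *
      Complex.exp (((1 - (β₀ + ∑ j, β j * (κ j : ℝ)) : ℝ) : ℂ) * w) := by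
  have : -qf β d w = ∑ j, (-(d j : ℂ)) * Complex.exp (((-β j : ℝ) : ℂ) * w) := by
    simp [qf]
  rw [this, Finset.sum_pow_eq_sum_piAntidiag, Finset.piAntidiag_univ_fin_eq_antidiagonalTuple,
    Finset.sum_mul]
  refine Finset.sum_congr rfl fun κ hκ => ?_
  have hk : ∑ j, κ j = k := Finset.Nat.mem_antidiagonalTuple.1 hκ
  have hm := Nat.multinomial_spec Finset.univ κ
  rw [hk] at hm
  have hm' : (k.factorial : ℝ) / ∏ j, ((κ j).factorial : ℝ) = (Nat.multinomial Finset.univ κ : ℝ) := by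
    rw [div_eq_iff (Finset.prod_ne_zero_iff.2 fun j _ => by positivity), ← hm]
    push_cast; ring
  rw [hm']
  simp only [mul_pow, Finset.prod_mul_distrib, ← Complex.exp_nat_mul]
  rw [← Complex.exp_sum]
  push_cast
  rw [mul_assoc, mul_assoc, mul_assoc, ← Complex.exp_add]
  congr 4
  rw [sub_mul, sub_mul, add_mul, Finset.sum_mul]
  have : ∀ j, (κ j : ℂ) * (-(β j : ℂ) * w) = - ((β j : ℂ) * (κ j : ℂ) * w) := fun j => by ring
  simp only [this, Finset.sum_neg_distrib]
  ring

lemma calE_rep {m : ℕ} {b β₀ : ℝ} {β d : Fin m → ℝ} (z : Fin m) (hz : β z = b) (hb1 : b < 1)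
    (hpos : ∀ j, 0 < β j) (hle : ∀ j, β j ≤ b) (hd : ∀ j, 0 < d j) (hβ₀ : 0 < β₀)
    {t : ℝ} (ht : 0 < t) :
    ∃ a, Jk t (Pf b β₀ β d) a = 2 * Real.pi * Complex.I * (calE β β₀ d t : ℝ) := by
  have hlim : Tendsto (fun a : ℝ => ∑ j, d j * Real.exp (-β j * a)) atTop (nhds 0) := by
    have : Tendsto (fun a : ℝ => ∑ j, d j * Real.exp (-β j * a)) atTop (nhds (∑ j, d j * 0)) := by
      refine tendsto_finsetSum _ fun j _ => Tendsto.const_mul _ ?_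
      exact Real.tendsto_exp_atBot.comp
        (tendsto_id.const_mul_atTop_of_neg (by linarith [hpos j]))
    simpa using this
  obtain ⟨a, ha⟩ := (hlim.eventually (ge_mem_nhds (by norm_num : (0 : ℝ) < 1 / 2))).exists
  have hq : ∀ w : ℂ, a ≤ w.re → ‖qf β d w‖ ≤ 1 / 2 := by
    intro w hw
    refine le_trans ?_ ha
    refine (norm_sum_le _ _).trans (Finset.sum_le_sum fun j _ => ?_)
    rw [norm_mul, Complex.norm_real, Real.norm_of_nonneg (hd j).le, Complex.norm_exp,
      Complex.re_ofReal_mul]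
    have := hd j
    have := hpos j
    gcongr ?_ * Real.exp ?_
    nlinarith
  refine ⟨a, ?_⟩
  have hS := Jk_hasSum ht
    (F := fun k w => (-qf β d w) ^ k * Complex.exp (((1 - β₀ : ℝ) : ℂ) * w))
    (G := Pf b β₀ β d) (ρ := 1 / 2) (α := 1 - β₀) (a := a) (by norm_num) (by norm_num)
    (fun k w _ => by unfold qf; fun_prop)
    (fun k w _ hw => by
      simp only [norm_mul, norm_pow, norm_neg, Complex.norm_exp, Complex.re_ofReal_mul]
      gcongr
      exact hq w hw)
    (fun w _ hw => by
      have hn : ‖-qf β d w‖ < 1 := by rw [norm_neg]; linarith [hq w hw]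
      have := (hasSum_geometric_of_norm_lt_one hn).mul_right
        (Complex.exp (((1 - β₀ : ℝ) : ℂ) * w))
      suffices hP : Pf b β₀ β d w = (1 - -qf β d w)⁻¹ *
          Complex.exp (((1 - β₀ : ℝ) : ℂ) * w) by rw [hP]; exact this
      unfold Pf
      rw [Df_eq, sub_neg_eq_add]
      have e : Complex.exp (((1 - β₀ + b : ℝ) : ℂ) * w) =
          Complex.exp ((b : ℂ) * w) * Complex.exp (((1 - β₀ : ℝ) : ℂ) * w) := by
        rw [← Complex.exp_add]; congr 1; push_cast; ring
      rw [e, mul_div_mul_left _ _ (Complex.exp_ne_zero _), div_eq_mul_inv, mul_comm])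
  have hk : ∀ k : ℕ, Jk t (fun w => (-qf β d w) ^ k * Complex.exp (((1 - β₀ : ℝ) : ℂ) * w)) a =
      2 * Real.pi * Complex.I * ((t ^ (β₀ - 1) * (∑ κ ∈ Finset.Nat.antidiagonalTuple m k,
    ((k.factorial : ℝ) / ∏ j, ((κ j).factorial : ℝ)) *
      (∏ j, (-(d j) * t ^ (β j)) ^ κ j) / Real.Gamma (β₀ + ∑ j, β j * (κ j : ℝ))) : ℝ) : ℂ) := by
    intro k
    simp only [qf_pow]
    rw [Jk_exp_sum ht, Finset.mul_sum, Complex.ofReal_sum, Finset.mul_sum]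
    refine Finset.sum_congr rfl fun κ _ => ?_
    have hp : 0 < β₀ + ∑ j, β j * (κ j : ℝ) :=
      add_pos_of_pos_of_nonneg hβ₀ (Finset.sum_nonneg fun j _ =>
        mul_nonneg (hpos j).le (Nat.cast_nonneg _))
    rw [hankel ht a hp, mul_left_comm, ← Complex.ofReal_mul]
    congr 2
    have e1 : t ^ (β₀ + ∑ j, β j * (κ j : ℝ) - 1) =
        t ^ (β₀ - 1) * ∏ j, (t ^ (β j)) ^ κ j := by
      rw [show β₀ + ∑ j, β j * (κ j : ℝ) - 1 = (β₀ - 1) + ∑ j, β j * (κ j : ℝ) by ring,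
        Real.rpow_add ht, Real.rpow_sum_of_pos ht]
      congr 1
      refine Finset.prod_congr rfl fun j _ => ?_
      rw [Real.rpow_mul ht.le, Real.rpow_natCast]
    rw [e1]
    simp only [mul_pow, Finset.prod_mul_distrib]
    ring
  simp only [hk] at hS
  rw [← hS.tsum_eq, tsum_mul_left, ← Complex.ofReal_tsum, tsum_mul_left]
  rfl

theorem stmt17 (m : ℕ) (hm : 0 < m) (β : Fin m → ℝ) (β₀ : ℝ)
    (hβpos : ∀ i, 0 < β i) (hβanti : StrictAnti β)
    (hβlt : β ⟨0, hm⟩ < β₀) (hβ₀1 : β₀ ≤ 1)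
    (d : Fin m → ℝ) (hd : ∀ i, 0 < d i) :
    Tendsto
      (fun t : ℝ =>
        d ⟨0, hm⟩ * Real.Gamma (β₀ - β ⟨0, hm⟩) * t ^ (1 + β ⟨0, hm⟩ - β₀)
          * calE β β₀ d t)
      atTop (nhds 1) := by
  
  set z : Fin m := ⟨0, hm⟩ with hzdef
  set b : ℝ := β z with hb
  have hb0 : 0 < b := hβpos z
  have hb1 : b < 1 := by linarith
  have hlt : ∀ j, j ≠ z → β j < b := fun j hj => hβanti (by
    refine lt_of_le_of_ne ?_ hj.symm
    exact Fin.mk_le_of_le_val (Nat.zero_le _))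
  have hle : ∀ j, β j ≤ b := fun j => by
    by_cases h : j = z
    · rw [h]
    · exact (hlt j h).le
  have hdz : (d z : ℂ) ≠ 0 := by exact_mod_cast (hd z).ne'
  set c : ℝ := 1 - β₀ + b with hc
  have hc0 : 0 < c := by linarith
  have hpi := Real.pi_pos
  set δ : ℝ := Real.cos (b * Real.pi / 2) * d z with hδ
  have hδ0 : 0 < δ := mul_pos
    (Real.cos_pos_of_mem_Ioo ⟨by nlinarith, by nlinarith⟩) (hd z)
  have hlow : ∀ w : ℂ, |w.im| ≤ Real.pi → δ ≤ ‖Df b β d w‖ := fun w hw =>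
    Df_lower z rfl hb1 hβpos hle hd w hw
  have hD0 : ∀ w : ℂ, |w.im| ≤ Real.pi → Df b β d w ≠ 0 := fun w hw =>
    norm_pos_iff.1 (lt_of_lt_of_le hδ0 (hlow w hw))
  have hreg : StripReg (Pf b β₀ β d) := by
    intro w hw
    unfold Pf
    refine DifferentiableAt.div (by fun_prop) ?_ (hD0 w hw)
    unfold Df; fun_prop
  have hbd : ∀ a, StripBd (Pf b β₀ β d) δ⁻¹ c a := by
    intro a w hw _
    unfold Pf
    rw [norm_div, Complex.norm_exp, Complex.re_ofReal_mul, div_eq_inv_mul]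
    have := hlow w hw
    gcongr
  have hrep : ∀ t : ℝ, 0 < t → (∫ x : ℝ, ((Real.exp (-(t * Real.exp x)) : ℝ) : ℂ) *
      (Pf b β₀ β d (x + Real.pi * Complex.I) - Pf b β₀ β d (x - Real.pi * Complex.I))) =
      2 * Real.pi * Complex.I * (calE β β₀ d t : ℝ) := by
    intro t ht
    obtain ⟨a, ha⟩ := calE_rep z (show β z = b from rfl) hb1 hβpos hle hd (by linarith : 0 < β₀) ht
    rw [← ha, Jk_collapse ht hc0 hreg hbd]
  have hre : ∀ x τ : ℝ, ((Real.exp (τ * c) : ℝ) : ℂ) *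
      (Pf b β₀ β d (((x - τ : ℝ) : ℂ) + Real.pi * Complex.I) -
        Pf b β₀ β d (((x - τ : ℝ) : ℂ) - Real.pi * Complex.I)) =
      Complex.exp ((c : ℂ) * (x + Real.pi * Complex.I)) /
        Df b β d (((x - τ : ℝ) : ℂ) + Real.pi * Complex.I) -
      Complex.exp ((c : ℂ) * (x - Real.pi * Complex.I)) /
        Df b β d (((x - τ : ℝ) : ℂ) - Real.pi * Complex.I) := by
    intro x τ
    unfold Pf
    rw [mul_sub, ← mul_div_assoc, ← mul_div_assoc, Complex.ofReal_exp, ← Complex.exp_add,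
      ← Complex.exp_add]
    congr 3
    · rw [hc]; push_cast; ring
    · rw [hc]; push_cast; ring
  have hlimI : Tendsto (fun τ : ℝ => ∫ x : ℝ, ((Real.exp (-(Real.exp x)) : ℝ) : ℂ) *
      (((Real.exp (τ * c) : ℝ) : ℂ) *
      (Pf b β₀ β d (((x - τ : ℝ) : ℂ) + Real.pi * Complex.I) -
        Pf b β₀ β d (((x - τ : ℝ) : ℂ) - Real.pi * Complex.I)))) atTop
      (nhds (∫ x : ℝ, ((Real.exp (-(Real.exp x)) : ℝ) : ℂ) *
        ((Complex.exp ((c : ℂ) * (x + Real.pi * Complex.I)) / (d z : ℂ) -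
      Complex.exp ((c : ℂ) * (x - Real.pi * Complex.I)) / (d z : ℂ))))) := by
    have hK := kernel_integrable_s17 (t := 1) one_pos hc0
    simp only [one_mul] at hK
    refine tendsto_integral_filter_of_dominated_convergence
      (fun x => 2 * δ⁻¹ * (Real.exp (-(Real.exp x)) * Real.exp (c * x))) ?_ ?_
      (hK.const_mul _) ?_
    · refine Eventually.of_forall fun τ => Continuous.aestronglyMeasurable ?_
      have h1 : Continuous fun x : ℝ => x - τ := by fun_prop
      exact (Complex.continuous_ofReal.comp (by fun_prop)).mul (continuous_const.mul
        ((hreg.cont_top.comp h1).sub (hreg.cont_bot.comp h1)))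
    · refine Eventually.of_forall fun τ => Eventually.of_forall fun x => ?_
      rw [norm_mul, norm_mul, Complex.norm_real, Complex.norm_real,
        Real.norm_of_nonneg (Real.exp_pos _).le, Real.norm_of_nonneg (Real.exp_pos _).le]
      have h1 := (hbd (x - τ)).diff (le_refl (x - τ))
      calc _ ≤ Real.exp (-(Real.exp x)) * (Real.exp (τ * c) *
            (2 * δ⁻¹ * Real.exp (c * (x - τ)))) := by gcongr
        _ = 2 * δ⁻¹ * (Real.exp (-(Real.exp x)) * (Real.exp (τ * c) * Real.exp (c * (x - τ)))) := by
            ring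
        _ = _ := by
            rw [← Real.exp_add (τ * c)]; congr 4; ring
    · refine Eventually.of_forall fun x => Tendsto.const_mul _ ?_
      simp only [hre]
      have hxt : Tendsto (fun τ : ℝ => x - τ) atTop atBot :=
        tendsto_atBot_add_const_left _ x tendsto_neg_atTop_atBot
      refine Tendsto.sub ?_ ?_
      · refine tendsto_const_nhds.div (Df_lim z hb0 rfl hlt _ ?_) hdz
        simpa using hxt
      · refine tendsto_const_nhds.div (Df_lim z hb0 rfl hlt _ ?_) hdz
        simpa using hxt
  have hval : (∫ x : ℝ, ((Real.exp (-(Real.exp x)) : ℝ) : ℂ) *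
        ((Complex.exp ((c : ℂ) * (x + Real.pi * Complex.I)) / (d z : ℂ) -
      Complex.exp ((c : ℂ) * (x - Real.pi * Complex.I)) / (d z : ℂ)))) =
      ((Real.Gamma c : ℝ) : ℂ) * ((2 * Complex.I * (Real.sin (Real.pi * c) : ℝ)) / (d z : ℂ)) := by
    have h1 : ∀ x : ℝ, ((Real.exp (-(Real.exp x)) : ℝ) : ℂ) *
        ((Complex.exp ((c : ℂ) * (x + Real.pi * Complex.I)) / (d z : ℂ) -
      Complex.exp ((c : ℂ) * (x - Real.pi * Complex.I)) / (d z : ℂ))) =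
      ((Real.exp (-(1 * Real.exp x)) * Real.exp (c * x) : ℝ) : ℂ) *
      ((2 * Complex.I * (Real.sin (Real.pi * c) : ℝ)) / (d z : ℂ)) := by
      intro x
      rw [← sub_div, exp_diff, one_mul, Complex.ofReal_mul]; ring
    simp only [h1]
    rw [integral_mul_const, integral_complex_ofReal, kernel_integral one_pos hc0]
    simp
  have hshift : ∀ τ : ℝ, (∫ x : ℝ, ((Real.exp (-(Real.exp x)) : ℝ) : ℂ) *
      (((Real.exp (τ * c) : ℝ) : ℂ) *
      (Pf b β₀ β d (((x - τ : ℝ) : ℂ) + Real.pi * Complex.I) -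
        Pf b β₀ β d (((x - τ : ℝ) : ℂ) - Real.pi * Complex.I)))) =
      2 * Real.pi * Complex.I * (((Real.exp τ) ^ c * calE β β₀ d (Real.exp τ) : ℝ) : ℂ) := by
    intro τ
    have h1 := hrep (Real.exp τ) (Real.exp_pos τ)
    rw [← integral_sub_right_eq_self _ τ] at h1
    rw [← Real.exp_mul, Complex.ofReal_mul, mul_left_comm, ← h1, ← integral_const_mul]
    refine integral_congr_ae (Eventually.of_forall fun x => ?_)
    have : Real.exp τ * Real.exp (x - τ) = Real.exp x := by
      rw [← Real.exp_add]; congr 1; ring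
    simp only [this]
    ring
  simp only [hshift, hval] at hlimI
  have hsin : 0 < Real.sin (Real.pi * c) := Real.sin_pos_of_pos_of_lt_pi (by positivity) (by
    nlinarith)
  have hG := Real.Gamma_mul_Gamma_one_sub c
  have hcb : 1 - c = β₀ - b := by rw [hc]; ring
  rw [hcb, eq_div_iff hsin.ne'] at hG
  have hfin := hlimI.const_mul
    ((d z : ℂ) * ((Real.Gamma (β₀ - b) : ℝ) : ℂ) / (2 * Real.pi * Complex.I))
  have hpiC : (Real.pi : ℂ) ≠ 0 := by exact_mod_cast hpi.ne'
  have hGC := congrArg (fun r : ℝ => (r : ℂ)) hG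
  simp only [Complex.ofReal_mul] at hGC
  have e1 : ((d z : ℂ) * ((Real.Gamma (β₀ - b) : ℝ) : ℂ) / (2 * Real.pi * Complex.I)) *
      (((Real.Gamma c : ℝ) : ℂ) * ((2 * Complex.I * (Real.sin (Real.pi * c) : ℝ)) / (d z : ℂ))) =
      ((1 : ℝ) : ℂ) := by
    have hI := Complex.I_ne_zero
    rw [div_mul_eq_mul_div, div_eq_iff (by simp [hpiC]), mul_div_assoc', mul_div_assoc',
      div_eq_iff hdz, Complex.ofReal_one]
    linear_combination (2 * Complex.I * (d z : ℂ)) * hGC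
  rw [e1] at hfin
  have hfin2 : Tendsto (fun τ : ℝ => d z * Real.Gamma (β₀ - b) * (Real.exp τ) ^ c *
      calE β β₀ d (Real.exp τ)) atTop (nhds 1) := by
    have h2 := (Complex.continuous_re.tendsto _).comp hfin
    rw [Complex.ofReal_re] at h2
    refine h2.congr fun τ => ?_
    have : ((d z : ℂ) * ((Real.Gamma (β₀ - b) : ℝ) : ℂ) / (2 * Real.pi * Complex.I)) *
      (2 * Real.pi * Complex.I * (((Real.exp τ) ^ c * calE β β₀ d (Real.exp τ) : ℝ) : ℂ)) =
      ((d z * Real.Gamma (β₀ - b) * (Real.exp τ) ^ c * calE β β₀ d (Real.exp τ) : ℝ) : ℂ) := by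
      have hI := Complex.I_ne_zero
      rw [div_mul_eq_mul_div, div_eq_iff (by simp [hpiC])]
      push_cast; ring
    simp only [Function.comp]
    rw [this, Complex.ofReal_re]
  refine (hfin2.comp Real.tendsto_log_atTop).congr' ?_
  filter_upwards [eventually_gt_atTop 0] with t ht
  simp only [Function.comp, Real.exp_log ht]
  rw [show 1 + b - β₀ = c by rw [hc]; ring]
end
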